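/- Let (c,a) ∈ S_p and let V₁, V₂ ∈ B_{c,a} be two distinct components of the cycle of periodic Fatou components containing the orbit of c. If ∂V₁ ∩ ∂V₂ ≠ ∅, then ∂V₁ ∩ ∂V₂ is a single point {q}, and this point satisfies f_{c,a}^p(q) = q. -/

import Mathlib

open Set Function Filter Topology Metric

noncomputable section

/-- The cubic polynomial `f_{c,a}(z) = z^3 - 3c^2 z + a`, with critical points `c` and `-c`. -/
def cubic (c a : ℂ) : ℂ → ℂ := fun z => z ^ 3 - 3 * c ^ 2 * z + a

/-- The critically periodic curve `S_p`: parameters for which the critical point `c`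
has exact period `p`. -/
def Sp (p : ℕ) : Set (ℂ × ℂ) :=
  {w | (cubic w.1 w.2)^[p] w.1 = w.1 ∧ ∀ k, 1 ≤ k → k < p → (cubic w.1 w.2)^[k] w.1 ≠ w.1}

/-- `S_p^*`: the curve `S_p` minus the finitely many parameters for which `-c` meets
the orbit of `c`. -/
def SpStar (p : ℕ) : Set (ℂ × ℂ) :=
  {w ∈ Sp p | ∀ k, 0 < k → k ≤ p → (cubic w.1 w.2)^[k] w.1 ≠ -w.1}

/-- The filled Julia set of a polynomial: points with bounded forward orbit. -/
def filledJulia (f : ℂ → ℂ) : Set ℂ :=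
  {z | Bornology.IsBounded (range fun n => f^[n] z)}

/-- The Julia set of a polynomial: the boundary of the filled Julia set. -/
def juliaSet (f : ℂ → ℂ) : Set ℂ := frontier (filledJulia f)

/-- The Fatou set of a polynomial. -/
def fatouSet (f : ℂ → ℂ) : Set ℂ := (juliaSet f)ᶜ

/-- The Fatou component containing a point `z`. -/
def fatouComponent (f : ℂ → ℂ) (z : ℂ) : Set ℂ := connectedComponentIn (fatouSet f) z

/-- The orbit of `z` converges to an attracting periodic cycle of `f`. -/
def AttractedToAttractingCycle (f : ℂ → ℂ) (z : ℂ) : Prop :=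
  ∃ n : ℕ, 0 < n ∧ ∃ w : ℂ, f^[n] w = w ∧ ‖deriv (f^[n]) w‖ < 1 ∧
    Tendsto (fun k => f^[n * k] z) atTop (𝓝 w)

/-- A parameter `(c,a)` is hyperbolic if both critical points `c`, `-c` of `f_{c,a}`
are attracted to attracting cycles. -/
def IsHyperbolicParam (w : ℂ × ℂ) : Prop :=
  AttractedToAttractingCycle (cubic w.1 w.2) w.1 ∧
    AttractedToAttractingCycle (cubic w.1 w.2) (-w.1)

/-- The hyperbolic locus on `S_p`. -/
def hypLocus (p : ℕ) : Set (ℂ × ℂ) := {w ∈ Sp p | IsHyperbolicParam w}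

/-- A hyperbolic component on `S_p`: a connected component of the hyperbolic locus. -/
def IsHyperbolicComponent (p : ℕ) (H : Set (ℂ × ℂ)) : Prop :=
  ∃ w ∈ hypLocus p, H = connectedComponentIn (hypLocus p) w

/-- A Jordan curve: a homeomorphic image of the unit circle. -/
def IsJordanCurve {X : Type*} [TopologicalSpace X] (Γ : Set X) : Prop :=
  ∃ φ : ↥(sphere (0 : ℂ) 1) → X, Continuous φ ∧ Injective φ ∧ range φ = Γ

/-- A Jordan disk in `ℂ`: an open connected set bounded by a Jordan curve. -/
def IsJordanDisk (S : Set ℂ) : Prop :=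
  IsOpen S ∧ IsConnected S ∧ IsJordanCurve (frontier S)

/-- `A_{c,a}`: the union of the `p` Fatou components containing the superattracting
orbit of `c`. -/
def critBasin (p : ℕ) (w : ℂ × ℂ) : Set ℂ :=
  ⋃ k ∈ Finset.range p, fatouComponent (cubic w.1 w.2) ((cubic w.1 w.2)^[k] w.1)

/-- The connectedness locus `C(S_p)`. -/
def connLocus (p : ℕ) : Set (ℂ × ℂ) :=
  {w ∈ Sp p | IsConnected (juliaSet (cubic w.1 w.2))}

/-- `C₀(S_p)`: parameters in `C(S_p)` whose free critical orbit never enters `A_{c,a}`. -/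
def connLocus0 (p : ℕ) : Set (ℂ × ℂ) :=
  {w ∈ connLocus p | ∀ k : ℕ, (cubic w.1 w.2)^[k] (-w.1) ∉ critBasin p w}

/-- A Böttcher coordinate of `g` at a superattracting fixed point `z₀`, defined on an
open set `U`, conjugating `g` to `z ↦ z^d`, injective near `z₀`. -/
structure IsBottcherAt (g : ℂ → ℂ) (z₀ : ℂ) (B : ℂ → ℂ) (U : Set ℂ) (d : ℕ) : Prop where
  open_dom : IsOpen U
  mem : z₀ ∈ U
  mapsTo : MapsTo g U U
  analytic : AnalyticOnNhd ℂ B U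
  zero : B z₀ = 0
  two_le : 2 ≤ d
  conj : ∀ z ∈ U, B (g z) = B z ^ d
  inj : ∃ V ⊆ U, IsOpen V ∧ z₀ ∈ V ∧ InjOn B V

/-- A Böttcher coordinate of `g` defined on a whole (super)attracting Fatou
component `U`, a conformal isomorphism onto the unit disk conjugating `g` to `z ↦ z^d`. -/
structure IsFullBottcher (g : ℂ → ℂ) (z₀ : ℂ) (U : Set ℂ) (B : ℂ → ℂ) (d : ℕ) : Prop where
  two_le : 2 ≤ d
  analytic : AnalyticOnNhd ℂ B U
  bij : BijOn B U (ball (0 : ℂ) 1)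
  zero : B z₀ = 0
  conj : ∀ z ∈ U, B (g z) = B z ^ d

/-- The basin of infinity of a polynomial. -/
def basinInf (f : ℂ → ℂ) : Set ℂ := {z | Tendsto (fun n => ‖f^[n] z‖) atTop atTop}

/-- A Böttcher coordinate of a cubic polynomial near infinity, tangent to the identity. -/
structure IsBottcherInf (f : ℂ → ℂ) (B : ℂ → ℂ) (R₀ : ℝ) : Prop where
  one_le : 1 ≤ R₀
  analytic : AnalyticOnNhd ℂ B {z : ℂ | R₀ < ‖z‖}
  inj : InjOn B {z : ℂ | R₀ < ‖z‖}
  mapsTo : ∀ z : ℂ, R₀ < ‖z‖ → R₀ < ‖f z‖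
  conj : ∀ z : ℂ, R₀ < ‖z‖ → B (f z) = B z ^ 3
  asymp : Tendsto (fun z => B z / z) (Bornology.cobounded ℂ) (𝓝 1)

/-- A Böttcher coordinate of a cubic polynomial defined on the whole basin of infinity
(available when the Julia set is connected). -/
structure IsFullBottcherInf (f : ℂ → ℂ) (B : ℂ → ℂ) : Prop where
  analytic : AnalyticOnNhd ℂ B (basinInf f)
  inj : InjOn B (basinInf f)
  conj : ∀ z ∈ basinInf f, B (f z) = B z ^ 3
  asymp : Tendsto (fun z => B z / z) (Bornology.cobounded ℂ) (𝓝 1)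

/-- The external ray of angle `θ` (for a cubic polynomial), described through a Böttcher
coordinate `B` near infinity: points whose large iterates lie on the straight part of the
ray of angle `3^n θ`. -/
def extRaySet (f B : ℂ → ℂ) (R₀ : ℝ) (θ : ℝ) : Set ℂ :=
  {z | ∃ N : ℕ, ∀ n, N ≤ n → R₀ < ‖f^[n] z‖ ∧
    ∃ r : ℝ, 1 < r ∧
      B (f^[n] z) = (r : ℂ) * Complex.exp (2 * Real.pi * Complex.I * ((3 : ℂ) ^ n * (θ : ℂ)))}

/-- `R` is the external ray of angle `θ` of `f`. -/
def IsExternalRaySet (f : ℂ → ℂ) (θ : ℝ) (R : Set ℂ) : Prop :=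
  ∃ B R₀, IsBottcherInf f B R₀ ∧ R = extRaySet f B R₀ θ

/-- The internal ray of angle `θ` (w.r.t. a Böttcher coordinate `B` of `f^p` at the
superattracting periodic point `z₀`) in the Fatou component of `z₀`. -/
def intRaySet (p : ℕ) (f : ℂ → ℂ) (z₀ : ℂ) (B : ℂ → ℂ) (U : Set ℂ) (θ : ℝ) : Set ℂ :=
  {z ∈ fatouComponent f z₀ | ∃ N : ℕ, ∀ n, N ≤ n → f^[p * n] z ∈ U ∧
    ∃ r : ℝ, 0 ≤ r ∧ r < 1 ∧
      B (f^[p * n] z) = (r : ℂ) * Complex.exp (2 * Real.pi * Complex.I * ((2 : ℂ) ^ n * (θ : ℂ)))}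

/-- `R` is the internal ray of angle `θ` of `f` in the periodic Fatou component of `z₀`. -/
def IsInternalRaySet (p : ℕ) (f : ℂ → ℂ) (z₀ : ℂ) (θ : ℝ) (R : Set ℂ) : Prop :=
  ∃ B U d, IsBottcherAt (f^[p]) z₀ B U d ∧ R = intRaySet p f z₀ B U θ

/-- A ray `R` (as a set) lands at the point `q`. -/
def LandsAt (R : Set ℂ) (q : ℂ) : Prop := IsConnected R ∧ closure R \ R = {q}

/-- `q` is a repelling periodic point of `f`. -/
def IsRepellingPeriodicPt (f : ℂ → ℂ) (q : ℂ) : Prop :=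
  ∃ n : ℕ, 0 < n ∧ f^[n] q = q ∧ 1 < ‖deriv (f^[n]) q‖

/-- `q` is a parabolic periodic point of `f`: its multiplier is a root of unity. -/
def IsParabolicPeriodicPt (f : ℂ → ℂ) (q : ℂ) : Prop :=
  ∃ n : ℕ, 0 < n ∧ f^[n] q = q ∧ ∃ m : ℕ, 0 < m ∧ (deriv (f^[n]) q) ^ m = 1

/-- `f` has a parabolic periodic point. -/
def HasParabolicPoint (f : ℂ → ℂ) : Prop := ∃ q, IsParabolicPeriodicPt f q

/-- The Green function of the basin of infinity. -/
def greenInf (f : ℂ → ℂ) (z : ℂ) : ℝ :=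
  limUnder atTop fun n : ℕ => Real.log ‖f^[n] z‖ / 3 ^ n

/-- The Green function of a periodic Fatou component containing the orbit point `w₀`. -/
def greenComp (p : ℕ) (f : ℂ → ℂ) (w₀ z : ℂ) : ℝ :=
  limUnder atTop fun n : ℕ => Real.log ‖f^[p * n] z - w₀‖ / 2 ^ n

/-- The truncated plane `X_{c,a}`: the plane minus the equipotential trap near infinity
and near the superattracting cycle. -/
def Xset (p : ℕ) (c a : ℂ) : Set ℂ :=
  {z | ¬ (z ∈ basinInf (cubic c a) ∧ 1 ≤ greenInf (cubic c a) z) ∧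
    ∀ k, k < p → ¬ (z ∈ fatouComponent (cubic c a) ((cubic c a)^[k] c) ∧
      greenComp p (cubic c a) ((cubic c a)^[k] c) z ≤ -1)}

/-- `G = γ_{c,a}(θ)`: the forward invariant graph generated by the closed internal ray of
angle `θ` in `U_{c,a}(c)` together with the closures of all external rays landing at its
landing point. -/
def IsGammaGraph (p : ℕ) (c a : ℂ) (θ : ℝ) (G : Set ℂ) : Prop :=
  ∃ (Rint : Set ℂ) (ζ : ℂ), IsInternalRaySet p (cubic c a) c θ Rint ∧
    closure Rint \ Rint = {ζ} ∧
    G = ⋃ k : ℕ, (cubic c a)^[k] ''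
      (closure Rint ∪ ⋃₀ {S | ∃ t R, IsExternalRaySet (cubic c a) t R ∧
        closure R \ R = {ζ} ∧ S = closure R})

/-- A puzzle for `f` (with periodic critical point of period `p`) relative to the
truncated plane `X`. -/
structure IsPuzzle (p : ℕ) (f : ℂ → ℂ) (X Γ : Set ℂ) : Prop where
  subset_closure : Γ ⊆ closure X
  boundary_subset : frontier X ⊆ Γ
  compact : IsCompact Γ
  forward_inv : f '' (Γ ∩ f^[p] ⁻¹' X) ⊆ Γ
  crit_avoid : ∀ c' : ℂ, deriv f c' = 0 → ∀ k : ℕ, f^[k] c' ∉ Γ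

/-- The puzzle piece of depth `n` containing `z`. -/
def pieceAt (f : ℂ → ℂ) (X Γ : Set ℂ) (n : ℕ) (z : ℂ) : Set ℂ :=
  connectedComponentIn (f^[n] ⁻¹' (X \ Γ)) z

/-- An `ℓ`-admissible puzzle. -/
structure IsAdmissiblePuzzle (ℓ p : ℕ) (f : ℂ → ℂ) (X Γ : Set ℂ) : Prop where
  puzzle : IsPuzzle p f X Γ
  nondeg : ∀ c' : ℂ, deriv f c' = 0 → c' ∈ juliaSet f →
    ∃ d : ℕ, closure (pieceAt f X Γ (d + ℓ) c') ⊆ pieceAt f X Γ d c'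
  repelling : ∀ z ∈ Γ ∩ juliaSet f, ∀ n : ℕ, 0 < n → f^[n] z = z →
    1 < ‖deriv (f^[n]) z‖
  jordan : ∀ (n : ℕ) (z : ℂ), z ∈ f^[n] ⁻¹' (X \ Γ) → IsJordanDisk (pieceAt f X Γ n z)

/-- The tableau `T_f(z)` is periodic. -/
def TableauPeriodic (f : ℂ → ℂ) (X Γ : Set ℂ) (z : ℂ) : Prop :=
  ∃ k : ℕ, 1 ≤ k ∧ ∀ n : ℕ, pieceAt f X Γ n z = f^[k] '' pieceAt f X Γ (n + k) z

/-- `x` combinatorially accumulates to `y` (for `f`). -/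
def CombAcc (f : ℂ → ℂ) (X Γ : Set ℂ) (x y : ℂ) : Prop :=
  ∀ n : ℕ, ∃ j : ℕ, 0 < j ∧ f^[j] '' pieceAt f X Γ (n + j) x = pieceAt f X Γ n y

/-- `x` combinatorially accumulates to `y` for `g = f^p` (puzzle depths in `pℕ`). -/
def CombAccG (p : ℕ) (f : ℂ → ℂ) (X Γ : Set ℂ) (x y : ℂ) : Prop :=
  ∀ n : ℕ, ∃ j : ℕ, 0 < j ∧
    f^[p * j] '' pieceAt f X Γ (p * n + p * j) x = pieceAt f X Γ (p * n) y

/-- Critical points of `f` on the Julia set. -/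
def critJulia (f : ℂ → ℂ) : Set ℂ := {z | deriv f z = 0 ∧ z ∈ juliaSet f}

/-- `[x]_f`: critical points combinatorially bi-accumulating with `x`. -/
def critClass (f : ℂ → ℂ) (X Γ : Set ℂ) (x : ℂ) : Set ℂ :=
  {c' ∈ critJulia f | CombAcc f X Γ x c' ∧ CombAcc f X Γ c' x}

/-- `P_{n+k}(c')` is a child of `P_n(c₁)`: the map
`f^(k-1) : P_{n+k-1}(f(c')) → P_n(c₁)` is conformal. -/
def IsChild (f : ℂ → ℂ) (X Γ : Set ℂ) (n k : ℕ) (c' c₁ : ℂ) : Prop :=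
  0 < k ∧ f^[k - 1] '' pieceAt f X Γ (n + k - 1) (f c') = pieceAt f X Γ n c₁ ∧
    InjOn (f^[k - 1]) (pieceAt f X Γ (n + k - 1) (f c'))

/-- The critical piece `P_n(c₁)` has only finitely many children. -/
def FinitelyManyChildren (f : ℂ → ℂ) (X Γ : Set ℂ) (n : ℕ) (c₁ : ℂ) : Prop :=
  Set.Finite {q : ℂ × ℕ | q.1 ∈ critJulia f ∧ IsChild f X Γ n q.2 q.1 c₁}

/-- The tableau of `x` is persistently recurrent. -/
def PersistentlyRecurrent (f : ℂ → ℂ) (X Γ : Set ℂ) (x : ℂ) : Prop :=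
  CombAcc f X Γ x x ∧ ∀ c₁ ∈ critClass f X Γ x, ∀ n : ℕ, FinitelyManyChildren f X Γ n c₁

/-- A function on a subset of `ℂ²` is analytic along every analytic disc contained in it
(this expresses holomorphy of a function on an analytic curve in `ℂ²`). -/
def AnalyticOnSlice (Φ : ℂ × ℂ → ℂ) (H : Set (ℂ × ℂ)) : Prop :=
  ∀ (U : Set ℂ) (γ : ℂ → ℂ × ℂ), IsOpen U →
    AnalyticOnNhd ℂ (fun t => (γ t).1) U → AnalyticOnNhd ℂ (fun t => (γ t).2) U →
    (∀ t ∈ U, γ t ∈ H) → AnalyticOnNhd ℂ (fun t => Φ (γ t)) U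

/-- A quasiconformal homeomorphism of the plane (metric definition: bounded circular
distortion). -/
def IsQCHomeo (φ : ℂ → ℂ) : Prop :=
  Continuous φ ∧ Bijective φ ∧ ∃ K : ℝ, ∀ x : ℂ,
    Filter.limsup (fun r : ℝ =>
        sSup ((fun y => dist (φ y) (φ x)) '' sphere x r) /
          sInf ((fun y => dist (φ y) (φ x)) '' sphere x r)) (𝓝[>] (0 : ℝ)) ≤ K

/-- The sector of the parameter disk coordinate `Φ`, of radii `> 1 - 1/(k+1)` and
angles within `1/(k+1)` of `t`. -/
def paramSector (Φ : ℂ × ℂ → ℂ) (H : Set (ℂ × ℂ)) (t : ℝ) (k : ℕ) : Set (ℂ × ℂ) :=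
  {w ∈ H | ∃ r θ' : ℝ, 1 - 1 / (k + 1) < r ∧ r < 1 ∧ |θ' - t| < 1 / (k + 1) ∧
    Φ w = (r : ℂ) * Complex.exp (2 * Real.pi * Complex.I * (θ' : ℂ))}

/-- The impression of the parameter ray of angle `t`. -/
def impression (Φ : ℂ × ℂ → ℂ) (H : Set (ℂ × ℂ)) (t : ℝ) : Set (ℂ × ℂ) :=
  ⋂ k : ℕ, closure (paramSector Φ H t k)

end

namespace RayLanding

/-! ### Logarithms along curves, normalised at infinity -/

theorem eq_of_exp_eq_const {X : Type*} [TopologicalSpace X] {S : Set X} (hS : IsPreconnected S)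
    {h : X → ℂ} (hc : ContinuousOn h S) {k : ℂ} (hk : ∀ x ∈ S, Complex.exp (h x) = k)
    {x y : X} (hx : x ∈ S) (hy : y ∈ S) : h x = h y := by
  have := Complex.isCoveringMap_exp.eqOn_of_comp_eqOn hS hc (continuousOn_const (c := h x))
    (fun z hz => by
      apply Subtype.ext
      simp only [comp_apply]
      rw [hk z hz, hk x hx]) hx rfl
  exact (this hy).symm

theorem eq_of_exp_eq {X : Type*} [TopologicalSpace X] {S : Set X} (hS : IsPreconnected S)
    {u v : X → ℂ} (hu : ContinuousOn u S) (hv : ContinuousOn v S)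
    (h : ∀ x ∈ S, Complex.exp (u x) = Complex.exp (v x))
    {x y : X} (hx : x ∈ S) (hy : y ∈ S) : u x - v x = u y - v y :=
  eq_of_exp_eq_const hS (hu.sub hv) (k := 1)
    (fun z hz => by rw [Pi.sub_apply, Complex.exp_sub, h z hz, div_self (Complex.exp_ne_zero _)]) hx hy

/-- `u` is a continuous logarithm of `φ` on `[s, ∞)` asymptotic to `A`. -/
structure IsLogFrom (A φ u : ℝ → ℂ) (s : ℝ) : Prop where
  cont : ContinuousOn u (Ici s)
  exp_eq : ∀ t, s ≤ t → Complex.exp (u t) = φ t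
  lim : Tendsto (fun t => u t - A t) atTop (𝓝 0)

theorem IsLogFrom.mono {A φ u : ℝ → ℂ} {s s' : ℝ} (h : IsLogFrom A φ u s) (hs : s ≤ s') :
    IsLogFrom A φ u s' :=
  ⟨h.cont.mono (Ici_subset_Ici.2 hs), fun t ht => h.exp_eq t (hs.trans ht), h.lim⟩

theorem IsLogFrom.eq {A φ u v : ℝ → ℂ} {s : ℝ} (hu : IsLogFrom A φ u s)
    (hv : IsLogFrom A φ v s) {t : ℝ} (ht : s ≤ t) : u t = v t := by
  have h1 : ∀ t', s ≤ t' → u t' - v t' = u t - v t := fun t' ht' =>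
    eq_of_exp_eq isPreconnected_Ici hu.cont hv.cont
      (fun x hx => by rw [hu.exp_eq x hx, hv.exp_eq x hx]) ht' ht
  have h2 : Tendsto (fun t => u t - v t) atTop (𝓝 0) := by
    have := hu.lim.sub hv.lim
    simpa using this
  have h3 : Tendsto (fun _ : ℝ => u t - v t) atTop (𝓝 0) :=
    h2.congr' ((eventually_ge_atTop s).mono fun t' ht' => h1 t' ht')
  exact sub_eq_zero.1 (tendsto_nhds_unique tendsto_const_nhds h3)

theorem exists_continuous_log {φ : ℝ → ℂ} (hφ : Continuous φ) (h0 : ∀ t, φ t ≠ 0) :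
    ∃ u : ℝ → ℂ, Continuous u ∧ ∀ t, Complex.exp (u t) = φ t := by
  obtain ⟨F, ⟨-, hF⟩, -⟩ := Complex.isCoveringMapOn_exp.existsUnique_continuousMap_lifts
    ⟨φ, hφ⟩ (a₀ := 0) (e₀ := Complex.log (φ 0)) (by simp [Complex.exp_log (h0 0)])
    (fun a => by simpa using h0 a)
  exact ⟨F, F.continuous, fun t => congrFun hF t⟩

theorem exists_isLogFrom {A φ : ℝ → ℂ} (hA : Continuous A) {s : ℝ} (hφ : ContinuousOn φ (Ici s))
    (h0 : ∀ t, s ≤ t → φ t ≠ 0)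
    (hlim : Tendsto (fun t => φ t * Complex.exp (-A t)) atTop (𝓝 1)) :
    ∃ u, IsLogFrom A φ u s := by
  obtain ⟨u, hu, hue⟩ := exists_continuous_log (φ := fun t => φ (max s t))
    (hφ.comp_continuous (by fun_prop) (fun t => mem_Ici.2 (le_max_left _ _))) (fun t => h0 _ (le_max_left _ _))
  have hexp : ∀ t, s ≤ t → Complex.exp (u t) = φ t := fun t ht => by
    rw [hue t, max_eq_right ht]
  have hslit : ∀ᶠ t in atTop, φ t * Complex.exp (-A t) ∈ Complex.slitPlane :=
    hlim.eventually (Complex.isOpen_slitPlane.mem_nhds (by simp))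
  obtain ⟨T, hT⟩ := (hslit.and (eventually_ge_atTop s)).exists_forall_of_atTop
  set L : ℝ → ℂ := fun t => Complex.log (φ t * Complex.exp (-A t)) with hL
  have hTs : s ≤ T := (hT T le_rfl).2
  have hLc : ContinuousOn L (Ici T) := by
    refine ContinuousOn.clog ?_ (fun t ht => (hT t ht).1)
    exact (hφ.mono (Ici_subset_Ici.2 hTs)).mul (by fun_prop)
  have hLlim : Tendsto L atTop (𝓝 0) := by
    have := hlim.clog (by simp)
    simpa using this
  set k := u T - (A T + L T) with hk
  have hLe : ∀ t, T ≤ t → Complex.exp (A t + L t) = φ t := fun t ht => by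
    rw [Complex.exp_add, hL, Complex.exp_log (Complex.slitPlane_ne_zero (hT t ht).1),
      Complex.exp_neg]
    field_simp [Complex.exp_ne_zero]
  have hconst : ∀ t, T ≤ t → u t - (A t + L t) = k := fun t ht =>
    eq_of_exp_eq (S := Ici T) isPreconnected_Ici hu.continuousOn (hA.continuousOn.add hLc)
      (fun x hx => by
        change _ = Complex.exp (A x + L x)
        rw [hexp x (hTs.trans hx), hLe x hx]) ht self_mem_Ici
  have hk1 : Complex.exp k = 1 := by
    rw [hk, Complex.exp_sub, hexp T hTs, hLe T le_rfl, div_self (h0 T hTs)]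
  refine ⟨fun t => u t - k, (hu.sub continuous_const).continuousOn, fun t ht => ?_, ?_⟩
  · rw [Complex.exp_sub, hk1, div_one, hexp t ht]
  · refine hLlim.congr' ((eventually_ge_atTop T).mono fun t ht => ?_)
    have := hconst t ht
    linear_combination -this

open Classical in
/-- The logarithm at `s` of the curve `φ`, normalised to be asymptotic to `A` at infinity. -/
noncomputable def nlog (A φ : ℝ → ℂ) (s : ℝ) : ℂ :=
  if h : ∃ u, IsLogFrom A φ u s then h.choose s else 0

theorem IsLogFrom.nlog_eq {A φ u : ℝ → ℂ} {s : ℝ} (h : IsLogFrom A φ u s) {t : ℝ} (ht : s ≤ t) :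
    nlog A φ t = u t := by
  have h' : ∃ u, IsLogFrom A φ u t := ⟨u, h.mono ht⟩
  rw [nlog, dif_pos h']
  exact h'.choose_spec.eq (h.mono ht) le_rfl

theorem isLogFrom_nlog {A φ : ℝ → ℂ} (hA : Continuous A) {s : ℝ} (hφ : ContinuousOn φ (Ici s))
    (h0 : ∀ t, s ≤ t → φ t ≠ 0)
    (hlim : Tendsto (fun t => φ t * Complex.exp (-A t)) atTop (𝓝 1)) :
    IsLogFrom A φ (nlog A φ) s := by
  obtain ⟨u, hu⟩ := exists_isLogFrom hA hφ h0 hlim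
  refine ⟨hu.cont.congr fun t ht => hu.nlog_eq ht, fun t ht => ?_, ?_⟩
  · rw [hu.nlog_eq ht, hu.exp_eq t ht]
  · exact hu.lim.congr' ((eventually_ge_atTop s).mono fun t ht => by simp only [hu.nlog_eq ht])

/-! ### Asymptotic rays -/

/-- The straight line of slope `κ` and height `α` (in logarithmic coordinates). -/
noncomputable def line (κ α : ℝ) (s : ℝ) : ℂ := (1 + κ * Complex.I) * s + α * Complex.I

theorem continuous_line (κ α : ℝ) : Continuous (line κ α) := by unfold line; fun_prop

@[simp] theorem line_re (κ α s : ℝ) : (line κ α s).re = s := by simp [line]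

theorem line_sub (κ α β s t : ℝ) :
    line κ α s - line κ β t = line κ (α - β) (s - t) := by
  simp [line]; ring

/-- A continuous curve asymptotic to the image under `exp` of a line. -/
structure IsRay (κ α : ℝ) (γ : ℝ → ℂ) : Prop where
  cont : Continuous γ
  lim : Tendsto (fun s => γ s * Complex.exp (-line κ α s)) atTop (𝓝 1)

theorem tendsto_exp_neg_line (κ α : ℝ) :
    Tendsto (fun s => Complex.exp (-line κ α s)) atTop (𝓝 0) := by
  rw [Complex.tendsto_exp_nhds_zero_iff]
  simp only [Complex.neg_re, line_re]
  exact tendsto_neg_atTop_atBot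

theorem IsRay.lim_sub {κ α : ℝ} {γ : ℝ → ℂ} (h : IsRay κ α γ) (v : ℂ) :
    Tendsto (fun s => (γ s - v) * Complex.exp (-line κ α s)) atTop (𝓝 1) := by
  have := h.lim.sub ((tendsto_exp_neg_line κ α).const_mul v)
  simp only [mul_zero, sub_zero] at this
  exact this.congr fun s => by ring

theorem IsRay.tendsto_norm {κ α : ℝ} {γ : ℝ → ℂ} (h : IsRay κ α γ) :
    Tendsto (fun s => ‖γ s‖) atTop atTop := by
  have h1 : Tendsto (fun s => ‖γ s * Complex.exp (-line κ α s)‖) atTop (𝓝 1) := by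
    simpa using h.lim.norm
  have h2 := h1.pos_mul_atTop one_pos Real.tendsto_exp_atTop
  refine h2.congr fun s => ?_
  rw [norm_mul, Complex.norm_exp, Complex.neg_re, line_re, Real.exp_neg]
  field_simp

/-- The logarithm of `γ s - v`, normalised at infinity. -/
noncomputable def ell (κ α : ℝ) (γ : ℝ → ℂ) (v : ℂ) (s : ℝ) : ℂ :=
  nlog (line κ α) (fun t => γ t - v) s

theorem IsRay.isLogFrom {κ α : ℝ} {γ : ℝ → ℂ} (h : IsRay κ α γ) {v : ℂ} {s : ℝ}
    (hv : ∀ t, s ≤ t → γ t ≠ v) :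
    IsLogFrom (line κ α) (fun t => γ t - v) (ell κ α γ v) s :=
  isLogFrom_nlog (continuous_line κ α) (h.cont.sub continuous_const).continuousOn
    (fun t ht => sub_ne_zero.2 (hv t ht)) (h.lim_sub v)

theorem IsRay.exp_ell {κ α : ℝ} {γ : ℝ → ℂ} (h : IsRay κ α γ) {v : ℂ} {s : ℝ}
    (hv : ∀ t, s ≤ t → γ t ≠ v) : Complex.exp (ell κ α γ v s) = γ s - v :=
  (h.isLogFrom hv).exp_eq s le_rfl

theorem IsRay.eventually_ne {κ α : ℝ} {γ : ℝ → ℂ} (h : IsRay κ α γ) (v : ℂ) :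
    ∃ s, ∀ t, s ≤ t → γ t ≠ v := by
  obtain ⟨s, hs⟩ := (h.tendsto_norm.eventually_gt_atTop ‖v‖).exists_forall_of_atTop
  exact ⟨s, fun t ht e => by have := hs t ht; rw [e] at this; exact lt_irrefl _ this⟩

theorem IsRay.ell_lim {κ α : ℝ} {γ : ℝ → ℂ} (h : IsRay κ α γ) (v : ℂ) :
    Tendsto (fun s => ell κ α γ v s - line κ α s) atTop (𝓝 0) := by
  obtain ⟨s, hs⟩ := h.eventually_ne v
  exact (h.isLogFrom hs).lim

theorem isClosed_image_Ici {κ α : ℝ} {γ : ℝ → ℂ} (h : IsRay κ α γ) (s : ℝ) :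
    IsClosed (γ '' Ici s) := by
  refine isClosed_of_closure_subset fun w hw => ?_
  obtain ⟨T, hT⟩ := (h.tendsto_norm.eventually_gt_atTop (‖w‖ + 1)).exists_forall_of_atTop
  have hsub : γ '' Ici s ⊆ γ '' Icc s T ∪ {z | ‖w‖ + 1 ≤ ‖z‖} := by
    rintro _ ⟨t, ht, rfl⟩
    rcases le_total t T with h1 | h1
    · exact Or.inl ⟨t, ⟨ht, h1⟩, rfl⟩
    · exact Or.inr (hT t h1).le
  have hcl : IsClosed (γ '' Icc s T ∪ {z | ‖w‖ + 1 ≤ ‖z‖}) :=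
    (isCompact_Icc.image h.cont).isClosed.union (isClosed_le continuous_const continuous_norm)
  rcases closure_minimal hsub hcl hw with ⟨t, ht, rfl⟩ | h2
  · exact ⟨t, ht.1, rfl⟩
  · have h3 : ‖w‖ + 1 ≤ ‖w‖ := h2
    linarith

/-- Moving the base point inside a disc that misses the ray. -/
theorem IsRay.ell_shift {κ α : ℝ} {γ : ℝ → ℂ} (h : IsRay κ α γ) {v v' : ℂ} {s r : ℝ}
    (hr : ∀ t, s ≤ t → r ≤ ‖γ t - v‖) (hv' : ‖v' - v‖ < r) {t : ℝ} (ht : s ≤ t) :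
    ell κ α γ v' t = ell κ α γ v t + Complex.log (1 - (v' - v) / (γ t - v)) := by
  have hr0 : 0 < r := (norm_nonneg _).trans_lt hv'
  have hv : ∀ t, s ≤ t → γ t ≠ v := fun t ht e => by
    have := hr t ht; rw [e] at this; simp at this; linarith
  have hlt : ∀ t, s ≤ t → ‖(v' - v) / (γ t - v)‖ < 1 := fun t ht => by
    rw [norm_div, div_lt_one (hr0.trans_le (hr t ht))]
    exact hv'.trans_le (hr t ht)
  have hslit : ∀ t, s ≤ t → 1 - (v' - v) / (γ t - v) ∈ Complex.slitPlane := fun t ht => by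
    have := Complex.mem_slitPlane_of_norm_lt_one (z := -((v' - v) / (γ t - v)))
      (by rw [norm_neg]; exact hlt t ht)
    rwa [← sub_eq_add_neg] at this
  have hl := h.isLogFrom hv
  have : IsLogFrom (line κ α) (fun t => γ t - v')
      (fun t => ell κ α γ v t + Complex.log (1 - (v' - v) / (γ t - v))) s := by
    refine ⟨hl.cont.add (ContinuousOn.clog ?_ fun t ht => hslit t ht), fun t ht => ?_, ?_⟩
    · refine continuousOn_const.sub (continuousOn_const.div
        (h.cont.sub continuous_const).continuousOn fun t ht => sub_ne_zero.2 (hv t ht))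
    · rw [Complex.exp_add, hl.exp_eq t ht, Complex.exp_log (Complex.slitPlane_ne_zero (hslit t ht))]
      have := sub_ne_zero.2 (hv t ht)
      field_simp
      ring
    · have h1 : Tendsto (fun t => (v' - v) / (γ t - v)) atTop (𝓝 0) := by
        rw [tendsto_zero_iff_norm_tendsto_zero]
        simp only [norm_div]
        refine tendsto_const_nhds.div_atTop ?_
        refine tendsto_atTop_mono (fun t => norm_sub_norm_le _ _) ?_
        exact tendsto_atTop_add_const_right _ _ h.tendsto_norm
      have h2 : Tendsto (fun t => Complex.log (1 - (v' - v) / (γ t - v))) atTop (𝓝 0) := by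
        have := (tendsto_const_nhds (x := (1:ℂ)) |>.sub h1).clog (by simp)
        simpa using this
      have := hl.lim.add h2
      simp only [add_zero] at this
      exact this.congr fun t => by ring
  exact this.nlog_eq ht

theorem IsRay.exists_dist {κ α : ℝ} {γ : ℝ → ℂ} (h : IsRay κ α γ) {v : ℂ} {s : ℝ}
    (hv : ∀ t, s ≤ t → γ t ≠ v) : ∃ r > 0, ∀ t, s ≤ t → r ≤ ‖γ t - v‖ := by
  have hm : v ∈ (γ '' Ici s)ᶜ := by
    rintro ⟨t, ht, e⟩; exact hv t ht e
  obtain ⟨r, hr, hb⟩ := Metric.isOpen_iff.1 (isClosed_image_Ici h s).isOpen_compl v hm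
  refine ⟨r, hr, fun t ht => ?_⟩
  by_contra hlt
  exact hb (show γ t ∈ ball v r by rw [mem_ball, dist_eq_norm]; exact not_le.1 hlt) ⟨t, ht, rfl⟩

theorem IsRay.exists_lt_ne {κ α : ℝ} {γ : ℝ → ℂ} (h : IsRay κ α γ) {v : ℂ} {s : ℝ}
    (hv : ∀ t, s ≤ t → γ t ≠ v) : ∃ s₁ < s, ∀ t, s₁ ≤ t → γ t ≠ v := by
  have h1 : ∀ᶠ t in 𝓝 s, γ t ≠ v := h.cont.continuousAt.eventually_ne (hv s le_rfl)
  obtain ⟨ε, hε, hb⟩ := Metric.eventually_nhds_iff.1 h1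
  refine ⟨s - ε / 2, by linarith, fun t ht => ?_⟩
  rcases le_total s t with h2 | h2
  · exact hv t h2
  · exact hb (by rw [Real.dist_eq, abs_lt]; constructor <;> linarith)

/-- Joint continuity of the normalised logarithm. -/
theorem IsRay.continuousAt_ell {κ α : ℝ} {γ : ℝ → ℂ} (h : IsRay κ α γ) {v : ℂ} {s : ℝ}
    (hv : ∀ t, s ≤ t → γ t ≠ v) :
    ContinuousAt (fun p : ℂ × ℝ => ell κ α γ p.1 p.2) (v, s) := by
  obtain ⟨s₁, hs₁, hv₁⟩ := h.exists_lt_ne hv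
  obtain ⟨r, hr0, hr⟩ := h.exists_dist hv₁
  have hev : ∀ᶠ p : ℂ × ℝ in 𝓝 (v, s), ell κ α γ p.1 p.2 =
      ell κ α γ v p.2 + Complex.log (1 - (p.1 - v) / (γ p.2 - v)) := by
    have h1 : ∀ᶠ p : ℂ × ℝ in 𝓝 (v, s), ‖p.1 - v‖ < r := by
      have : Continuous fun p : ℂ × ℝ => ‖p.1 - v‖ := by fun_prop
      exact this.continuousAt.eventually (gt_mem_nhds (by simpa using hr0))
    have h2 : ∀ᶠ p : ℂ × ℝ in 𝓝 (v, s), s₁ < p.2 :=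
      continuousAt_snd.eventually (lt_mem_nhds hs₁)
    filter_upwards [h1, h2] with p hp hp2
    exact h.ell_shift hr hp hp2.le
  refine ContinuousAt.congr_of_eventuallyEq ?_ hev
  have hne : γ s - v ≠ 0 := sub_ne_zero.2 (hv s le_rfl)
  refine ContinuousAt.add ?_ ?_
  · have : ContinuousAt (ell κ α γ v) s := (h.isLogFrom hv₁).cont.continuousAt (Ici_mem_nhds hs₁)
    exact ContinuousAt.comp (f := fun p : ℂ × ℝ => p.2) (x := (v, s)) this continuousAt_snd
  · refine ContinuousAt.clog ?_ (by simp)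
    refine continuousAt_const.sub (ContinuousAt.div (by fun_prop) ?_ hne)
    exact (h.cont.continuousAt.comp continuousAt_snd).sub continuousAt_const

theorem IsRay.ell_eq_log {κ α : ℝ} {γ : ℝ → ℂ} (h : IsRay κ α γ) {v : ℂ} {s : ℝ}
    (hs : ∀ t, s ≤ t → (γ t - v) * Complex.exp (-line κ α t) ∈ Complex.slitPlane) :
    ell κ α γ v s = line κ α s + Complex.log ((γ s - v) * Complex.exp (-line κ α s)) := by
  have : IsLogFrom (line κ α) (fun t => γ t - v)
      (fun t => line κ α t + Complex.log ((γ t - v) * Complex.exp (-line κ α t))) s := by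
    refine ⟨(continuous_line κ α).continuousOn.add (ContinuousOn.clog ?_ fun t ht => hs t ht),
      fun t ht => ?_, ?_⟩
    · have := h.cont
      have := continuous_line κ α
      fun_prop
    · rw [Complex.exp_add, Complex.exp_log (Complex.slitPlane_ne_zero (hs t ht)), Complex.exp_neg]
      have := Complex.exp_ne_zero (line κ α t)
      field_simp
    · have := (h.lim_sub v).clog (by simp)
      simpa using this
  exact this.nlog_eq le_rfl

theorem exists_dist_exp_line {κ β : ℝ} (hβ : Complex.exp (-(β * Complex.I)) ≠ 1) :
    ∃ δ > 0, ∀ τ, 0 ≤ τ → δ ≤ ‖1 - Complex.exp (-line κ β τ)‖ := by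
  have hc : Continuous fun τ => ‖1 - Complex.exp (-line κ β τ)‖ := by
    have := continuous_line κ β
    fun_prop
  have hl : Tendsto (fun τ => ‖1 - Complex.exp (-line κ β τ)‖) atTop (𝓝 1) := by
    simpa using ((tendsto_exp_neg_line κ β).const_sub 1).norm
  have hpos : ∀ τ, 0 ≤ τ → 0 < ‖1 - Complex.exp (-line κ β τ)‖ := fun τ hτ => by
    rw [norm_pos_iff, sub_ne_zero]
    intro e
    have h1 := congrArg norm e
    rw [norm_one, Complex.norm_exp, eq_comm, Real.exp_eq_one_iff] at h1
    simp only [Complex.neg_re, line_re, neg_eq_zero] at h1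
    subst h1
    apply hβ
    rw [e]; simp [line]
  obtain ⟨T, hT⟩ := (hl.eventually (lt_mem_nhds (show (1/2 : ℝ) < 1 by norm_num))).exists_forall_of_atTop
  obtain ⟨x, hx, hmin⟩ := (isCompact_Icc (a := (0:ℝ)) (b := max T 0)).exists_isMinOn
    ⟨0, by simp⟩ hc.continuousOn
  refine ⟨min (1/2) ‖1 - Complex.exp (-line κ β x)‖, lt_min (by norm_num) (hpos x hx.1), fun τ hτ => ?_⟩
  rcases le_total τ (max T 0) with h1 | h1
  · exact (min_le_right _ _).trans (hmin ⟨hτ, h1⟩)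
  · exact (min_le_left _ _).trans (hT τ ((le_max_left _ _).trans h1)).le

theorem mem_slitPlane_of_near {w a b : ℂ} {δ : ℝ} (hw : ‖w‖ ≤ 1) (hd : δ ≤ ‖1 - w‖)
    (ha : ‖a - 1‖ < δ / 2) (hb : ‖b - 1‖ < δ / 2) : a - b * w ∈ Complex.slitPlane := by
  by_contra hn
  rw [Complex.mem_slitPlane_iff, not_or, not_lt, not_not] at hn
  set e := (a - 1) - (b - 1) * w with he
  have hq : a - b * w = (1 - w) + e := by rw [he]; ring
  have hen : ‖e‖ < δ := by
    have h1 : ‖(b - 1) * w‖ ≤ ‖b - 1‖ := by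
      rw [norm_mul]; exact mul_le_of_le_one_right (norm_nonneg _) hw
    have := norm_sub_le (a - 1) ((b - 1) * w)
    linarith
  have hre : 0 ≤ (1 - w).re := by
    have := (Complex.re_le_norm w).trans hw
    simp only [Complex.sub_re, Complex.one_re]; linarith
  rw [hq, Complex.add_re, Complex.add_im] at hn
  have h1 : Complex.normSq (1 - w) ≤ Complex.normSq e := by
    rw [Complex.normSq_apply, Complex.normSq_apply]
    have : (1 - w).im = - e.im := by linarith [hn.2]
    rw [this]
    nlinarith [hn.1]
  rw [Complex.normSq_eq_norm_sq, Complex.normSq_eq_norm_sq] at h1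
  have := abs_le_of_sq_le_sq h1 (norm_nonneg _)
  rw [abs_of_nonneg (norm_nonneg _)] at this
  linarith

theorem sub_mul_exp_line (κ α α' : ℝ) (x y : ℂ) (s t : ℝ) :
    (y - x) * Complex.exp (-line κ α' t) = y * Complex.exp (-line κ α' t) -
      x * Complex.exp (-line κ α s) * Complex.exp (-line κ (α' - α) (t - s)) := by
  rw [mul_assoc x, ← Complex.exp_add, ← line_sub]
  ring_nf

theorem IsRay.eventually_slit {κ α α' : ℝ} {γ γ' : ℝ → ℂ} (h : IsRay κ α γ)
    (h' : IsRay κ α' γ') (hβ : Complex.exp (-((α' - α : ℝ) * Complex.I)) ≠ 1) :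
    ∃ T, ∀ s, T ≤ s → ∀ t, s ≤ t →
      (γ' t - γ s) * Complex.exp (-line κ α' t) ∈ Complex.slitPlane := by
  obtain ⟨δ, hδ, hd⟩ := exists_dist_exp_line (κ := κ) hβ
  have h1 := h.lim.eventually (Metric.ball_mem_nhds 1 (half_pos hδ))
  have h2 := h'.lim.eventually (Metric.ball_mem_nhds 1 (half_pos hδ))
  obtain ⟨T, hT⟩ := (h1.and h2).exists_forall_of_atTop
  refine ⟨T, fun s hs t ht => ?_⟩
  rw [sub_mul_exp_line κ α α' _ _ s t]
  refine mem_slitPlane_of_near ?_ (hd (t - s) (by linarith)) ?_ ?_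
  · rw [Complex.norm_exp, Real.exp_le_one_iff]; simp; linarith
  · exact mem_ball_iff_norm.1 (hT t (hs.trans ht)).2
  · exact mem_ball_iff_norm.1 (hT s hs).1

theorem log_one_sub_exp {β : ℝ} (h0 : 0 < β) (h1 : β < 2 * Real.pi) :
    Complex.log (1 - Complex.exp (-(β * Complex.I))) - Complex.log (1 - Complex.exp (β * Complex.I))
      = (Real.pi - β) * Complex.I := by
  have hs : 0 < Real.sin (β / 2) := Real.sin_pos_of_pos_of_lt_pi (by linarith) (by linarith)
  have e : ∀ θ : ℝ, (1 : ℂ) - Complex.exp (θ * Complex.I) =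
      2 * Complex.sin (θ / 2) * (-Complex.I) * Complex.exp (θ / 2 * Complex.I) := fun θ => by
    have h2 : Complex.exp (θ * Complex.I) = Complex.exp (θ / 2 * Complex.I) ^ 2 := by
      rw [← Complex.exp_nat_mul]; congr 1; push_cast; ring
    have h3 : Complex.exp (-(θ / 2) * Complex.I) = (Complex.exp (θ / 2 * Complex.I))⁻¹ := by
      rw [← Complex.exp_neg]; congr 1; ring
    rw [h2, Complex.sin, h3]
    have := Complex.exp_ne_zero (θ / 2 * Complex.I)
    field_simp
    ring_nf
    simp [Complex.I_sq]
    ring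
  have e1 : (1 : ℂ) - Complex.exp (β * Complex.I) =
      ((2 * Real.sin (β / 2) : ℝ) : ℂ) * Complex.exp (((β - Real.pi) / 2 : ℝ) * Complex.I) := by
    rw [e β]
    have : Complex.exp (((β - Real.pi) / 2 : ℝ) * Complex.I) =
        (-Complex.I) * Complex.exp (β / 2 * Complex.I) := by
      rw [show (((β - Real.pi) / 2 : ℝ) : ℂ) * Complex.I =
        β / 2 * Complex.I - Real.pi / 2 * Complex.I by push_cast; ring, Complex.exp_sub,
        Complex.exp_pi_div_two_mul_I, div_eq_mul_inv, Complex.inv_I]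
      ring
    rw [this]; push_cast; ring
  have e2 : (1 : ℂ) - Complex.exp (-(β * Complex.I)) =
      ((2 * Real.sin (β / 2) : ℝ) : ℂ) * Complex.exp (((Real.pi - β) / 2 : ℝ) * Complex.I) := by
    have h4 := congrArg (starRingEnd ℂ) e1
    simp only [map_sub, map_one, ← Complex.exp_conj, map_mul, Complex.conj_ofReal,
      Complex.conj_I] at h4
    rw [show -(β * Complex.I : ℂ) = β * -Complex.I by ring, h4]
    congr 2; push_cast; ring
  have hp : (0:ℝ) < 2 * Real.sin (β / 2) := by positivity
  rw [e1, e2, Complex.log_ofReal_mul hp (Complex.exp_ne_zero _),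
    Complex.log_ofReal_mul hp (Complex.exp_ne_zero _), Complex.log_exp, Complex.log_exp]
  · push_cast; ring
  all_goals
    simp
    try linarith [Real.pi_pos]

/-- Two disjoint asymptotic rays with heights `α < α' < α + 2π`. -/
theorem IsRay.ell_swap {κ α α' : ℝ} {γ γ' : ℝ → ℂ} (h : IsRay κ α γ)
    (h' : IsRay κ α' γ') (h0 : α < α') (h2 : α' < α + 2 * Real.pi) {s s' : ℝ}
    (hd : ∀ t t', s ≤ t → s' ≤ t' → γ t ≠ γ' t') :
    ell κ α' γ' (γ s) s' = ell κ α γ (γ' s') s + Real.pi * Complex.I := by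
  set F : ℝ × ℝ → ℂ := fun p => ell κ α' γ' (γ p.1) p.2 - ell κ α γ (γ' p.2) p.1 with hF
  have hpre : IsPreconnected (Ici s ×ˢ Ici s') := isPreconnected_Ici.prod isPreconnected_Ici
  have hcont : ContinuousOn F (Ici s ×ˢ Ici s') := by
    rintro ⟨x, y⟩ ⟨hx, hy⟩
    refine ContinuousAt.continuousWithinAt (ContinuousAt.sub ?_ ?_)
    · have := h'.continuousAt_ell (v := γ x) (s := y)
        (fun t ht => (hd x t hx (le_trans hy ht)).symm)
      exact ContinuousAt.comp (f := fun p : ℝ × ℝ => (γ p.1, p.2)) (x := (x, y)) this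
        ((h.cont.comp continuous_fst).prodMk continuous_snd).continuousAt
    · have := h.continuousAt_ell (v := γ' y) (s := x) (fun t ht => hd t y (le_trans hx ht) hy)
      exact ContinuousAt.comp (f := fun p : ℝ × ℝ => (γ' p.2, p.1)) (x := (x, y)) this
        ((h'.cont.comp continuous_snd).prodMk continuous_fst).continuousAt
  have hexp : ∀ p ∈ Ici s ×ˢ Ici s', Complex.exp (F p) = -1 := by
    rintro ⟨x, y⟩ ⟨hx, hy⟩
    have hne : γ x - γ' y ≠ 0 := sub_ne_zero.2 (hd x y hx hy)
    rw [hF, Complex.exp_sub, h'.exp_ell (fun t ht => (hd x t hx (le_trans hy ht)).symm),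
      h.exp_ell (fun t ht => hd t y (le_trans hx ht) hy), div_eq_iff hne]
    ring
  have hpi := Real.pi_pos
  have key : Complex.exp (-((α' - α : ℝ) * Complex.I)) ≠ 1 := by
    intro e
    obtain ⟨n, hn⟩ := Complex.exp_eq_one_iff.1 e
    have := congrArg Complex.im hn
    simp at this
    have h3 : (-1 : ℝ) < n := by
      by_contra! hc; nlinarith
    have h4 : (n : ℝ) < 0 := by
      by_contra! hc; nlinarith
    have h5 : (-1 : ℤ) < n := by exact_mod_cast h3
    have h6 : n < 0 := by exact_mod_cast h4
    omega
  have key' : Complex.exp (-((α - α' : ℝ) * Complex.I)) ≠ 1 := by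
    intro e
    apply key
    have : -((α' - α : ℝ) * Complex.I : ℂ) = -(-((α - α' : ℝ) * Complex.I)) := by push_cast; ring
    rw [this, Complex.exp_neg, e, inv_one]
  obtain ⟨T, hT⟩ := h.eventually_slit h' key
  obtain ⟨T', hT'⟩ := h'.eventually_slit h key'
  set β : ℝ := α' - α with hβ
  have hval : ∀ t, max T T' ≤ t → F (t, t) = β * Complex.I +
      Complex.log (γ' t * Complex.exp (-line κ α' t) -
        γ t * Complex.exp (-line κ α t) * Complex.exp (-(β * Complex.I))) -
      Complex.log (γ t * Complex.exp (-line κ α t) -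
        γ' t * Complex.exp (-line κ α' t) * Complex.exp (β * Complex.I)) := fun t ht => by
    have e1 : line κ α' t - line κ α t = β * Complex.I := by simp [line, hβ]; ring
    have e2 : line κ (α' - α) (t - t) = β * Complex.I := by simp [line, hβ]
    have e3 : -line κ (α - α') (t - t) = β * Complex.I := by simp [line, hβ]; ring
    rw [hF]
    simp only
    rw [h'.ell_eq_log (hT t (le_trans (le_max_left _ _) ht)),
      h.ell_eq_log (hT' t (le_trans (le_max_right _ _) ht)), sub_mul_exp_line κ α α' _ _ t t,
      sub_mul_exp_line κ α' α _ _ t t, e2, e3]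
    linear_combination e1
  have hlimF : Tendsto (fun t => F (t, t)) atTop (𝓝 (Real.pi * Complex.I)) := by
    have hn1 : (1 : ℂ) - 1 * Complex.exp (-(β * Complex.I)) ∈ Complex.slitPlane := by
      refine mem_slitPlane_of_near (δ := ‖1 - Complex.exp (-(β * Complex.I))‖) ?_ le_rfl ?_ ?_
      · rw [Complex.norm_exp]; simp
      all_goals simpa using sub_ne_zero.2 (Ne.symm key)
    have key2 : Complex.exp (β * Complex.I) ≠ 1 := by
      intro e; apply key; rw [Complex.exp_neg, e, inv_one]
    have hn2 : (1 : ℂ) - 1 * Complex.exp (β * Complex.I) ∈ Complex.slitPlane := by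
      refine mem_slitPlane_of_near (δ := ‖1 - Complex.exp (β * Complex.I)‖) ?_ le_rfl ?_ ?_
      · rw [Complex.norm_exp]; simp
      all_goals simpa using sub_ne_zero.2 (Ne.symm key2)
    have l1 := ((h'.lim.sub (h.lim.mul_const (Complex.exp (-(β * Complex.I))))).clog hn1).const_add
      (β * Complex.I)
    have l2 := (h.lim.sub (h'.lim.mul_const (Complex.exp (β * Complex.I)))).clog hn2
    have l3 := l1.sub l2
    have e4 : (β * Complex.I : ℂ) + Complex.log (1 - 1 * Complex.exp (-(β * Complex.I))) -
        Complex.log (1 - 1 * Complex.exp (β * Complex.I)) = Real.pi * Complex.I := by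
      have := log_one_sub_exp (β := β) (by linarith) (by linarith)
      rw [one_mul, one_mul, add_sub_assoc, this]; ring
    rw [e4] at l3
    exact l3.congr' ((eventually_ge_atTop (max T T')).mono fun t ht => (hval t ht).symm)
  have hconst : Tendsto (fun _ : ℝ => F (s, s')) atTop (𝓝 (Real.pi * Complex.I)) := by
    refine hlimF.congr' ((eventually_ge_atTop (max s s')).mono fun t ht => ?_)
    exact eq_of_exp_eq_const hpre hcont hexp
      ⟨(le_max_left s s').trans ht, (le_max_right s s').trans ht⟩ ⟨self_mem_Ici, self_mem_Ici⟩
  have := tendsto_nhds_unique tendsto_const_nhds hconst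
  rw [hF] at this
  linear_combination this

/-! ### Systems of fixed rays -/

/-- Height (in logarithmic coordinates) of the `j`-th fixed ray of a polynomial of degree `D`. -/
noncomputable def height (D : ℕ) (j : ℤ) : ℝ := 2 * Real.pi * j / (D - 1)

/-- The fixed external rays of a monic polynomial, parametrised so as to land at parameter `0`. -/
structure RaySystem (g : Polynomial ℂ) (κ : ℝ) (R : ℤ → ℝ → ℂ) : Prop where
  monic : g.Monic
  two_le : 2 ≤ g.natDegree
  ray : ∀ j, IsRay κ (height g.natDegree j) (R j)
  conj : ∀ j s, 0 ≤ s → g.eval (R j s) = R j (g.natDegree * s)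
  disj : ∀ j j' s s', 0 < s → 0 ≤ s' → R j s = R j' s' →
    s = s' ∧ ((g.natDegree : ℤ) - 1) ∣ j - j'
  per : ∀ j, R (j + ((g.natDegree : ℤ) - 1)) = R j

/-- The fixed points of `g`. -/
noncomputable def fixedPts (g : Polynomial ℂ) : Finset ℂ := (g - Polynomial.X).roots.toFinset

/-- The multiplicity of a fixed point of `g`. -/
noncomputable def fixedMult (g : Polynomial ℂ) (z : ℂ) : ℕ := (g - Polynomial.X).roots.count z

namespace RaySystem

variable {g : Polynomial ℂ} {κ : ℝ} {R : ℤ → ℝ → ℂ}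

/-- The logarithm of `R j s - v`. -/
noncomputable abbrev lg (g : Polynomial ℂ) (κ : ℝ) (R : ℤ → ℝ → ℂ) (j : ℤ) (v : ℂ) (s : ℝ) : ℂ :=
  ell κ (height g.natDegree j) (R j) v s

theorem one_lt (h : RaySystem g κ R) : (1 : ℝ) < g.natDegree := by
  exact_mod_cast h.two_le

theorem monic_sub_X (h : RaySystem g κ R) : (g - Polynomial.X).Monic :=
  h.monic.sub_of_left (by
    rw [Polynomial.degree_X, Polynomial.degree_eq_natDegree h.monic.ne_zero]
    exact_mod_cast h.two_le)

theorem natDegree_sub_X (h : RaySystem g κ R) : (g - Polynomial.X).natDegree = g.natDegree :=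
  Polynomial.natDegree_sub_eq_left_of_natDegree_lt (by
    rw [Polynomial.natDegree_X]; exact h.two_le)

theorem mem_fixedPts (h : RaySystem g κ R) {z : ℂ} : z ∈ fixedPts g ↔ g.eval z = z := by
  rw [fixedPts, Multiset.mem_toFinset, Polynomial.mem_roots h.monic_sub_X.ne_zero]
  simp [Polynomial.IsRoot, sub_eq_zero]

theorem sum_fixedMult (h : RaySystem g κ R) : ∑ z ∈ fixedPts g, fixedMult g z = g.natDegree := by
  rw [← h.natDegree_sub_X, (IsAlgClosed.splits (g - Polynomial.X)).natDegree_eq_card_roots]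
  exact Multiset.toFinset_sum_count_eq _

theorem one_le_fixedMult {z : ℂ} (hz : z ∈ fixedPts g) : 1 ≤ fixedMult g z := by
  rw [fixedPts, Multiset.mem_toFinset] at hz
  exact Multiset.one_le_count_iff_mem.2 hz

theorem eval_sub_eq_prod (h : RaySystem g κ R) (w : ℂ) :
    g.eval w - w = ∏ z ∈ fixedPts g, (w - z) ^ fixedMult g z := by
  have := (IsAlgClosed.splits (g - Polynomial.X)).eval_eq_prod_roots_of_monic h.monic_sub_X w
  rw [Finset.prod_multiset_map_count] at this
  simpa [fixedPts, fixedMult] using this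

theorem ne_fixed (h : RaySystem g κ R) {j : ℤ} {s : ℝ} (hs : 0 < s) {z : ℂ}
    (hz : g.eval z = z) : R j s ≠ z := by
  intro e
  have h1 := h.conj j s hs.le
  rw [e, hz, ← e] at h1
  have h2 := (h.disj j j s _ hs (mul_nonneg (Nat.cast_nonneg _) hs.le) h1).1
  have := h.one_lt
  nlinarith

theorem fixed_zero (h : RaySystem g κ R) (j : ℤ) : g.eval (R j 0) = R j 0 := by
  simpa using h.conj j 0 le_rfl

theorem height_succ (h : RaySystem g κ R) (j : ℤ) :
    g.natDegree * height g.natDegree j = height g.natDegree j + 2 * Real.pi * j := by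
  have := h.one_lt
  have h1 : (g.natDegree : ℝ) - 1 ≠ 0 := by linarith
  unfold height
  field_simp
  ring

theorem sum_lg (h : RaySystem g κ R) (j : ℤ) {s : ℝ} (hs : 0 < s) :
    ∑ z ∈ fixedPts g, fixedMult g z * lg g κ R j z s =
      lg g κ R j (R j s) (g.natDegree * s) + 2 * Real.pi * Complex.I * j := by
  have hD := h.one_lt
  set D : ℝ := (g.natDegree : ℝ) with hDdef
  set α := height g.natDegree j with hα
  have hne : ∀ z ∈ fixedPts g, ∀ s, 0 < s → ∀ t, s ≤ t → R j t ≠ z := fun z hz s hs t ht =>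
    h.ne_fixed (hs.trans_le ht) (h.mem_fixedPts.1 hz)
  have hne2 : ∀ s, 0 < s → ∀ t, D * s ≤ t → R j t ≠ R j s := fun s hs t ht e => by
    have h1 : s < t := by nlinarith
    exact h1.ne' (h.disj j j t s (hs.trans h1) hs.le e).1
  set F : ℝ → ℂ := fun s => ∑ z ∈ fixedPts g, fixedMult g z * lg g κ R j z s with hF
  set G : ℝ → ℂ := fun s => lg g κ R j (R j s) (D * s) with hG
  have hFc : ContinuousOn F (Ioi 0) := by
    refine continuousOn_finsetSum _ fun z hz s hs => ContinuousAt.continuousWithinAt ?_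
    refine continuousAt_const.mul ?_
    have := (h.ray j).continuousAt_ell (hne z hz s hs)
    exact ContinuousAt.comp (f := fun s : ℝ => (z, s)) this (by fun_prop)
  have hGc : ContinuousOn G (Ioi 0) := by
    intro s hs
    refine ContinuousAt.continuousWithinAt ?_
    have := (h.ray j).continuousAt_ell (hne2 s hs)
    have hc := (h.ray j).cont
    exact ContinuousAt.comp (f := fun s : ℝ => (R j s, D * s)) this (by fun_prop)
  have hexp : ∀ x ∈ Ioi (0 : ℝ), Complex.exp (F x) = Complex.exp (G x) := fun x hx => by
    rw [hF, hG]
    simp only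
    rw [(h.ray j).exp_ell (hne2 x hx), Complex.exp_sum, ← h.conj j x (le_of_lt hx),
      h.eval_sub_eq_prod]
    refine Finset.prod_congr rfl fun z hz => ?_
    rw [Complex.exp_nat_mul, (h.ray j).exp_ell (hne z hz x hx)]
  have hconst : ∀ x, 0 < x → F x - G x = F s - G s := fun x hx =>
    eq_of_exp_eq isPreconnected_Ioi hFc hGc hexp hx hs
  have l1 : Tendsto (fun s => F s - D * line κ α s) atTop (𝓝 0) := by
    have h1 : Tendsto (fun s => ∑ z ∈ fixedPts g, fixedMult g z * (lg g κ R j z s - line κ α s))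
        atTop (𝓝 (∑ z ∈ fixedPts g, fixedMult g z * 0)) :=
      tendsto_finsetSum _ fun z hz => ((h.ray j).ell_lim z).const_mul _
    simp only [mul_zero, Finset.sum_const_zero] at h1
    refine h1.congr fun s => ?_
    simp only [mul_sub, Finset.sum_sub_distrib, ← Finset.sum_mul, hF]
    congr 2
    rw [hDdef, ← h.sum_fixedMult]
    push_cast
    rfl
  have l2 : Tendsto (fun s => G s - line κ α (D * s)) atTop (𝓝 0) := by
    have e0 : Tendsto (fun s : ℝ => D * s) atTop atTop := tendsto_id.const_mul_atTop (by linarith)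
    have e1 : ∃ T, ∀ s, T ≤ s → ‖R j s * Complex.exp (-line κ α s) - 1‖ < 1 / 8 ∧ 0 < s ∧
        Real.exp (-((D - 1) * s)) < 1 / 8 := by
      have a1 := (h.ray j).lim.eventually (Metric.ball_mem_nhds 1 (show (0:ℝ) < 1/8 by norm_num))
      have a2 : Tendsto (fun s : ℝ => Real.exp (-((D - 1) * s))) atTop (𝓝 0) :=
        Real.tendsto_exp_neg_atTop_nhds_zero.comp
          (tendsto_id.const_mul_atTop (by linarith : 0 < D - 1))
      have a3 := a2.eventually (gt_mem_nhds (show (0:ℝ) < 1/8 by norm_num))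
      obtain ⟨T, hT⟩ := (a1.and ((eventually_gt_atTop 0).and a3)).exists_forall_of_atTop
      exact ⟨T, fun s hs => ⟨mem_ball_iff_norm.1 (hT s hs).1, (hT s hs).2⟩⟩
    obtain ⟨T, hT⟩ := e1
    have e2 : ∀ s, T ≤ s → ∀ t, D * s ≤ t →
        (R j t - R j s) * Complex.exp (-line κ α t) ∈ Complex.slitPlane := fun s hs t ht => by
      obtain ⟨b1, b2, b3⟩ := hT s hs
      have hst : s ≤ t := by nlinarith
      obtain ⟨c1, -, -⟩ := hT t (hs.trans hst)
      rw [sub_mul_exp_line κ α α _ _ s t]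
      have b4 : ‖Complex.exp (-line κ (α - α) (t - s))‖ < 1 / 8 := by
        rw [Complex.norm_exp]
        refine lt_of_le_of_lt (Real.exp_le_exp.2 ?_) b3
        simp only [Complex.neg_re, line_re]
        nlinarith
      refine mem_slitPlane_of_near (δ := 7 / 8) (by linarith) ?_ (by linarith) (by linarith)
      have := norm_sub_norm_le (1 : ℂ) (Complex.exp (-line κ (α - α) (t - s)))
      rw [norm_one] at this
      linarith
    have e3 : ∀ s, T ≤ s → G s - line κ α (D * s) =
        Complex.log ((R j (D * s) - R j s) * Complex.exp (-line κ α (D * s))) := fun s hs => by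
      rw [hG]
      simp only [lg]
      rw [(h.ray j).ell_eq_log (e2 s hs)]
      ring
    have e4 : Tendsto (fun s => (R j (D * s) - R j s) * Complex.exp (-line κ α (D * s))) atTop
        (𝓝 1) := by
      have f1 := (h.ray j).lim.comp e0
      have f2 : Tendsto (fun s => Complex.exp (-line κ (α - α) (D * s - s))) atTop (𝓝 0) := by
        have : Tendsto (fun s => D * s - s) atTop atTop := by
          have hD' : 0 < D - 1 := by linarith
          exact (tendsto_id.const_mul_atTop hD').congr fun s => by simp only [id]; ring
        exact (tendsto_exp_neg_line κ (α - α)).comp this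
      have f3 := f1.sub ((h.ray j).lim.mul f2)
      simp only [mul_zero, sub_zero] at f3
      refine f3.congr fun s => ?_
      rw [sub_mul_exp_line κ α α _ _ s (D * s)]
      rfl
    have e5 := e4.clog (by simp)
    rw [Complex.log_one] at e5
    exact e5.congr' ((eventually_ge_atTop T).mono fun s hs => (e3 s hs).symm)
  have l3 : ∀ s, D * line κ α s - line κ α (D * s) = 2 * Real.pi * Complex.I * j := fun s => by
    have := h.height_succ j
    rw [← hα, ← hDdef] at this
    have h2 : (D : ℂ) * α = α + 2 * Real.pi * j := by exact_mod_cast this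
    simp only [line]
    push_cast
    linear_combination Complex.I * h2
  have l4 : Tendsto (fun x => F x - G x) atTop (𝓝 (2 * Real.pi * Complex.I * j)) := by
    have := (l1.sub l2).add_const (2 * Real.pi * Complex.I * j : ℂ)
    rw [sub_zero, zero_add] at this
    refine this.congr fun x => ?_
    rw [← l3 x]; ring
  have l5 : Tendsto (fun _ : ℝ => F s - G s) atTop (𝓝 (2 * Real.pi * Complex.I * j)) :=
    l4.congr' ((eventually_gt_atTop 0).mono fun x hx => hconst x hx)
  have := tendsto_nhds_unique tendsto_const_nhds l5
  linear_combination this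

end RaySystem

theorem abs_im_log_one_sub_le {T : ℂ} (h : ‖T‖ ≤ 1) : |(Complex.log (1 - T)).im| ≤ Real.pi / 2 := by
  rw [Complex.log_im, Complex.abs_arg_le_pi_div_two_iff]
  have := (Complex.re_le_norm T).trans h
  simp only [Complex.sub_re, Complex.one_re]; linarith

theorem one_sub_mem_slitPlane {T : ℂ} (h : ‖T‖ ≤ 1) (h1 : T ≠ 1) : 1 - T ∈ Complex.slitPlane := by
  have hd : 0 < ‖1 - T‖ := norm_pos_iff.2 (sub_ne_zero.2 h1.symm)
  simpa using mem_slitPlane_of_near h le_rfl (a := 1) (b := 1) (by simpa using hd) (by simpa using hd)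

theorem IsRay.abs_im_ell_sub_le {κ α : ℝ} {γ : ℝ → ℂ} (h : IsRay κ α γ) {η : ℝ → ℂ}
    (hη : Continuous η) {t₁ S : ℝ} (ht₁ : 0 ≤ t₁)
    (hle : ∀ t, 0 ≤ t → t ≤ t₁ → ‖η t - η 0‖ ≤ ‖γ S - η 0‖)
    (hne : ∀ t, 0 ≤ t → t ≤ t₁ → ∀ t', S ≤ t' → γ t' ≠ η t) :
    |(ell κ α γ (η t₁) S - ell κ α γ (η 0) S).im| ≤ Real.pi / 2 := by
  have hm : γ S - η 0 ≠ 0 := sub_ne_zero.2 (hne 0 le_rfl ht₁ S le_rfl)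
  set T : ℝ → ℂ := fun t => (η t - η 0) / (γ S - η 0) with hT
  have hT1 : ∀ t, 0 ≤ t → t ≤ t₁ → ‖T t‖ ≤ 1 := fun t h0 h1 => by
    rw [hT]; simp only
    rw [norm_div, div_le_one (norm_pos_iff.2 hm)]
    exact hle t h0 h1
  have hTne : ∀ t, 0 ≤ t → t ≤ t₁ → T t ≠ 1 := fun t h0 h1 e => by
    rw [hT] at e; simp only at e
    rw [div_eq_one_iff_eq hm] at e
    exact hne t h0 h1 S le_rfl (sub_left_injective e).symm
  have hc : ContinuousOn (fun t => ell κ α γ (η t) S) (Icc 0 t₁) := fun t ht => by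
    refine ContinuousAt.continuousWithinAt ?_
    exact ContinuousAt.comp (f := fun t : ℝ => (η t, S)) (h.continuousAt_ell (hne t ht.1 ht.2))
      (by fun_prop)
  have hlc : ContinuousOn (fun t => ell κ α γ (η 0) S + Complex.log (1 - T t)) (Icc 0 t₁) := by
    refine continuousOn_const.add (ContinuousOn.clog (by fun_prop) fun t ht => ?_)
    exact one_sub_mem_slitPlane (hT1 t ht.1 ht.2) (hTne t ht.1 ht.2)
  have := eq_of_exp_eq isPreconnected_Icc hc hlc (fun t ht => by
    rw [h.exp_ell (hne t ht.1 ht.2), Complex.exp_add, h.exp_ell (hne 0 le_rfl ht₁), Complex.exp_log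
      (Complex.slitPlane_ne_zero (one_sub_mem_slitPlane (hT1 t ht.1 ht.2) (hTne t ht.1 ht.2)))]
    simp only [hT]
    field_simp
    ring) (right_mem_Icc.2 ht₁) (left_mem_Icc.2 ht₁)
  have h2 : ell κ α γ (η t₁) S - ell κ α γ (η 0) S = Complex.log (1 - T t₁) := by
    simp only [hT, sub_self, zero_div, sub_zero, Complex.log_one, add_zero] at this ⊢
    linear_combination this
  rw [h2]
  exact abs_im_log_one_sub_le (hT1 t₁ ht₁ le_rfl)

theorem exists_first_hit {γ : ℝ → ℂ} (hγ : Continuous γ) {ε ρ : ℝ} (hε : 0 ≤ ε) (hρ : 0 < ρ)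
    (hlt : ρ < ‖γ ε - γ 0‖) : ∃ S, 0 < S ∧ S ≤ ε ∧ ‖γ S - γ 0‖ = ρ ∧
      ∀ t, 0 ≤ t → t < S → ‖γ t - γ 0‖ < ρ := by
  have hc : Continuous fun t => ‖γ t - γ 0‖ := by fun_prop
  have hK : IsCompact (Icc 0 ε ∩ {t | ρ ≤ ‖γ t - γ 0‖}) :=
    isCompact_Icc.inter_right (isClosed_le continuous_const hc)
  obtain ⟨S, ⟨hS1, hS2⟩, hmin⟩ := hK.exists_isLeast ⟨ε, ⟨hε, le_rfl⟩, hlt.le⟩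
  have hfirst : ∀ t, 0 ≤ t → t < S → ‖γ t - γ 0‖ < ρ := fun t h0 h1 => by
    by_contra hn
    exact absurd (hmin ⟨⟨h0, h1.le.trans hS1.2⟩, not_lt.1 hn⟩) (not_le.2 h1)
  have hS0 : 0 < S := by
    rcases hS1.1.eq_or_lt with h | h
    · exfalso
      have h3 : ρ ≤ ‖γ S - γ 0‖ := hS2
      rw [← h, sub_self, norm_zero] at h3
      linarith
    · exact h
  refine ⟨S, hS0, hS1.2, le_antisymm ?_ hS2, hfirst⟩
  have hcl : S ∈ closure (Ico 0 S) := by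
    rw [closure_Ico hS0.ne]; exact ⟨hS0.le, le_rfl⟩
  have : Ico 0 S ⊆ {t | ‖γ t - γ 0‖ ≤ ρ} := fun t ht => (hfirst t ht.1 ht.2).le
  exact closure_minimal this (isClosed_le hc continuous_const) hcl

namespace RaySystem

variable {g : Polynomial ℂ} {κ : ℝ} {R : ℤ → ℝ → ℂ}

theorem not_dvd {D : ℕ} {a b : ℤ} (hab : a < b) (hba : b < a + ((D : ℤ) - 1)) :
    ¬ ((D : ℤ) - 1) ∣ b - a := by
  intro hd
  have := Int.le_of_dvd (by omega) hd
  omega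

theorem height_lt (h : RaySystem g κ R) {a b : ℤ} (hab : a < b) :
    height g.natDegree a < height g.natDegree b := by
  have := h.one_lt
  have hp := Real.pi_pos
  have h2 : (a : ℝ) < b := by exact_mod_cast hab
  exact div_lt_div_of_pos_right (by nlinarith) (by linarith)

theorem height_lt_add (h : RaySystem g κ R) {a b : ℤ} (hba : b < a + ((g.natDegree : ℤ) - 1)) :
    height g.natDegree b < height g.natDegree a + 2 * Real.pi := by
  have := h.one_lt
  have hp := Real.pi_pos
  have h2 : (b : ℝ) < a + (g.natDegree - 1) := by exact_mod_cast hba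
  have h3 : (0:ℝ) < g.natDegree - 1 := by linarith
  have h4 : height g.natDegree a + 2 * Real.pi =
      2 * Real.pi * (a + (g.natDegree - 1)) / (g.natDegree - 1) := by
    unfold height; field_simp
  rw [h4]
  exact div_lt_div_of_pos_right (by nlinarith) h3

theorem exists_norm_lt (h : RaySystem g κ R) (j : ℤ) {ε : ℝ} (hε : 0 < ε) :
    0 < ‖R j ε - R j 0‖ :=
  norm_pos_iff.2 (sub_ne_zero.2 (h.ne_fixed hε (h.fixed_zero j)))

theorem deriv_ne_zero (h : RaySystem g κ R) (j : ℤ) :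
    g.derivative.eval (R j 0) ≠ 0 := by
  intro h0
  have hd := g.hasDerivAt (R j 0)
  rw [h0] at hd
  have h1 := hd.isLittleO.def (show (0:ℝ) < 1 by norm_num)
  simp only [smul_zero, sub_zero, one_mul] at h1
  have h2 : ∀ᶠ t in 𝓝 (0:ℝ), ‖g.eval (R j t) - g.eval (R j 0)‖ ≤ ‖R j t - R j 0‖ :=
    ((h.ray j).cont.continuousAt (x := 0)).eventually h1
  obtain ⟨ε, hε, hb⟩ := Metric.eventually_nhds_iff.1 h2
  have hpos := h.exists_norm_lt j (half_pos hε)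
  obtain ⟨S, hS0, hSε, hSρ, hfirst⟩ := exists_first_hit (h.ray j).cont (half_pos hε).le
    (half_pos hpos) (by linarith)
  have hD := h.one_lt
  have hD0 : (0:ℝ) < g.natDegree := by linarith
  have h3 := hfirst (S / g.natDegree) (by positivity) (div_lt_self hS0 hD)
  have h4 := @hb (S / g.natDegree) (by
    have h6 := div_lt_self hS0 hD
    have h7 : 0 < S / g.natDegree := by positivity
    rw [Real.dist_eq, sub_zero, abs_of_pos h7]; linarith)
  rw [h.conj j _ (by positivity), h.fixed_zero, mul_div_cancel₀ _ hD0.ne', hSρ] at h4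
  linarith

theorem norm_log_sub_le (h : RaySystem g κ R) {a b : ℤ} (hab : a < b)
    (hba : b < a + ((g.natDegree : ℤ) - 1)) (hm : R a 0 = R b 0) {η : ℝ} (hη : 0 < η) :
    ∃ ε > 0, ∀ s s', 0 < s → s < ε → 0 < s' → s' < ε →
      ‖(lg g κ R b (R b 0) (g.natDegree * s') - lg g κ R b (R b 0) s') -
        (lg g κ R a (R a 0) (g.natDegree * s) - lg g κ R a (R a 0) s)‖ ≤ η := by
  have hD := h.one_lt
  set D : ℝ := (g.natDegree : ℝ) with hDdef
  set m := R a 0 with hma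
  set μ := g.derivative.eval m with hμ
  have hμ0 : μ ≠ 0 := h.deriv_ne_zero a
  have hdvd := not_dvd hab hba
  have hne : ∀ s s', 0 ≤ s → 0 ≤ s' → (0 < s ∨ 0 < s') → R a s ≠ R b s' := by
    rintro s s' hs hs' (h1 | h1) e
    · exact hdvd ((dvd_sub_comm).1 (h.disj a b s s' h1 hs' e).2)
    · exact hdvd (h.disj b a s' s h1 hs e.symm).2
  set X : ℝ × ℝ → ℂ := fun p => lg g κ R b (R a p.1) p.2 with hX
  have hswap : ∀ s s', 0 ≤ s → 0 ≤ s' → (0 < s ∨ 0 < s') →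
      X (s, s') = lg g κ R a (R b s') s + Real.pi * Complex.I := fun s s' hs hs' hp =>
    (h.ray a).ell_swap (h.ray b) (h.height_lt hab) (h.height_lt_add hba) fun t t' ht ht' =>
      hne t t' (hs.trans ht) (hs'.trans ht') (hp.imp (fun h => h.trans_le ht) fun h => h.trans_le ht')
  have hexpX : ∀ s s', 0 ≤ s → 0 ≤ s' → (0 < s ∨ 0 < s') →
      Complex.exp (X (s, s')) = R b s' - R a s := fun s s' hs hs' hp => by
    rw [hswap s s' hs hs' hp, Complex.exp_add, Complex.exp_pi_mul_I, (h.ray a).exp_ell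
      fun t ht => hne t s' (hs.trans ht) hs' (hp.imp (fun h => h.trans_le ht) id)]
    ring
  have hXc : ∀ s s', 0 ≤ s → 0 ≤ s' → (0 < s ∨ 0 < s') →
      ContinuousWithinAt X (Ici 0 ×ˢ Ici 0) (s, s') := fun s s' hs hs' hp => by
    rcases hp with hp | hp
    · have := (h.ray b).continuousAt_ell (v := R a s) (s := s')
        fun t ht => (hne s t hs (hs'.trans ht) (Or.inl hp)).symm
      refine ContinuousAt.continuousWithinAt ?_
      exact ContinuousAt.comp (f := fun p : ℝ × ℝ => (R a p.1, p.2)) (x := (s, s')) this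
        (((h.ray a).cont.comp continuous_fst).prodMk continuous_snd).continuousAt
    · have := (h.ray b).continuousAt_ell (v := R a s) (s := s')
        fun t ht => (hne s t hs (hs'.trans ht) (Or.inr (hp.trans_le ht))).symm
      refine ContinuousAt.continuousWithinAt ?_
      exact ContinuousAt.comp (f := fun p : ℝ × ℝ => (R a p.1, p.2)) (x := (s, s')) this
        (((h.ray a).cont.comp continuous_fst).prodMk continuous_snd).continuousAt
  set c : ℝ := min (1 / 4) (η / 3) with hc
  have hc0 : 0 < c := lt_min (by norm_num) (by positivity)
  have hstrict := (g.hasStrictDerivAt m).isLittleO.def (show (0:ℝ) < c * ‖μ‖ from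
    mul_pos hc0 (norm_pos_iff.2 hμ0))
  have h1 : ∀ᶠ p : ℝ × ℝ in 𝓝 (0, 0),
      ‖g.eval (R b p.2) - g.eval (R a p.1) - (R b p.2 - R a p.1) * μ‖ ≤
        c * ‖μ‖ * ‖R b p.2 - R a p.1‖ := by
    have hcont : ContinuousAt (fun p : ℝ × ℝ => (R b p.2, R a p.1)) (0, 0) :=
      (((h.ray b).cont.comp continuous_snd).prodMk ((h.ray a).cont.comp continuous_fst)).continuousAt
    have h2 : Tendsto (fun p : ℝ × ℝ => (R b p.2, R a p.1)) (𝓝 (0, 0)) (𝓝 (m, m)) := by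
      have := hcont.tendsto
      simp only [← hma, ← hm] at this
      exact this
    have := h2.eventually hstrict
    simpa [← hμ] using this
  obtain ⟨ε, hε, hb⟩ := Metric.eventually_nhds_iff.1 h1
  set W : ℝ × ℝ → ℂ := fun p => (R b (D * p.2) - R a (D * p.1)) / (R b p.2 - R a p.1) / μ with hW
  have hWn : ∀ s s', 0 ≤ s → s < ε → 0 ≤ s' → s' < ε → (0 < s ∨ 0 < s') →
      ‖W (s, s') - 1‖ ≤ c := fun s s' hs hsε hs' hsε' hp => by
    have hne' : R b s' - R a s ≠ 0 := sub_ne_zero.2 (hne s s' hs hs' hp).symm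
    have h2 := @hb (s, s') (by
      rw [Prod.dist_eq, max_lt_iff, Real.dist_eq, Real.dist_eq, sub_zero, sub_zero, abs_of_nonneg hs,
        abs_of_nonneg hs']
      exact ⟨hsε, hsε'⟩)
    simp only at h2
    rw [h.conj b s' hs', h.conj a s hs, ← hDdef] at h2
    have h3 : W (s, s') - 1 = (R b (D * s') - R a (D * s) - (R b s' - R a s) * μ) /
        ((R b s' - R a s) * μ) := by
      simp only [hW]; field_simp
    rw [h3, norm_div, norm_mul, div_le_iff₀ (mul_pos (norm_pos_iff.2 hne') (norm_pos_iff.2 hμ0))]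
    linarith
  refine ⟨ε, hε, fun s s' hs hsε hs' hsε' => ?_⟩
  set P : Set (ℝ × ℝ) := Icc 0 s ×ˢ {s'} ∪ {s} ×ˢ Icc 0 s' with hP
  have hPpre : IsPreconnected P :=
    IsPreconnected.union (s, s') (by simp [hs.le]) (by simp [hs'.le])
      (isPreconnected_Icc.prod isPreconnected_singleton)
      (isPreconnected_singleton.prod isPreconnected_Icc)
  have hPmem : ∀ p ∈ P, 0 ≤ p.1 ∧ p.1 < ε ∧ 0 ≤ p.2 ∧ p.2 < ε ∧ (0 < p.1 ∨ 0 < p.2) := by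
    rintro ⟨x, y⟩ (⟨hx, hy⟩ | ⟨hx, hy⟩)
    · simp only [mem_singleton_iff] at hy; subst hy
      exact ⟨hx.1, lt_of_le_of_lt hx.2 hsε, hs'.le, hsε', Or.inr hs'⟩
    · simp only [mem_singleton_iff] at hx; subst hx
      exact ⟨hs.le, hsε, hy.1, lt_of_le_of_lt hy.2 hsε', Or.inl hs⟩
  have hPQ : P ⊆ Ici 0 ×ˢ Ici 0 := fun p hp => ⟨(hPmem p hp).1, (hPmem p hp).2.2.1⟩
  have hDp : ∀ p ∈ P, 0 ≤ D * p.1 ∧ 0 ≤ D * p.2 ∧ (0 < D * p.1 ∨ 0 < D * p.2) := fun p hp => by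
    obtain ⟨q1, -, q2, -, q3⟩ := hPmem p hp
    exact ⟨by positivity, by positivity, q3.imp (fun _ => by positivity) fun _ => by positivity⟩
  have hslit : ∀ p ∈ P, W p ∈ Complex.slitPlane := fun p hp => by
    obtain ⟨q1, q2, q3, q4, q5⟩ := hPmem p hp
    have h2 := hWn p.1 p.2 q1 q2 q3 q4 q5
    have h3 : c ≤ 1 / 4 := min_le_left _ _
    have := Complex.mem_slitPlane_of_norm_lt_one (z := W p - 1) (by linarith)
    simpa using this
  have hqc : ContinuousOn (fun p => X (D * p.1, D * p.2) - X p) P := by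
    intro p hp
    obtain ⟨q1, q2, q3, q4, q5⟩ := hPmem p hp
    obtain ⟨r1, r2, r3⟩ := hDp p hp
    refine ContinuousWithinAt.sub ?_ ((hXc p.1 p.2 q1 q3 q5).mono hPQ)
    exact ContinuousWithinAt.comp (t := Ici 0 ×ˢ Ici 0) (f := fun p : ℝ × ℝ => (D * p.1, D * p.2))
      (hXc _ _ r1 r2 r3) (by fun_prop) fun q hq => ⟨(hDp q hq).1, (hDp q hq).2.1⟩
  have hlc : ContinuousOn (fun p => Complex.log μ + Complex.log (W p)) P := by
    refine continuousOn_const.add (ContinuousOn.clog ?_ hslit)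
    have c1 := (h.ray a).cont
    have c2 := (h.ray b).cont
    refine ContinuousOn.div_const (ContinuousOn.div (by fun_prop) (by fun_prop) fun p hp => ?_) _
    obtain ⟨q1, q2, q3, q4, q5⟩ := hPmem p hp
    exact sub_ne_zero.2 (hne p.1 p.2 q1 q3 q5).symm
  have hm1 : ((0 : ℝ), s') ∈ P := Or.inl ⟨⟨le_rfl, hs.le⟩, rfl⟩
  have hm2 : (s, (0 : ℝ)) ∈ P := Or.inr ⟨rfl, le_rfl, hs'.le⟩
  have hkey := eq_of_exp_eq hPpre hqc hlc (fun p hp => by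
    obtain ⟨q1, q2, q3, q4, q5⟩ := hPmem p hp
    obtain ⟨r1, r2, r3⟩ := hDp p hp
    have hne' : R b p.2 - R a p.1 ≠ 0 := sub_ne_zero.2 (hne p.1 p.2 q1 q3 q5).symm
    rw [Complex.exp_sub, hexpX _ _ r1 r2 r3, hexpX p.1 p.2 q1 q3 q5, Complex.exp_add,
      Complex.exp_log hμ0, Complex.exp_log (Complex.slitPlane_ne_zero (hslit p hp))]
    simp only [hW]
    field_simp) hm1 hm2
  have hlogW : ∀ p ∈ P, ‖Complex.log (W p)‖ ≤ 3 / 2 * c := fun p hp => by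
    obtain ⟨q1, q2, q3, q4, q5⟩ := hPmem p hp
    have h2 := hWn p.1 p.2 q1 q2 q3 q4 q5
    have h3 : c ≤ 1 / 4 := min_le_left _ _
    have := Complex.norm_log_one_add_half_le_self (z := W p - 1) (by linarith)
    rw [add_sub_cancel] at this
    linarith
  have e1 : X (D * 0, D * s') - X (0, s') =
      lg g κ R b (R b 0) (D * s') - lg g κ R b (R b 0) s' := by
    simp only [hX, mul_zero, ← hma, hm]
  have e2 : X (D * s, D * 0) - X (s, 0) = lg g κ R a m (D * s) - lg g κ R a m s := by
    rw [hswap _ _ (by positivity) (by positivity) (Or.inl (by positivity)),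
      hswap _ _ hs.le le_rfl (Or.inl hs), mul_zero, ← hm]
    ring
  have e3 : (lg g κ R b (R b 0) (D * s') - lg g κ R b (R b 0) s') -
      (lg g κ R a m (D * s) - lg g κ R a m s) = Complex.log (W (0, s')) - Complex.log (W (s, 0)) := by
    rw [← e1, ← e2]
    linear_combination hkey
  rw [e3]
  have h4 := norm_sub_le (Complex.log (W (0, s'))) (Complex.log (W (s, 0)))
  have h5 := hlogW _ hm1
  have h6 := hlogW _ hm2
  have h7 : c ≤ η / 3 := min_le_right _ _
  linarith

end RaySystem

namespace RaySystem

variable {g : Polynomial ℂ} {κ : ℝ} {R : ℤ → ℝ → ℂ}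

theorem continuousAt_lg (h : RaySystem g κ R) {j : ℤ} {z : ℂ} {s : ℝ}
    (hz : ∀ t, s ≤ t → R j t ≠ z) : ContinuousAt (fun s => lg g κ R j z s) s :=
  ContinuousAt.comp (f := fun s : ℝ => (z, s)) ((h.ray j).continuousAt_ell hz) (by fun_prop)

theorem ne_of_fixed (h : RaySystem g κ R) {j : ℤ} {z : ℂ} (hz : g.eval z = z) (hne : R j 0 ≠ z)
    {t : ℝ} (ht : 0 ≤ t) : R j t ≠ z := by
  rcases ht.eq_or_lt with h0 | h0
  · rwa [← h0]
  · exact h.ne_fixed h0 hz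

theorem disjoint_rays (h : RaySystem g κ R) {a b : ℤ} (hab : a < b)
    (hba : b < a + ((g.natDegree : ℤ) - 1)) {s s' : ℝ} (hs : 0 ≤ s) (hs' : 0 ≤ s')
    (hp : 0 < s ∨ 0 < s') : R a s ≠ R b s' := by
  have hdvd := not_dvd hab hba
  rcases hp with h1 | h1 <;> intro e
  · exact hdvd (dvd_sub_comm.1 (h.disj a b s s' h1 hs' e).2)
  · exact hdvd (h.disj b a s' s h1 hs e.symm).2

theorem im_lg_sub_le (h : RaySystem g κ R) {a b : ℤ} (hab : a < b)
    (hba : b < a + ((g.natDegree : ℤ) - 1)) (hm : R a 0 = R b 0) {Sa Sb : ℝ} (ha : 0 < Sa)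
    (hb : 0 < Sb) (hae : ∀ t, 0 ≤ t → t ≤ Sa → ‖R a t - R a 0‖ ≤ ‖R b Sb - R b 0‖)
    (hbe : ∀ t, 0 ≤ t → t ≤ Sb → ‖R b t - R b 0‖ ≤ ‖R a Sa - R a 0‖) :
    (lg g κ R b (R b 0) Sb - lg g κ R a (R a 0) Sa).im ≤ 2 * Real.pi := by
  have h1 := (h.ray b).abs_im_ell_sub_le (h.ray a).cont (S := Sb) ha.le
    (fun t h0 h1 => by have := hae t h0 h1; rwa [← hm] at this)
    fun t h0 _ t' ht' => (h.disjoint_rays hab hba h0 (hb.le.trans ht') (Or.inr (by linarith))).symm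
  have h2 := (h.ray a).abs_im_ell_sub_le (h.ray b).cont (S := Sa) hb.le
    (fun t h0 h1 => by have := hbe t h0 h1; rwa [hm] at this)
    fun t h0 _ t' ht' => h.disjoint_rays hab hba (ha.le.trans ht') h0 (Or.inl (by linarith))
  have h3 := (h.ray a).ell_swap (h.ray b) (s := Sa) (s' := Sb) (h.height_lt hab)
    (h.height_lt_add hba) fun t t' ht ht' =>
      h.disjoint_rays hab hba (ha.le.trans ht) (hb.le.trans ht') (Or.inl (by linarith))
  rw [h3, hm] at h1
  rw [← hm] at h2
  simp only [Complex.sub_im, Complex.add_im, Complex.mul_im, Complex.ofReal_re, Complex.I_im,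
    Complex.ofReal_im, Complex.I_re, mul_one, mul_zero, add_zero] at h1 h2 ⊢
  rw [abs_le] at h1 h2
  simp only [lg]
  rw [hm] at h2 ⊢
  linarith [h1.1, h2.2]

theorem le_sum_winding (h : RaySystem g κ R) {a b : ℤ} (hab : a < b)
    (hba : b < a + ((g.natDegree : ℤ) - 1)) (hm : R a 0 = R b 0) {n : ℂ → ℤ}
    (hn : ∀ z, g.eval z = z → z ≠ R a 0 →
      lg g κ R b z 0 - lg g κ R a z 0 = 2 * Real.pi * Complex.I * n z) :
    (b - a) - ((fixedMult g (R a 0) : ℤ) - 1) ≤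
      ∑ z ∈ (fixedPts g).erase (R a 0), fixedMult g z * n z := by
  have hD := h.one_lt
  have hπ := Real.pi_gt_three
  set m := R a 0 with hma
  have hmfix : g.eval m = m := h.fixed_zero a
  have hmmem : m ∈ fixedPts g := h.mem_fixedPts.2 hmfix
  set D : ℝ := (g.natDegree : ℝ) with hDdef
  have hD0 : 0 < D := by linarith
  set μ := fixedMult g m with hμ
  have hμ1 : 1 ≤ μ := one_le_fixedMult hmmem
  have hμ1' : (1 : ℝ) ≤ μ := by exact_mod_cast hμ1
  by_contra hcon
  set N := ∑ z ∈ (fixedPts g).erase m, (fixedMult g z : ℤ) * n z with hN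
  have hcon' : N ≤ b - a - μ := by omega
  set E : ℤ → ℝ → ℂ := fun j s => ∑ z ∈ (fixedPts g).erase m, fixedMult g z * lg g κ R j z s
    with hE
  have hE0 : E b 0 - E a 0 = 2 * Real.pi * Complex.I * N := by
    simp only [hE, hN]
    rw [← Finset.sum_sub_distrib]
    push_cast
    rw [Finset.mul_sum]
    refine Finset.sum_congr rfl fun z hz => ?_
    rw [← mul_sub, hn z (h.mem_fixedPts.1 (Finset.mem_of_mem_erase hz)) (Finset.ne_of_mem_erase hz)]
    ring
  have hEc : ∀ j, R j 0 = m → ContinuousAt (E j) 0 := fun j hj => by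
    refine tendsto_finsetSum _ fun z hz => ?_
    refine ContinuousAt.tendsto (continuousAt_const.mul (h.continuousAt_lg fun t ht => ?_))
    exact h.ne_of_fixed (h.mem_fixedPts.1 (Finset.mem_of_mem_erase hz))
      (by rw [hj]; exact (Finset.ne_of_mem_erase hz).symm) ht
  have hEs : ∀ j s, 0 < s → E j s = lg g κ R j (R j s) (D * s) + 2 * Real.pi * Complex.I * j
      - μ * lg g κ R j m s := fun j s hs => by
    rw [← h.sum_lg j hs, ← Finset.add_sum_erase _ _ hmmem]
    ring
  obtain ⟨ε₀, hε₀, hlog⟩ := h.norm_log_sub_le hab hba hm (η := 1 / μ) (by positivity)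
  obtain ⟨ε₁, hε₁, hE1⟩ := Metric.continuousAt_iff.1 (hEc a rfl) (1 / 4) (by norm_num)
  obtain ⟨ε₂, hε₂, hE2⟩ := Metric.continuousAt_iff.1 (hEc b hm.symm) (1 / 4) (by norm_num)
  obtain ⟨ε, hε, hε0, hε1, hε2⟩ : ∃ ε > 0, ε < ε₀ ∧ ε < ε₁ ∧ ε < ε₂ := by
    refine ⟨min ε₀ (min ε₁ ε₂) / 2, by positivity, ?_⟩
    have h3 : 0 < min ε₀ (min ε₁ ε₂) := by positivity
    have h4 : min ε₀ (min ε₁ ε₂) ≤ ε₀ := min_le_left _ _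
    have h5 : min ε₀ (min ε₁ ε₂) ≤ ε₁ := (min_le_right _ _).trans (min_le_left _ _)
    have h6 : min ε₀ (min ε₁ ε₂) ≤ ε₂ := (min_le_right _ _).trans (min_le_right _ _)
    refine ⟨?_, ?_, ?_⟩ <;> linarith
  have pa := h.exists_norm_lt a hε
  have pb := h.exists_norm_lt b hε
  obtain ⟨ρ, hρ, hρa, hρb⟩ : ∃ ρ > 0, ρ < ‖R a ε - R a 0‖ ∧ ρ < ‖R b ε - R b 0‖ := by
    refine ⟨min ‖R a ε - R a 0‖ ‖R b ε - R b 0‖ / 2, by positivity, ?_⟩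
    have h3 : 0 < min ‖R a ε - R a 0‖ ‖R b ε - R b 0‖ := by positivity
    have h4 := min_le_left ‖R a ε - R a 0‖ ‖R b ε - R b 0‖
    have h5 := min_le_right ‖R a ε - R a 0‖ ‖R b ε - R b 0‖
    constructor <;> linarith
  obtain ⟨Sa, ha0, haε, haρ, haf⟩ := exists_first_hit (h.ray a).cont hε.le hρ hρa
  obtain ⟨Sb, hb0, hbε, hbρ, hbf⟩ := exists_first_hit (h.ray b).cont hε.le hρ hρb
  have hfle : ∀ {j S}, ‖R j S - R j 0‖ = ρ → (∀ t, 0 ≤ t → t < S → ‖R j t - R j 0‖ < ρ) →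
      ∀ t, 0 ≤ t → t ≤ S → ‖R j t - R j 0‖ ≤ ρ := fun h1 h2 t h3 h4 => by
    rcases h4.eq_or_lt with h4 | h4
    · rw [h4, h1]
    · exact (h2 t h3 h4).le
  have hX := h.im_lg_sub_le hab hba hm ha0 hb0 (by rw [hbρ]; exact hfle haρ haf)
    (by rw [haρ]; exact hfle hbρ hbf)
  have hδ : ∀ {j S}, 0 < S → ‖R j S - R j 0‖ = ρ →
      (∀ t, 0 ≤ t → t < S → ‖R j t - R j 0‖ < ρ) →
      |(lg g κ R j (R j (S / D)) S - lg g κ R j (R j 0) S).im| ≤ Real.pi / 2 :=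
    fun {j S} hS h1 h2 => by
    have h3 : S / D < S := div_lt_self hS hD
    refine (h.ray j).abs_im_ell_sub_le (h.ray j).cont (by positivity)
      (fun t h4 h5 => by rw [h1]; exact hfle h1 h2 t h4 (h5.trans h3.le)) fun t h4 h5 t' h6 e => ?_
    have := (h.disj j j t' t (hS.trans_le h6) h4 e).1
    linarith
  have hδa := abs_le.1 (hδ ha0 haρ haf)
  have hδb := abs_le.1 (hδ hb0 hbρ hbf)
  have ha1 : Sa / D < Sa := div_lt_self ha0 hD
  have hb1 : Sb / D < Sb := div_lt_self hb0 hD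
  have ha2 : 0 < Sa / D := by positivity
  have hb2 : 0 < Sb / D := by positivity
  have hl := hlog (Sa / D) (Sb / D) ha2 (by linarith) hb2 (by linarith)
  have e1 := @hE1 (Sa / D) (by rw [Real.dist_eq, sub_zero, abs_of_pos ha2]; linarith)
  have e2 := @hE2 (Sb / D) (by rw [Real.dist_eq, sub_zero, abs_of_pos hb2]; linarith)
  rw [dist_eq_norm] at e1 e2
  have e3 := (Complex.abs_im_le_norm _).trans e1.le
  have e4 := (Complex.abs_im_le_norm _).trans e2.le
  have hl2 := (Complex.abs_im_le_norm _).trans hl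
  have ea := hEs a _ ha2
  have eb := hEs b _ hb2
  have hcan : ∀ S : ℝ, D * (S / D) = S := fun S => by field_simp
  rw [hcan] at ea eb
  rw [hcan, hcan] at hl2
  rw [← hm] at hl2 hX hδb
  have hX' : (μ - 1 : ℝ) * (lg g κ R b m Sb - lg g κ R a m Sa).im ≤ (μ - 1) * (2 * Real.pi) :=
    mul_le_mul_of_nonneg_left hX (by linarith)
  have hl3 : -1 ≤ (μ : ℝ) * ((lg g κ R b m Sb - lg g κ R b m (Sb / D)) -
      (lg g κ R a m Sa - lg g κ R a m (Sa / D))).im := by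
    have h1 := (abs_le.1 hl2).1
    have h2 := mul_le_mul_of_nonneg_left h1 (show (0 : ℝ) ≤ μ by linarith)
    have h3 : (μ : ℝ) * -(1 / μ) = -1 := by field_simp
    linarith
  have hfin := congrArg Complex.im hE0
  have ia := congrArg Complex.im ea
  have ib := congrArg Complex.im eb
  rw [abs_le] at e3 e4
  have hNr : (N : ℝ) ≤ b - a - μ := by exact_mod_cast hcon'
  simp only [Complex.sub_im, Complex.add_im, Complex.mul_im, Complex.mul_re, Complex.ofReal_re,
    Complex.I_im, Complex.ofReal_im, Complex.I_re, mul_one, mul_zero, add_zero, zero_mul,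
    Complex.natCast_re, Complex.natCast_im, Complex.intCast_re, Complex.intCast_im, sub_zero,
    Complex.re_ofNat, Complex.im_ofNat, zero_add] at hfin ia ib e3 e4 hl3 hX' hδa hδb
  simp only [← hma] at hδa hδb
  have h7 : 2 * Real.pi * N ≤ 2 * Real.pi * (b - a - μ) :=
    mul_le_mul_of_nonneg_left hNr (by linarith)
  linarith [e3.1, e3.2, e4.1, e4.2, hδa.1, hδa.2, hδb.1, hδb.2]

end RaySystem

/-! ### The complement of the rays -/

/-- The union of all rays together with their landing points. -/
def raySet (R : ℤ → ℝ → ℂ) : Set ℂ := ⋃ j, R j '' Ici 0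

/-- A ray system together with the facts on the dynamics near infinity used to compare winding
numbers: flow boxes around points of rays, and straight paths to infinity starting at points of
large modulus. -/
structure FullRaySystem (g : Polynomial ℂ) (κ : ℝ) (R : ℤ → ℝ → ℂ) : Prop
    extends RaySystem g κ R where
  flow : ∀ j s, 0 < s → ∃ H₁ H₂ : Set ℂ, H₁ ∪ H₂ ∪ raySet R ∈ 𝓝 (R j s) ∧
    ∀ H, H = H₁ ∨ H = H₂ → IsPreconnected H ∧ Disjoint H (raySet R) ∧
      ∃ z ∈ H, ∃ c > s, ∃ k > (0 : ℝ), ∀ᶠ n : ℕ in atTop,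
        k * Real.exp (g.natDegree ^ n * c) ≤ ‖(fun z => g.eval z)^[n] z‖
  far : ∃ M : ℝ, ∀ v, M < ‖v‖ → v ∉ raySet R → ∃ (k : ℤ) (α : ℝ) (γ : ℝ → ℂ), IsRay κ α γ ∧
    γ 0 = v ∧ height g.natDegree k < α ∧ α < height g.natDegree (k + 1) ∧
    ∀ t, 0 ≤ t → γ t ∉ raySet R

namespace RaySystem

variable {g : Polynomial ℂ} {κ : ℝ} {R : ℤ → ℝ → ℂ}

theorem mem_raySet {v : ℂ} : v ∈ raySet R ↔ ∃ j t, 0 ≤ t ∧ R j t = v := by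
  simp [raySet]

theorem per_mul (h : RaySystem g κ R) (j k : ℤ) : R (j + k * ((g.natDegree : ℤ) - 1)) = R j := by
  induction k using Int.induction_on with
  | zero => simp
  | succ i ih => rw [← ih, ← h.per (j + (i : ℤ) * _)]; congr 1; ring
  | pred i ih => rw [← ih, ← h.per (j + (-(i : ℤ) - 1) * _)]; congr 1; ring

theorem exists_index (h : RaySystem g κ R) (j : ℤ) :
    ∃ i ∈ Finset.Ico (0 : ℤ) ((g.natDegree : ℤ) - 1), R i = R j := by
  have hD := h.two_le
  have h1 : (0 : ℤ) < (g.natDegree : ℤ) - 1 := by omega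
  refine ⟨j % ((g.natDegree : ℤ) - 1), Finset.mem_Ico.2 ⟨Int.emod_nonneg _ h1.ne',
    Int.emod_lt_of_pos _ h1⟩, ?_⟩
  conv_rhs => rw [← Int.emod_add_mul_ediv j ((g.natDegree : ℤ) - 1), mul_comm]
  rw [h.per_mul]

theorem raySet_eq (h : RaySystem g κ R) :
    raySet R = ⋃ i ∈ Finset.Ico (0 : ℤ) ((g.natDegree : ℤ) - 1), R i '' Ici 0 := by
  apply subset_antisymm
  · refine iUnion_subset fun j => ?_
    obtain ⟨i, hi, e⟩ := h.exists_index j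
    rw [← e]
    exact subset_biUnion_of_mem (u := fun i => R i '' Ici 0) (by exact_mod_cast hi)
  · exact iUnion₂_subset fun i _ => subset_iUnion (fun i => R i '' Ici 0) i

theorem isClosed_raySet (h : RaySystem g κ R) : IsClosed (raySet R) := by
  rw [h.raySet_eq]
  exact isClosed_biUnion_finset fun i _ => isClosed_image_Ici (h.ray i) 0

theorem exists_norm_le (h : RaySystem g κ R) :
    ∃ C > 0, ∀ j s, 0 ≤ s → ‖R j s‖ ≤ C * Real.exp s := by
  have key : ∀ j, ∃ C > 0, ∀ s, 0 ≤ s → ‖R j s‖ ≤ C * Real.exp s := fun j => by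
    have h1 := (h.ray j).lim.norm.eventually (gt_mem_nhds (show ‖(1 : ℂ)‖ < 2 by norm_num))
    obtain ⟨T, hT⟩ := h1.exists_forall_of_atTop
    obtain ⟨C, hC⟩ := isCompact_Icc.exists_bound_of_continuousOn
      ((h.ray j).cont.continuousOn (s := Icc 0 T))
    refine ⟨max C 2, by positivity, fun s hs => ?_⟩
    rcases le_total s T with h2 | h2
    · have h3 := hC s ⟨hs, h2⟩
      have h4 := Real.one_le_exp hs
      have h5 := le_max_left C 2
      have h6 := le_max_right C 2
      nlinarith
    · have h3 := hT s h2
      rw [norm_mul, Complex.norm_exp, Complex.neg_re, line_re, Real.exp_neg, ← div_eq_mul_inv,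
        div_lt_iff₀ (Real.exp_pos _)] at h3
      have h6 := le_max_right C 2
      nlinarith [Real.exp_pos s]
  choose C hC hle using key
  refine ⟨1 + ∑ i ∈ Finset.Ico (0 : ℤ) ((g.natDegree : ℤ) - 1), C i, ?_, fun j s hs => ?_⟩
  · have := Finset.sum_nonneg fun i (_ : i ∈ Finset.Ico (0 : ℤ) ((g.natDegree : ℤ) - 1)) =>
      (hC i).le
    linarith
  · obtain ⟨i, hi, e⟩ := h.exists_index j
    rw [← e]
    have := Finset.single_le_sum (f := C) (fun i _ => (hC i).le) hi
    exact (hle i s hs).trans (mul_le_mul_of_nonneg_right (by linarith) (Real.exp_pos _).le)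

theorem iterate_ray (h : RaySystem g κ R) (j : ℤ) {s : ℝ} (hs : 0 ≤ s) (n : ℕ) :
    (fun z => g.eval z)^[n] (R j s) = R j (g.natDegree ^ n * s) := by
  induction n with
  | zero => simp
  | succ n ih =>
    rw [iterate_succ_apply', ih, h.conj j _ (by positivity)]
    congr 1; ring

/-- Two points with the same relative winding numbers around pairs of rays landing together. -/
def SameSig (g : Polynomial ℂ) (κ : ℝ) (R : ℤ → ℝ → ℂ) (x y : ℂ) : Prop :=
  ∀ a b, R a 0 = R b 0 →
    lg g κ R b x 0 - lg g κ R a x 0 = lg g κ R b y 0 - lg g κ R a y 0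

theorem sig_eq (h : RaySystem g κ R) {a b : ℤ} (hm : R a 0 = R b 0) {S : Set ℂ}
    (hS : IsPreconnected S) (hSa : ∀ v ∈ S, ∀ t, 0 ≤ t → R a t ≠ v)
    (hSb : ∀ v ∈ S, ∀ t, 0 ≤ t → R b t ≠ v) {x y : ℂ} (hx : x ∈ S) (hy : y ∈ S) :
    lg g κ R b x 0 - lg g κ R a x 0 = lg g κ R b y 0 - lg g κ R a y 0 := by
  have hc : ∀ j, (∀ v ∈ S, ∀ t, 0 ≤ t → R j t ≠ v) →
      ContinuousOn (fun v => lg g κ R j v 0) S := fun j hj v hv => by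
    refine ContinuousAt.continuousWithinAt ?_
    exact ContinuousAt.comp (f := fun v : ℂ => (v, (0 : ℝ)))
      ((h.ray j).continuousAt_ell (hj v hv)) (by fun_prop)
  refine eq_of_exp_eq_const hS ((hc b hSb).sub (hc a hSa)) (k := 1) (fun v hv => ?_) hx hy
  simp only [Pi.sub_apply]
  rw [Complex.exp_sub, (h.ray a).exp_ell (hSa v hv), (h.ray b).exp_ell (hSb v hv), hm,
    div_self (sub_ne_zero.2 (hSb v hv 0 le_rfl))]

theorem sameSig_of_isPreconnected (h : RaySystem g κ R) {S : Set ℂ} (hS : IsPreconnected S)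
    (hd : Disjoint S (raySet R)) {x y : ℂ} (hx : x ∈ S) (hy : y ∈ S) : SameSig g κ R x y :=
  fun a b hm => h.sig_eq hm hS
    (fun _ hv t ht e => hd.notMem_of_mem_left hv (mem_raySet.2 ⟨a, t, ht, e⟩))
    (fun _ hv t ht e => hd.notMem_of_mem_left hv (mem_raySet.2 ⟨b, t, ht, e⟩)) hx hy

theorem SameSig.trans {x y z : ℂ} (h : SameSig g κ R x y) (h' : SameSig g κ R y z) :
    SameSig g κ R x z :=
  fun a b hm => (h a b hm).trans (h' a b hm)

theorem isOpen_sameSig (h : RaySystem g κ R) (z : ℂ) :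
    IsOpen {v | v ∉ raySet R ∧ SameSig g κ R v z} := by
  rw [Metric.isOpen_iff]
  rintro v ⟨hv, hs⟩
  obtain ⟨ε, hε, hb⟩ := Metric.isOpen_iff.1 h.isClosed_raySet.isOpen_compl v hv
  refine ⟨ε, hε, fun w hw => ⟨hb hw, SameSig.trans ?_ hs⟩⟩
  exact h.sameSig_of_isPreconnected (convex_ball v ε).isPreconnected
    (disjoint_left.2 fun x hx => hb hx) hw (mem_ball_self hε)

theorem frontier_sameSig_subset (h : RaySystem g κ R) (z : ℂ) :
    frontier {v | v ∉ raySet R ∧ SameSig g κ R v z} ⊆ raySet R := by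
  intro w hw
  by_contra hwR
  obtain ⟨ε, hε, hb⟩ := Metric.isOpen_iff.1 h.isClosed_raySet.isOpen_compl w hwR
  obtain ⟨v, hv, hvd⟩ := Metric.mem_closure_iff.1 hw.1 ε hε
  refine hw.2 ?_
  rw [(h.isOpen_sameSig z).interior_eq]
  refine ⟨hwR, SameSig.trans ?_ hv.2⟩
  exact h.sameSig_of_isPreconnected (convex_ball w ε).isPreconnected
    (disjoint_left.2 fun x hx => hb hx) (mem_ball_self hε) (by rwa [mem_ball, dist_comm])

end RaySystem

theorem not_isBounded_of_finite_frontier {B F : Set ℂ} (hB : IsOpen B) (hne : B.Nonempty)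
    (hF : F.Finite) (hBF : frontier B ⊆ F) : ¬ Bornology.IsBounded B := by
  intro hbd
  have hconn : IsConnected Fᶜ := hF.countable.isConnected_compl_of_one_lt_rank (by simp)
  have hunb : ∀ S : Set ℂ, Bornology.IsBounded S → Sᶜ.Nonempty := fun S hS => by
    by_contra h
    rw [not_nonempty_iff_eq_empty, compl_empty_iff] at h
    exact NormedSpace.unbounded_univ ℂ ℂ (h ▸ hS)
  obtain ⟨b, hb⟩ := hne
  have h1 : (Fᶜ ∩ B).Nonempty := by
    by_contra h
    rw [inter_comm, ← sdiff_eq, not_nonempty_iff_eq_empty, sdiff_eq_empty] at h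
    exact infinite_of_mem_nhds b (hB.mem_nhds hb) (hF.subset h)
  have h2 : (Fᶜ ∩ (closure B)ᶜ).Nonempty := by
    rw [← compl_union]
    exact hunb _ (hF.isBounded.union hbd.closure)
  have := hconn.isPreconnected B (closure B)ᶜ hB isClosed_closure.isOpen_compl (fun x hx => by
    by_cases hxc : x ∈ closure B
    · left
      by_contra hxB
      exact hx (hBF ⟨hxc, by rwa [hB.interior_eq]⟩)
    · exact Or.inr hxc) h1 h2
  obtain ⟨x, -, hx1, hx2⟩ := this
  exact hx2 (subset_closure hx1)

/-! ### Separation of fixed points by rays -/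

namespace FullRaySystem

open RaySystem

variable {g : Polynomial ℂ} {κ : ℝ} {R : ℤ → ℝ → ℂ}

theorem exists_sameSig_far (h : FullRaySystem g κ R) {z : ℂ} (hz : z ∉ raySet R) (M : ℝ) :
    ∃ v, v ∉ raySet R ∧ M < ‖v‖ ∧ SameSig g κ R v z := by
  have hr := h.toRaySystem
  set B : Set ℂ := {v | v ∉ raySet R ∧ SameSig g κ R v z} with hB
  have hBo : IsOpen B := hr.isOpen_sameSig z
  have hBne : B.Nonempty := ⟨z, hz, fun _ _ _ => rfl⟩
  have hfr : frontier B ⊆ raySet R := hr.frontier_sameSig_subset z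
  by_contra! hcon
  have hbd : Bornology.IsBounded B := by
    rw [isBounded_iff_forall_norm_le]
    refine ⟨M, fun v hv => ?_⟩
    by_contra hlt
    exact hcon v hv.1 (not_le.1 hlt) hv.2
  have hfrc : IsCompact (frontier B) := hbd.isCompact_closure.of_isClosed_subset isClosed_frontier
    frontier_subset_closure
  obtain ⟨C', hC'⟩ := isBounded_iff_forall_norm_le.1 hfrc.isBounded
  set I := Finset.Ico (0 : ℤ) ((g.natDegree : ℤ) - 1) with hI
  set T : Set ℝ := ⋃ i ∈ I, (Ici 0 ∩ R i ⁻¹' frontier B) with hT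
  have hTc : IsCompact T := by
    refine I.isCompact_biUnion fun i _ => ?_
    obtain ⟨t, ht⟩ := ((hr.ray i).tendsto_norm.eventually_gt_atTop C').exists_forall_of_atTop
    refine (isCompact_Icc (a := 0) (b := t)).of_isClosed_subset
      (isClosed_Ici.inter (isClosed_frontier.preimage (hr.ray i).cont)) fun s hs => ⟨hs.1, ?_⟩
    by_contra hst
    exact absurd (hC' _ hs.2) (not_le.2 (ht s (not_le.1 hst).le))
  have hpos : ∃ s ∈ T, 0 < s := by
    by_contra! h0
    refine not_isBounded_of_finite_frontier hBo hBne
      ((I.finite_toSet).image fun i => R i 0) (fun w hw => ?_) hbd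
    obtain ⟨j, t, ht, e⟩ := mem_raySet.1 (hfr hw)
    obtain ⟨i, hi, ei⟩ := hr.exists_index j
    have h1 : t ∈ T := mem_biUnion (x := i) hi ⟨ht, by rw [mem_preimage, ei, e]; exact hw⟩
    have h2 : t = 0 := le_antisymm (h0 t h1) ht
    exact ⟨i, hi, by simp only; rw [ei, ← h2, e]⟩
  obtain ⟨s, hsT, hs0⟩ := hpos
  obtain ⟨s₀, hs₀, hmax⟩ := hTc.exists_isGreatest ⟨s, hsT⟩
  have hs₀pos : 0 < s₀ := hs0.trans_le (hmax hsT)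
  obtain ⟨j, hj, -, hjf⟩ := mem_iUnion₂.1 hs₀
  obtain ⟨H₁, H₂, hnhds, hH⟩ := h.flow j s₀ hs₀pos
  obtain ⟨v, hvB, hvn⟩ : (B ∩ (H₁ ∪ H₂ ∪ raySet R)).Nonempty := by
    rw [inter_comm]
    exact mem_closure_iff_nhds.1 (frontier_subset_closure hjf) _ hnhds
  have : ∃ H, (H = H₁ ∨ H = H₂) ∧ v ∈ H := by
    rcases hvn with (h1 | h1) | h1
    · exact ⟨H₁, Or.inl rfl, h1⟩
    · exact ⟨H₂, Or.inr rfl, h1⟩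
    · exact absurd h1 hvB.1
  obtain ⟨H, hHH, hvH⟩ := this
  obtain ⟨hpre, hdis, w, hwH, c, hc, k, hk, hev⟩ := hH H hHH
  have hwB : w ∈ B := ⟨hdis.notMem_of_mem_left hwH,
    (hr.sameSig_of_isPreconnected hpre hdis hwH hvH).trans hvB.2⟩
  obtain ⟨C, hC, hCle⟩ := hr.exists_norm_le
  have hle : ∀ n : ℕ, ‖(fun z => g.eval z)^[n] w‖ ≤ C * Real.exp (g.natDegree ^ n * s₀) := fun n => by
    have hd : Differentiable ℂ (fun z => g.eval z)^[n] := g.differentiable.iterate n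
    refine Complex.norm_le_of_forall_mem_frontier_norm_le hbd hd.diffContOnCl (fun x hx => ?_)
      (subset_closure hwB)
    obtain ⟨j', t, ht, e⟩ := mem_raySet.1 (hfr hx)
    obtain ⟨i, hi, ei⟩ := hr.exists_index j'
    have h1 : t ∈ T := mem_biUnion (x := i) hi ⟨ht, by rw [mem_preimage, ei, e]; exact hx⟩
    rw [← e, hr.iterate_ray j' ht]
    refine (hCle j' _ (by positivity)).trans ?_
    gcongr
    exact hmax h1
  have hlim : Tendsto (fun n : ℕ => (g.natDegree : ℝ) ^ n * (c - s₀)) atTop atTop :=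
    (tendsto_pow_atTop_atTop_of_one_lt hr.one_lt).atTop_mul_const (by linarith)
  obtain ⟨n, h1, h2⟩ := (hev.and ((Real.tendsto_exp_atTop.comp hlim).eventually_gt_atTop
    (C / k))).exists
  have h3 := h1.trans (hle n)
  simp only [comp_apply] at h2
  rw [mul_sub, Real.exp_sub, div_lt_div_iff₀ hk (Real.exp_pos _)] at h2
  linarith

theorem exists_window (h : FullRaySystem g κ R) {z : ℂ} (hz : z ∉ raySet R) :
    ∃ k : ℤ, ∀ a b, k < a → a < k + g.natDegree → k < b → b < k + g.natDegree → R a 0 = R b 0 →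
      lg g κ R a z 0 = lg g κ R b z 0 := by
  have hr := h.toRaySystem
  obtain ⟨M, hM⟩ := h.far
  obtain ⟨v, hv, hvM, hsig⟩ := h.exists_sameSig_far hz M
  obtain ⟨k, α, γ, hγ, hγ0, hk1, hk2, hd⟩ := hM v hvM hv
  have key : ∀ j, k < j → j < k + g.natDegree →
      lg g κ R j v 0 = ell κ α γ (R j 0) 0 + Real.pi * Complex.I := fun j h1 h2 => by
    have h3 : α < height g.natDegree j := by
      rcases (show k + 1 ≤ j by omega).eq_or_lt with e | e
      · rwa [← e]
      · exact hk2.trans (hr.height_lt e)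
    have h4 : height g.natDegree j < α + 2 * Real.pi := by
      rcases (show j ≤ k + (g.natDegree - 1 : ℤ) by omega).eq_or_lt with e | e
      · have h5 : height g.natDegree j = height g.natDegree k + 2 * Real.pi := by
          have := hr.one_lt
          have h6 : (g.natDegree : ℝ) - 1 ≠ 0 := by linarith
          rw [e]; unfold height; push_cast; field_simp
        linarith
      · have := hr.height_lt_add e
        linarith
    have := hγ.ell_swap (hr.ray j) (s := 0) (s' := 0) h3 h4 fun t t' ht ht' e =>
      hd t ht (mem_raySet.2 ⟨j, t', ht', e.symm⟩)
    rw [← this, hγ0]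
  refine ⟨k, fun a b ha1 ha2 hb1 hb2 hm => ?_⟩
  have h1 := hsig a b hm
  rw [key a ha1 ha2, key b hb1 hb2, hm, sub_self] at h1
  exact (sub_eq_zero.1 h1.symm).symm

end FullRaySystem

theorem IsRay.ell_add_two_pi {κ α : ℝ} {γ : ℝ → ℂ} (h : IsRay κ α γ) {v : ℂ} {s : ℝ}
    (hv : ∀ t, s ≤ t → γ t ≠ v) :
    ell κ (α + 2 * Real.pi) γ v s = ell κ α γ v s + 2 * Real.pi * Complex.I := by
  have h1 := h.isLogFrom hv
  have h2 : IsLogFrom (line κ (α + 2 * Real.pi)) (fun t => γ t - v)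
      (fun t => ell κ α γ v t + 2 * Real.pi * Complex.I) s := by
    refine ⟨h1.cont.add continuousOn_const, fun t ht => ?_, h1.lim.congr fun t => ?_⟩
    · rw [Complex.exp_add, Complex.exp_two_pi_mul_I, mul_one, h1.exp_eq t ht]
    · simp only [line]; push_cast; ring
  exact h2.nlog_eq le_rfl

theorem le_sum_of_steps (F : Finset ℂ) (mult : ℂ → ℕ) (l : ℂ → ℤ) (k : ℤ) (D : ℕ)
    (hstep : ∀ x, k < x → x < k + D → ∃ e, x ≤ e ∧ e < k + D ∧
      e - x + 1 ≤ ∑ z ∈ F, if x ≤ l z ∧ l z ≤ e then (mult z : ℤ) else 0) (n : ℕ) (hn : n < D) :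
    (n : ℤ) ≤ ∑ z ∈ F, if k + D - n ≤ l z then (mult z : ℤ) else 0 := by
  induction n using Nat.strong_induction_on with
  | _ n ih =>
    rcases Nat.eq_zero_or_pos n with h0 | h0
    · subst h0
      exact Finset.sum_nonneg fun z _ => by split_ifs <;> simp
    obtain ⟨e, h1, h2, h3⟩ := hstep (k + D - n) (by omega) (by omega)
    obtain ⟨n', hn'⟩ : ∃ n' : ℕ, (n' : ℤ) = k + D - 1 - e := ⟨(k + D - 1 - e).toNat, by omega⟩
    have h4 := ih n' (by omega) (by omega)
    have h5 : (∑ z ∈ F, if k + D - n ≤ l z then (mult z : ℤ) else 0) =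
        (∑ z ∈ F, if k + D - n ≤ l z ∧ l z ≤ e then (mult z : ℤ) else 0) +
        ∑ z ∈ F, if k + D - n' ≤ l z then (mult z : ℤ) else 0 := by
      rw [← Finset.sum_add_distrib]
      refine Finset.sum_congr rfl fun z _ => ?_
      split_ifs <;> omega
    rw [h5]
    omega

namespace FullRaySystem

open RaySystem

variable {g : Polynomial ℂ} {κ : ℝ} {R : ℤ → ℝ → ℂ}

theorem _root_.RayLanding.RaySystem.lg_add_period (h : RaySystem g κ R) {j : ℤ} {v : ℂ} {s : ℝ}
    (hv : ∀ t, s ≤ t → R j t ≠ v) :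
    lg g κ R (j + ((g.natDegree : ℤ) - 1)) v s = lg g κ R j v s + 2 * Real.pi * Complex.I := by
  have h5 : height g.natDegree (j + ((g.natDegree : ℤ) - 1)) =
      height g.natDegree j + 2 * Real.pi := by
    have := h.one_lt
    have h6 : (g.natDegree : ℝ) - 1 ≠ 0 := by linarith
    unfold height; push_cast; field_simp
  simp only [lg]
  rw [h5, h.per, (h.ray j).ell_add_two_pi hv]

/-- `l` locates the fixed point `z` relative to the rays with indices in `(k, k + D)`. -/
def IsLocation (g : Polynomial ℂ) (κ : ℝ) (R : ℤ → ℝ → ℂ) (k : ℤ) (z : ℂ) (l : ℤ) : Prop :=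
  k ≤ l ∧ l < k + g.natDegree ∧
  (∀ a b, k < a → a < b → b < k + g.natDegree → R a 0 = R b 0 → R a 0 ≠ z →
    lg g κ R b z 0 - lg g κ R a z 0 = 2 * Real.pi * Complex.I * (if a ≤ l ∧ l < b then 1 else 0 : ℤ))
  ∧ ∀ j, k < j → j < k + g.natDegree → R j 0 = z → j ≤ l ∧ k < l ∧ R l 0 = z

theorem isLocation_of_window {k : ℤ} {z : ℂ} (hD : 2 ≤ g.natDegree) (hz : z ∉ raySet R)
    (hw : ∀ a b, k < a → a < k + g.natDegree → k < b → b < k + g.natDegree → R a 0 = R b 0 →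
      lg g κ R a z 0 = lg g κ R b z 0) : IsLocation g κ R k z k := by
  refine ⟨le_rfl, by omega, fun a b ha hab hb hm _ => ?_, fun j _ _ hj => ?_⟩
  · rw [hw a b ha (by omega) (by omega) hb hm, sub_self, if_neg (by omega)]
    simp
  · exact absurd (mem_raySet.2 ⟨j, 0, le_rfl, hj⟩) hz

theorem exists_isLocation_of_notMem (h : FullRaySystem g κ R) (k : ℤ) {z : ℂ}
    (hz : z ∉ raySet R) : ∃ l, IsLocation g κ R k z l := by
  have hr := h.toRaySystem
  have hD := h.two_le
  have hne : ∀ j t, 0 ≤ t → R j t ≠ z := fun j t ht e => hz (mem_raySet.2 ⟨j, t, ht, e⟩)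
  obtain ⟨k', hk'⟩ := h.exists_window hz
  set P : ℤ := (g.natDegree : ℤ) - 1 with hP
  have hP0 : 0 < P := by omega
  have hper : ∀ (i j : ℤ), R (j + i * P) = R j ∧
      lg g κ R (j + i * P) z 0 = lg g κ R j z 0 + i * (2 * Real.pi * Complex.I) := fun i j => by
    refine ⟨hr.per_mul j i, ?_⟩
    induction i using Int.induction_on with
    | zero => simp
    | succ i ih =>
      have := hr.lg_add_period (hne (j + (i : ℤ) * P))
      rw [show j + ((i : ℤ) + 1) * P = j + (i : ℤ) * P + P by ring, this, ih]
      push_cast; ring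
    | pred i ih =>
      have := hr.lg_add_period (hne (j + (-(i : ℤ) - 1) * P))
      rw [show j + (-(i : ℤ) - 1) * P + ((g.natDegree : ℤ) - 1) = j + -(i : ℤ) * P by
        rw [hP]; ring, ih] at this
      push_cast at this ⊢
      linear_combination -this
  set l := k + (k' - k) % P with hl
  have hl1 : k ≤ l := by have := Int.emod_nonneg (k' - k) hP0.ne'; omega
  have hl2 : l < k + P := by have := Int.emod_lt_of_pos (k' - k) hP0; omega
  set i := (k' - k) / P with hi
  have hk'l : k' = l + i * P := by
    have := Int.emod_add_mul_ediv (k' - k) P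
    rw [hl]; linarith
  have hw : ∀ a b, l < a → a < l + g.natDegree → l < b → b < l + g.natDegree → R a 0 = R b 0 →
      lg g κ R a z 0 = lg g κ R b z 0 := fun a b h1 h2 h3 h4 hm => by
    have := hk' (a + i * P) (b + i * P) (by omega) (by omega) (by omega) (by omega)
      (by rw [(hper i a).1, (hper i b).1, hm])
    rw [(hper i a).2, (hper i b).2] at this
    exact add_right_cancel this
  refine ⟨l, hl1, by omega, fun a b ha hab hb hm _ => ?_,
    fun j _ _ hj => absurd hj (hne j 0 le_rfl)⟩
  have ha' := hper 1 a
  have hb' := hper 1 b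
  rw [one_mul] at ha' hb'
  rcases lt_or_ge l a with h1 | h1
  · rw [hw a b h1 (by omega) (by omega) (by omega) hm, sub_self, if_neg (by omega)]
    simp
  rcases lt_or_ge l b with h2 | h2
  · have := hw (a + P) b (by omega) (by omega) h2 (by omega) (by rw [ha'.1, hm])
    rw [if_pos ⟨h1, h2⟩, ← this, ha'.2]
    push_cast; ring
  · have := hw (a + P) (b + P) (by omega) (by omega) (by omega) (by omega)
      (by rw [ha'.1, hb'.1, hm])
    rw [ha'.2, hb'.2] at this
    rw [add_right_cancel this, sub_self, if_neg (by omega)]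
    simp

theorem lg_swap (h : RaySystem g κ R) {a b : ℤ} (hab : a < b)
    (hba : b < a + ((g.natDegree : ℤ) - 1)) (hm : R a 0 ≠ R b 0) :
    lg g κ R b (R a 0) 0 = lg g κ R a (R b 0) 0 + Real.pi * Complex.I := by
  refine (h.ray a).ell_swap (h.ray b) (h.height_lt hab) (h.height_lt_add hba) fun t t' ht ht' => ?_
  rcases ht.eq_or_lt with e | e
  · rcases ht'.eq_or_lt with e' | e'
    · rwa [← e, ← e']
    · exact h.disjoint_rays hab hba ht ht' (Or.inr e')
  · exact h.disjoint_rays hab hba ht ht' (Or.inl e)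

theorem exists_isLocation_of_land (h : RaySystem g κ R) (k : ℤ) {j₀ : ℤ} :
    ∃ l, IsLocation g κ R k (R j₀ 0) l := by
  have hD := h.two_le
  set P : ℤ := (g.natDegree : ℤ) - 1 with hP
  have hP0 : 0 < P := by omega
  set z := R j₀ 0 with hz
  set J := (Finset.Ioo k (k + g.natDegree)).filter fun j => R j 0 = z with hJ
  have hmem : ∀ j, j ∈ J ↔ (k < j ∧ j < k + g.natDegree) ∧ R j 0 = z := fun j => by simp [hJ]
  have hJne : J.Nonempty := by
    refine ⟨k + 1 + (j₀ - k - 1) % P, (hmem _).2 ⟨?_, ?_⟩⟩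
    · have h1 := Int.emod_nonneg (j₀ - k - 1) hP0.ne'
      have h2 := Int.emod_lt_of_pos (j₀ - k - 1) hP0
      omega
    · have h1 := h.per_mul (k + 1 + (j₀ - k - 1) % P) ((j₀ - k - 1) / P)
      have h2 := Int.emod_add_mul_ediv (j₀ - k - 1) P
      rw [← hP, show k + 1 + (j₀ - k - 1) % P + (j₀ - k - 1) / P * P = j₀ by linarith] at h1
      rw [← h1]
  obtain ⟨⟨hl1, hl2⟩, hl3⟩ := (hmem _).1 (J.max'_mem hJne)
  set l := J.max' hJne with hl
  refine ⟨l, hl1.le, hl2, fun a b ha hab hb hm hne => ?_, fun j h1 h2 hj =>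
    ⟨J.le_max' j ((hmem j).2 ⟨⟨h1, h2⟩, hj⟩), hl1, hl3⟩⟩
  have hne' : R b 0 ≠ z := hm ▸ hne
  have hal : a ≠ l := fun e => hne (e ▸ hl3)
  have hbl : b ≠ l := fun e => hne' (e ▸ hl3)
  rw [← hl3] at hne hne' ⊢
  rcases lt_or_gt_of_ne hal with h1 | h1
  · rcases lt_or_gt_of_ne hbl with h2 | h2
    · have e1 := lg_swap h h1 (by omega) hne
      have e2 := lg_swap h h2 (by omega) hne'
      rw [if_neg (by omega)]
      rw [hm] at e1
      push_cast
      linear_combination e1 - e2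
    · have e1 := lg_swap h h1 (by omega) hne
      have e2 := lg_swap h h2 (by omega) hne'.symm
      rw [if_pos ⟨h1.le, h2⟩]
      rw [hm] at e1
      push_cast
      linear_combination e1 + e2
  · have e1 := lg_swap h h1 (by omega) hne.symm
    have e2 := lg_swap h (h1.trans hab) (by omega) hne'.symm
    rw [if_neg (by omega)]
    rw [hm] at e1
    push_cast
    linear_combination e2 - e1

theorem exists_isLocation (h : FullRaySystem g κ R) (k : ℤ) {z : ℂ} (hz : g.eval z = z) :
    ∃ l, IsLocation g κ R k z l := by
  by_cases hzR : z ∈ raySet R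
  · obtain ⟨j, t, ht, rfl⟩ := mem_raySet.1 hzR
    rcases ht.eq_or_lt with e | e
    · rw [← e]
      exact exists_isLocation_of_land h.toRaySystem k
    · exact absurd rfl (h.toRaySystem.ne_fixed (j := j) e hz)
  · exact h.exists_isLocation_of_notMem k hzR

theorem not_sameSig (h : FullRaySystem g κ R) {c₁ c₂ : ℂ} (hne : c₁ ≠ c₂)
    (h₁ : g.eval c₁ = c₁) (h₂ : g.eval c₂ = c₂) (hc₁ : c₁ ∉ raySet R) (hc₂ : c₂ ∉ raySet R) :
    ¬ SameSig g κ R c₁ c₂ := by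
  classical
  intro hsig
  have hr := h.toRaySystem
  have hD := h.two_le
  obtain ⟨k, hk⟩ := h.exists_window hc₁
  have hk₂ : ∀ a b, k < a → a < k + g.natDegree → k < b → b < k + g.natDegree → R a 0 = R b 0 →
      lg g κ R a c₂ 0 = lg g κ R b c₂ 0 := fun a b h1 h2 h3 h4 hm => by
    have e1 := hk a b h1 h2 h3 h4 hm
    have e2 := hsig a b hm
    linear_combination e1 + e2
  have hloc : ∀ z, ∃ l, g.eval z = z → IsLocation g κ R k z l ∧ ((z = c₁ ∨ z = c₂) → l = k) :=
    fun z => by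
    by_cases hz : g.eval z = z
    · by_cases hz2 : z = c₁ ∨ z = c₂
      · refine ⟨k, fun _ => ⟨?_, fun _ => rfl⟩⟩
        rcases hz2 with rfl | rfl
        · exact isLocation_of_window hD hc₁ hk
        · exact isLocation_of_window hD hc₂ hk₂
      · obtain ⟨l, hl⟩ := h.exists_isLocation k hz
        exact ⟨l, fun _ => ⟨hl, fun h => absurd h hz2⟩⟩
    · exact ⟨0, fun h => absurd h hz⟩
  choose l hl using hloc
  have hcount := le_sum_of_steps (fixedPts g) (fixedMult g) l k g.natDegree
    (fun x hx1 hx2 => by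
      set m := R x 0 with hm
      have hmfix : g.eval m = m := hr.fixed_zero x
      have hmmem := hr.mem_fixedPts.2 hmfix
      obtain ⟨⟨h1, h2, h3, h4⟩, -⟩ := hl m hmfix
      obtain ⟨h5, h6, h7⟩ := h4 x hx1 hx2 rfl
      refine ⟨l m, h5, h2, ?_⟩
      rw [← Finset.add_sum_erase _ _ hmmem, if_pos ⟨h5, le_rfl⟩]
      have h8 : (l m - x) - ((fixedMult g m : ℤ) - 1) ≤
          ∑ z ∈ (fixedPts g).erase m, fixedMult g z * (if x ≤ l z ∧ l z < l m then 1 else 0 : ℤ) := by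
        rcases h5.eq_or_lt with e | e
        · have h9 : (1 : ℤ) ≤ fixedMult g m := by exact_mod_cast one_le_fixedMult hmmem
          have : (0 : ℤ) ≤ ∑ z ∈ (fixedPts g).erase m,
              fixedMult g z * (if x ≤ l z ∧ l z < l m then 1 else 0 : ℤ) :=
            Finset.sum_nonneg fun z _ => by split_ifs <;> simp
          omega
        · exact hr.le_sum_winding (n := fun z => if x ≤ l z ∧ l z < l m then 1 else 0) e (by omega)
            h7.symm fun z hz hzm =>
              (hl z hz).1.2.2.1 x (l m) hx1 e h2 h7.symm hzm.symm
      have h9 : (∑ z ∈ (fixedPts g).erase m,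
          fixedMult g z * (if x ≤ l z ∧ l z < l m then 1 else 0 : ℤ)) ≤
          ∑ z ∈ (fixedPts g).erase m, if x ≤ l z ∧ l z ≤ l m then (fixedMult g z : ℤ) else 0 := by
        refine Finset.sum_le_sum fun z _ => ?_
        split_ifs <;> omega
      omega) (g.natDegree - 1) (by omega)
  have hm1 := hr.mem_fixedPts.2 h₁
  have hm2 := hr.mem_fixedPts.2 h₂
  have htot : ∑ z ∈ fixedPts g, (fixedMult g z : ℤ) = g.natDegree := by
    exact_mod_cast hr.sum_fixedMult
  have hm2' := Finset.mem_erase.2 ⟨hne.symm, hm2⟩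
  rw [← Finset.add_sum_erase _ _ hm1, ← Finset.add_sum_erase _ _ hm2'] at hcount htot
  rw [(hl c₁ h₁).2 (Or.inl rfl), (hl c₂ h₂).2 (Or.inr rfl), if_neg (by omega), if_neg (by omega)]
    at hcount
  have hle := Finset.sum_le_sum (s := ((fixedPts g).erase c₁).erase c₂)
    (f := fun z => if k + g.natDegree - ((g.natDegree - 1 : ℕ) : ℤ) ≤ l z
      then (fixedMult g z : ℤ) else 0) (g := fun z => (fixedMult g z : ℤ))
    fun z _ => by split_ifs <;> simp
  have p1 : (1 : ℤ) ≤ fixedMult g c₁ := by exact_mod_cast one_le_fixedMult hm1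
  have p2 : (1 : ℤ) ≤ fixedMult g c₂ := by exact_mod_cast one_le_fixedMult hm2
  omega

theorem ray_notMem_filledJulia (h : RaySystem g κ R) (j : ℤ) {s : ℝ} (hs : 0 < s) :
    R j s ∉ filledJulia fun z => g.eval z := by
  intro hb
  obtain ⟨C, hC⟩ := isBounded_iff_forall_norm_le.1
    (show Bornology.IsBounded (range fun n => (fun z => g.eval z)^[n] (R j s)) from hb)
  have h1 : Tendsto (fun n : ℕ => (g.natDegree : ℝ) ^ n * s) atTop atTop :=
    (tendsto_pow_atTop_atTop_of_one_lt h.one_lt).atTop_mul_const hs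
  obtain ⟨n, hn⟩ := (((h.ray j).tendsto_norm.comp h1).eventually_gt_atTop C).exists
  have := hC _ ⟨n, rfl⟩
  simp only [h.iterate_ray j hs.le] at this
  exact absurd this (not_le.2 hn)

theorem notMem_raySet_of_mem_interior (h : RaySystem g κ R) {v : ℂ}
    (hv : v ∈ interior (filledJulia fun z => g.eval z)) : v ∉ raySet R := by
  intro hR
  obtain ⟨j, t, ht, rfl⟩ := mem_raySet.1 hR
  rcases ht.eq_or_lt with e | e
  · rw [← e] at hv
    have h1 := (h.ray j).cont.continuousAt (x := 0)
    have h2 := h1.eventually (mem_interior_iff_mem_nhds.1 hv)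
    obtain ⟨ε, hε, hb⟩ := Metric.eventually_nhds_iff.1 h2
    refine ray_notMem_filledJulia h j (half_pos hε) (hb ?_)
    rw [Real.dist_eq, sub_zero, abs_of_pos (half_pos hε)]
    linarith
  · exact ray_notMem_filledJulia h j e (interior_subset hv)

theorem exists_closure_inter_subset (h : FullRaySystem g κ R)
    (hK : IsClosed (filledJulia fun z => g.eval z)) {c₁ c₂ : ℂ} (hne : c₁ ≠ c₂)
    (h₁ : g.eval c₁ = c₁) (h₂ : g.eval c₂ = c₂) {V₁ V₂ : Set ℂ} (hV₁ : IsPreconnected V₁)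
    (hV₂ : IsPreconnected V₂) (hi₁ : V₁ ⊆ interior (filledJulia fun z => g.eval z))
    (hi₂ : V₂ ⊆ interior (filledJulia fun z => g.eval z)) (hc₁ : c₁ ∈ V₁) (hc₂ : c₂ ∈ V₂) :
    ∃ m, g.eval m = m ∧ closure V₁ ∩ closure V₂ ⊆ {m} := by
  have hr := h.toRaySystem
  have hn := h.not_sameSig hne h₁ h₂ (notMem_raySet_of_mem_interior hr (hi₁ hc₁))
    (notMem_raySet_of_mem_interior hr (hi₂ hc₂))
  simp only [SameSig, not_forall] at hn
  obtain ⟨a, b, hm, hsig⟩ := hn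
  refine ⟨R a 0, hr.fixed_zero a, fun q hq => ?_⟩
  by_contra hqm
  rw [mem_singleton_iff] at hqm
  have hqK : q ∈ filledJulia fun z => g.eval z :=
    closure_minimal (hi₁.trans interior_subset) hK hq.1
  have hoff : ∀ j, R j 0 ≠ q → q ∉ R j '' Ici 0 := by
    rintro j hj ⟨t, ht, e⟩
    rcases (show 0 ≤ t from ht).eq_or_lt with e' | e'
    · exact hj (e' ▸ e)
    · exact ray_notMem_filledJulia hr j e' (e ▸ hqK)
  have hcl : IsClosed (R a '' Ici 0 ∪ R b '' Ici 0) :=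
    (isClosed_image_Ici (hr.ray a) 0).union (isClosed_image_Ici (hr.ray b) 0)
  obtain ⟨ε, hε, hb⟩ := Metric.isOpen_iff.1 hcl.isOpen_compl q (by
    rintro (h1 | h1)
    · exact hoff a (Ne.symm hqm) h1
    · exact hoff b (hm ▸ Ne.symm hqm) h1)
  have hnear : ∀ V : Set ℂ, q ∈ closure V → (V ∩ ball q ε).Nonempty := fun V hV => by
    rw [inter_comm]; exact mem_closure_iff_nhds.1 hV _ (ball_mem_nhds q hε)
  obtain ⟨x₁, hx₁, hx₁'⟩ := hnear V₁ hq.1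
  obtain ⟨x₂, hx₂, hx₂'⟩ := hnear V₂ hq.2
  have hpre : IsPreconnected (V₁ ∪ ball q ε ∪ V₂) :=
    (hV₁.union x₁ hx₁ hx₁' (convex_ball q ε).isPreconnected).union x₂ (Or.inr hx₂') hx₂ hV₂
  have hall : ∀ j, (j = a ∨ j = b) → ∀ v ∈ V₁ ∪ ball q ε ∪ V₂, ∀ t, 0 ≤ t → R j t ≠ v := by
    rintro j hj v ((hv | hv) | hv) t ht e
    · exact notMem_raySet_of_mem_interior hr (hi₁ hv) (mem_raySet.2 ⟨j, t, ht, e⟩)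
    · refine hb hv ?_
      rcases hj with rfl | rfl
      · exact Or.inl ⟨t, ht, e⟩
      · exact Or.inr ⟨t, ht, e⟩
    · exact notMem_raySet_of_mem_interior hr (hi₂ hv) (mem_raySet.2 ⟨j, t, ht, e⟩)
  exact hsig (hr.sig_eq hm hpre (hall a (Or.inl rfl)) (hall b (Or.inr rfl))
    (Or.inl (Or.inl hc₁)) (Or.inr hc₂))

end FullRaySystem

/-! ### Linearisation near infinity -/

/-- A map `ζ ↦ D ζ + e ζ` on the half-plane `σ < re ζ` with a small periodic perturbation `e`. -/
structure IsPerturbation (D : ℕ) (e : ℂ → ℂ) (σ C : ℝ) : Prop where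
  two_le : 2 ≤ D
  one_le : 1 ≤ σ
  nonneg : 0 ≤ C
  small : C * Real.exp (-σ) ≤ 3 / 4
  diff : DifferentiableOn ℂ e {ζ | σ < ζ.re}
  bound : ∀ ζ : ℂ, σ < ζ.re → ‖e ζ‖ ≤ C * Real.exp (-ζ.re)
  per : ∀ ζ, e (ζ + 2 * Real.pi * Complex.I) = e ζ

namespace IsPerturbation

/-- The perturbed map. -/
def map (D : ℕ) (e : ℂ → ℂ) (ζ : ℂ) : ℂ := D * ζ + e ζ

/-- The perturbation conjugating the perturbed map to multiplication by `D`. -/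
noncomputable def corr (D : ℕ) (e : ℂ → ℂ) (ζ : ℂ) : ℂ :=
  ∑' n : ℕ, e ((map D e)^[n] ζ) / (D : ℂ) ^ (n + 1)

/-- The linearising coordinate. -/
noncomputable def lin (D : ℕ) (e : ℂ → ℂ) (ζ : ℂ) : ℂ := ζ + corr D e ζ

variable {D : ℕ} {e : ℂ → ℂ} {σ C : ℝ}

theorem two_le_cast (h : IsPerturbation D e σ C) : (2 : ℝ) ≤ D := by exact_mod_cast h.two_le

theorem cast_ne_zero (h : IsPerturbation D e σ C) : (D : ℂ) ≠ 0 := by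
  have := h.two_le
  exact_mod_cast (by omega : D ≠ 0)

theorem mul_exp_le (h : IsPerturbation D e σ C) {x : ℝ} (hx : σ ≤ x) :
    C * Real.exp (-x) ≤ 3 / 4 :=
  le_trans (mul_le_mul_of_nonneg_left (Real.exp_le_exp.2 (by linarith)) h.nonneg) h.small

theorem norm_le (h : IsPerturbation D e σ C) {ζ : ℂ} (hζ : σ < ζ.re) : ‖e ζ‖ ≤ 3 / 4 :=
  (h.bound ζ hζ).trans (h.mul_exp_le hζ.le)

theorem re_le_re_map (h : IsPerturbation D e σ C) {ζ : ℂ} (hζ : σ < ζ.re) :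
    ζ.re ≤ (map D e ζ).re := by
  have h1 := (abs_le.1 ((Complex.abs_re_le_norm _).trans (h.norm_le hζ))).1
  have h2 := h.two_le_cast
  have h3 := h.one_le
  simp only [map, Complex.add_re, Complex.mul_re, Complex.natCast_re, Complex.natCast_im]
  nlinarith

theorem re_le_re_iterate (h : IsPerturbation D e σ C) {ζ : ℂ} (hζ : σ < ζ.re) (n : ℕ) :
    ζ.re ≤ ((map D e)^[n] ζ).re := by
  induction n with
  | zero => simp
  | succ n ih =>
    rw [iterate_succ_apply']
    exact ih.trans (h.re_le_re_map (hζ.trans_le ih))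

theorem map_add_period (h : IsPerturbation D e σ C) (ζ : ℂ) (n : ℤ) :
    e (ζ + n * (2 * Real.pi * Complex.I)) = e ζ := by
  have : Function.Periodic e (2 * Real.pi * Complex.I) := h.per
  simpa using this.int_mul n ζ

theorem iterate_add_period (h : IsPerturbation D e σ C) (ζ : ℂ) (n : ℤ) (k : ℕ) :
    (map D e)^[k] (ζ + n * (2 * Real.pi * Complex.I)) =
      (map D e)^[k] ζ + ((D ^ k * n : ℤ) : ℂ) * (2 * Real.pi * Complex.I) := by
  induction k with
  | zero => simp
  | succ k ih =>
    rw [iterate_succ_apply', iterate_succ_apply', ih, map, map, h.map_add_period]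
    push_cast
    ring

theorem corr_add_period (h : IsPerturbation D e σ C) (ζ : ℂ) (n : ℤ) :
    corr D e (ζ + n * (2 * Real.pi * Complex.I)) = corr D e ζ := by
  unfold corr
  congr 1
  ext k
  rw [h.iterate_add_period, h.map_add_period]

theorem lin_add_period (h : IsPerturbation D e σ C) (ζ : ℂ) (n : ℤ) :
    lin D e (ζ + n * (2 * Real.pi * Complex.I)) = lin D e ζ + n * (2 * Real.pi * Complex.I) := by
  rw [lin, lin, h.corr_add_period]; ring

theorem term_le (h : IsPerturbation D e σ C) {ζ : ℂ} (hζ : σ < ζ.re) (n : ℕ) :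
    ‖e ((map D e)^[n] ζ) / (D : ℂ) ^ (n + 1)‖ ≤ C * Real.exp (-ζ.re) * (1 / 2) ^ (n + 1) := by
  have h1 := h.re_le_re_iterate hζ n
  have h2 := h.bound _ (hζ.trans_le h1)
  rw [norm_div, norm_pow, Complex.norm_natCast, div_eq_mul_inv, ← inv_pow, one_div]
  have h3 := h.two_le_cast
  have h4 := h.nonneg
  gcongr
  refine h2.trans ?_
  gcongr

theorem hasSum_geometric' (c : ℝ) : HasSum (fun n : ℕ => c * (1 / 2) ^ (n + 1)) c := by
  have := hasSum_geometric_two.mul_left (c / 2)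
  rw [div_mul_cancel₀ c two_ne_zero] at this
  have e : (fun n : ℕ => c * (1 / 2) ^ (n + 1)) = fun n => c / 2 * (1 / 2) ^ n :=
    funext fun n => by ring
  rwa [e]

theorem summable_term (h : IsPerturbation D e σ C) {ζ : ℂ} (hζ : σ < ζ.re) :
    Summable fun n : ℕ => e ((map D e)^[n] ζ) / (D : ℂ) ^ (n + 1) :=
  Summable.of_norm_bounded (hasSum_geometric' _).summable (h.term_le hζ)

theorem norm_corr_le (h : IsPerturbation D e σ C) {ζ : ℂ} (hζ : σ < ζ.re) :
    ‖corr D e ζ‖ ≤ C * Real.exp (-ζ.re) :=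
  tsum_of_norm_bounded (hasSum_geometric' _) (h.term_le hζ)

theorem norm_corr_le' (h : IsPerturbation D e σ C) {ζ : ℂ} (hζ : σ < ζ.re) :
    ‖corr D e ζ‖ ≤ 3 / 4 :=
  (h.norm_corr_le hζ).trans (h.mul_exp_le hζ.le)

theorem isOpen_halfPlane (s : ℝ) : IsOpen {ζ : ℂ | s < ζ.re} :=
  isOpen_lt continuous_const Complex.continuous_re

theorem differentiableOn_map (h : IsPerturbation D e σ C) :
    DifferentiableOn ℂ (map D e) {ζ | σ < ζ.re} :=
  (differentiableOn_id.const_mul _).add h.diff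

theorem differentiableOn_iterate (h : IsPerturbation D e σ C) (n : ℕ) :
    DifferentiableOn ℂ ((map D e)^[n]) {ζ | σ < ζ.re} := by
  induction n with
  | zero => exact differentiableOn_id
  | succ n ih =>
    rw [iterate_succ']
    exact h.differentiableOn_map.comp ih fun ζ hζ => lt_of_lt_of_le hζ (h.re_le_re_iterate hζ n)

theorem differentiableOn_corr (h : IsPerturbation D e σ C) :
    DifferentiableOn ℂ (corr D e) {ζ | σ < ζ.re} := by
  refine Complex.differentiableOn_tsum_of_summable_norm (hasSum_geometric' (3 / 4)).summable
    (fun n => ?_) (isOpen_halfPlane σ) (fun n ζ hζ => ?_)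
  · exact (h.diff.comp (h.differentiableOn_iterate n)
      fun ζ hζ => lt_of_lt_of_le hζ (h.re_le_re_iterate hζ n)).div_const _
  · refine (h.term_le hζ n).trans ?_
    gcongr
    exact h.mul_exp_le (le_of_lt hζ)

theorem lin_map (h : IsPerturbation D e σ C) {ζ : ℂ} (hζ : σ < ζ.re) :
    lin D e (map D e ζ) = D * lin D e ζ := by
  have h1 := (h.summable_term hζ).tsum_eq_zero_add
  have h2 : corr D e (map D e ζ) = D * ∑' n : ℕ, e ((map D e)^[n + 1] ζ) / (D : ℂ) ^ (n + 1 + 1) := by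
    rw [← tsum_mul_left]
    unfold corr
    congr 1
    ext n
    rw [← iterate_succ_apply]
    have := h.cast_ne_zero
    field_simp
    ring
  have h3 : corr D e ζ = ∑' n : ℕ, e ((map D e)^[n] ζ) / (D : ℂ) ^ (n + 1) := rfl
  rw [lin, lin, h2, h3, h1, map]
  have := h.cast_ne_zero
  simp only [iterate_zero, id_eq, zero_add, pow_one]
  field_simp
  ring

theorem dist_corr_le (h : IsPerturbation D e σ C) {x y : ℂ} (hx : σ + 2 < x.re)
    (hy : σ + 2 < y.re) : ‖corr D e x - corr D e y‖ ≤ 1 / 2 * ‖x - y‖ := by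
  have hsub : {ζ : ℂ | σ + 2 < ζ.re} ⊆ {ζ | σ < ζ.re} := fun ζ hζ => by
    simp only [mem_ofPred_eq] at hζ ⊢; linarith
  refine Convex.norm_image_sub_le_of_norm_deriv_le (s := {ζ : ℂ | σ + 2 < ζ.re}) (fun ζ hζ => ?_)
    (fun ζ hζ => ?_) (convex_halfSpace_re_gt _) hy hx
  · exact h.differentiableOn_corr.differentiableAt ((isOpen_halfPlane σ).mem_nhds (hsub hζ))
  · have hb : closedBall ζ (3 / 2) ⊆ {ζ | σ < ζ.re} := fun z hz => by
      have h1 := (Complex.abs_re_le_norm (z - ζ)).trans (mem_closedBall_iff_norm.1 hz)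
      rw [Complex.sub_re] at h1
      have h2 := (abs_le.1 h1).1
      simp only [mem_ofPred_eq] at hζ ⊢
      linarith
    have := Complex.norm_deriv_le_of_forall_mem_sphere_norm_le (by norm_num : (0 : ℝ) < 3 / 2)
      (h.differentiableOn_corr.diffContOnCl_ball hb)
      (fun z hz => h.norm_corr_le' (hb (sphere_subset_closedBall hz)))
    norm_num at this ⊢
    linarith

theorem norm_sub_le (h : IsPerturbation D e σ C) {x y : ℂ} (hx : σ + 2 < x.re)
    (hy : σ + 2 < y.re) : ‖x - y‖ ≤ 2 * ‖lin D e x - lin D e y‖ := by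
  have h1 := h.dist_corr_le hx hy
  have h2 : x - y = (lin D e x - lin D e y) - (corr D e x - corr D e y) := by
    rw [lin, lin]; ring
  have h3 := _root_.norm_sub_le (lin D e x - lin D e y) (corr D e x - corr D e y)
  rw [← h2] at h3
  linarith

theorem lin_injOn (h : IsPerturbation D e σ C) {x y : ℂ} (hx : σ + 2 < x.re)
    (hy : σ + 2 < y.re) (hxy : lin D e x = lin D e y) : x = y := by
  have := h.norm_sub_le hx hy
  rw [hxy, sub_self, norm_zero, mul_zero] at this
  exact sub_eq_zero.1 (norm_le_zero_iff.1 this)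

theorem exists_lin_eq (h : IsPerturbation D e σ C) {ξ : ℂ} (hξ : σ + 5 < ξ.re) :
    ∃ ζ : ℂ, σ + 2 < ζ.re ∧ lin D e ζ = ξ := by
  have hsub : ∀ ζ ∈ closedBall ξ 1, σ + 2 < ζ.re := fun ζ hζ => by
    have h1 := (Complex.abs_re_le_norm (ζ - ξ)).trans (mem_closedBall_iff_norm.1 hζ)
    rw [Complex.sub_re] at h1
    linarith [(abs_le.1 h1).1]
  have hmaps : MapsTo (fun ζ => ξ - corr D e ζ) (closedBall ξ 1) (closedBall ξ 1) := fun ζ hζ => by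
    rw [mem_closedBall_iff_norm]
    simp only [sub_sub_cancel_left, norm_neg]
    exact (h.norm_corr_le' (by linarith [hsub ζ hζ])).trans (by norm_num)
  have hcontr : ContractingWith (1 / 2) (hmaps.restrict _ _ _) := by
    refine ⟨by norm_num, LipschitzWith.of_dist_le_mul fun x y => ?_⟩
    rw [Subtype.dist_eq, Subtype.dist_eq, dist_eq_norm, dist_eq_norm]
    simp only [MapsTo.val_restrict_apply, NNReal.coe_div, NNReal.coe_one, NNReal.coe_ofNat]
    rw [sub_sub_sub_cancel_left, norm_sub_rev]
    exact h.dist_corr_le (hsub x x.2) (hsub y y.2)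
  obtain ⟨ζ, hζ, hfix, -⟩ := hcontr.exists_fixedPoint' isClosed_closedBall.isComplete hmaps
    (mem_closedBall_self zero_le_one) (edist_ne_top _ _)
  have hfix' : ξ - corr D e ζ = ζ := hfix
  exact ⟨ζ, hsub ζ hζ, by rw [lin]; linear_combination -hfix'⟩

end IsPerturbation

/-- An inverse Böttcher coordinate near infinity in logarithmic coordinates. -/
structure IsBottcher (g : Polynomial ℂ) (s₀ : ℝ) (Ψ : ℂ → ℂ) : Prop where
  monic : g.Monic
  two_le : 2 ≤ g.natDegree
  pos : 0 < s₀
  cont : ContinuousOn Ψ {ξ | s₀ < ξ.re}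
  conj : ∀ ξ : ℂ, s₀ < ξ.re → g.eval (Ψ ξ) = Ψ (g.natDegree * ξ)
  inj : ∀ ξ ξ' : ℂ, s₀ < ξ.re → s₀ < ξ'.re → Ψ ξ = Ψ ξ' →
    ∃ n : ℤ, ξ = ξ' + n * (2 * Real.pi * Complex.I)
  per : ∀ (ξ : ℂ) (n : ℤ), s₀ < ξ.re → Ψ (ξ + n * (2 * Real.pi * Complex.I)) = Ψ ξ
  surj : ∃ M : ℝ, ∀ v : ℂ, M < ‖v‖ → ∃ ξ : ℂ, s₀ < ξ.re ∧ Ψ ξ = v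
  lim : Tendsto (fun ξ => Ψ ξ * Complex.exp (-ξ)) (comap Complex.re atTop) (𝓝 1)
  lower : ∀ ξ : ℂ, s₀ < ξ.re → Real.exp ξ.re ≤ 3 * ‖Ψ ξ‖
  upper : ∀ ξ : ℂ, s₀ < ξ.re → ‖Ψ ξ‖ ≤ 3 * Real.exp ξ.re
  isOpenMap : ∀ ξ : ℂ, s₀ < ξ.re → ∀ U ∈ 𝓝 ξ, Ψ '' U ∈ 𝓝 (Ψ ξ)

theorem IsPerturbation.exists_isBottcher {g : Polynomial ℂ} (hg : g.Monic) {e : ℂ → ℂ} {σ C : ℝ}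
    (h : IsPerturbation g.natDegree e σ C)
    (hexp : ∀ ζ : ℂ, σ < ζ.re → g.eval (Complex.exp ζ) = Complex.exp (map g.natDegree e ζ)) :
    ∃ s₀ Ψ, IsBottcher g s₀ Ψ := by
  have hch : ∀ ξ : ℂ, ∃ ζ : ℂ, σ + 5 < ξ.re → σ + 2 < ζ.re ∧ lin g.natDegree e ζ = ξ := fun ξ => by
    by_cases hξ : σ + 5 < ξ.re
    · obtain ⟨ζ, hζ⟩ := h.exists_lin_eq hξ
      exact ⟨ζ, fun _ => hζ⟩
    · exact ⟨0, fun h => absurd h hξ⟩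
  choose ψ hψ using hch
  have hσ := h.one_le
  have hclose : ∀ ξ : ℂ, σ + 5 < ξ.re → ‖ψ ξ - ξ‖ ≤ C * Real.exp (-(ψ ξ).re) ∧
      ‖ψ ξ - ξ‖ ≤ 3 / 4 := fun ξ hξ => by
    obtain ⟨h1, h2⟩ := hψ ξ hξ
    have h3 : ψ ξ - ξ = -corr g.natDegree e (ψ ξ) := by
      rw [lin] at h2
      linear_combination h2
    rw [h3, norm_neg]
    exact ⟨h.norm_corr_le (by linarith), h.norm_corr_le' (by linarith)⟩
  have habs : ∀ ξ : ℂ, σ + 5 < ξ.re → |(ψ ξ).re - ξ.re| ≤ 3 / 4 := fun ξ hξ => by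
    have h1 := (Complex.abs_re_le_norm (ψ ξ - ξ)).trans (hclose ξ hξ).2
    rwa [Complex.sub_re] at h1
  have hre : ∀ ξ : ℂ, σ + 5 < ξ.re → ξ.re - 3 / 4 ≤ (ψ ξ).re := fun ξ hξ => by
    linarith [(abs_le.1 (habs ξ hξ)).1]
  have hthree : Real.exp (3 / 4) ≤ 3 := by
    have := Real.exp_one_lt_d9
    have : Real.exp (3 / 4) ≤ Real.exp 1 := Real.exp_le_exp.2 (by norm_num)
    linarith
  have hψlin : ∀ ζ : ℂ, σ + 2 < ζ.re → σ + 5 < (lin g.natDegree e ζ).re →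
      ψ (lin g.natDegree e ζ) = ζ := fun ζ hζ hζ' =>
    h.lin_injOn (hψ _ hζ').1 hζ (hψ _ hζ').2
  have hlip : ContinuousOn ψ {ξ | σ + 5 < ξ.re} := by
    refine LipschitzOnWith.continuousOn (K := 2) (LipschitzOnWith.of_dist_le_mul fun x hx y hy => ?_)
    have := h.norm_sub_le (hψ x hx).1 (hψ y hy).1
    rw [(hψ x hx).2, (hψ y hy).2] at this
    rw [dist_eq_norm, dist_eq_norm]
    exact_mod_cast this
  have htwo := h.two_le_cast
  have hDre : ∀ ξ : ℂ, σ + 5 < ξ.re → σ + 5 < ((g.natDegree : ℂ) * ξ).re := fun ξ hξ => by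
    simp only [Complex.mul_re, Complex.natCast_re, Complex.natCast_im]
    nlinarith
  have hperre : ∀ (ξ : ℂ) (n : ℤ), (ξ + n * (2 * Real.pi * Complex.I)).re = ξ.re := fun ξ n => by
    simp
  refine ⟨σ + 5, fun ξ => Complex.exp (ψ ξ), hg, h.two_le, by linarith, hlip.cexp, fun ξ hξ => ?_,
    fun ξ ξ' hξ hξ' he => ?_, fun ξ n hξ => ?_, ?_, ?_, fun ξ hξ => ?_, fun ξ hξ => ?_,
    fun ξ hξ U hU => ?_⟩
  · obtain ⟨h1, h2⟩ := hψ ξ hξ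
    rw [hexp _ (by linarith)]
    congr 1
    have h3 := h.lin_map (ζ := ψ ξ) (by linarith)
    rw [h2] at h3
    rw [← h3]
    refine (hψlin _ ?_ ?_).symm
    · exact h1.trans_le (h.re_le_re_map (by linarith))
    · rw [h3]; exact hDre ξ hξ
  · obtain ⟨n, hn⟩ := Complex.exp_eq_exp_iff_exists_int.1 he
    refine ⟨n, ?_⟩
    rw [← (hψ ξ hξ).2, hn, h.lin_add_period, (hψ ξ' hξ').2]
  · have h1 : lin g.natDegree e (ψ ξ + n * (2 * Real.pi * Complex.I)) =
        ξ + n * (2 * Real.pi * Complex.I) := by rw [h.lin_add_period, (hψ ξ hξ).2]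
    have h2 := hψlin (ψ ξ + n * (2 * Real.pi * Complex.I)) (by rw [hperre]; exact (hψ ξ hξ).1)
      (by rw [h1, hperre]; exact hξ)
    rw [h1] at h2
    exact Complex.exp_eq_exp_iff_exists_int.2 ⟨n, h2⟩
  · refine ⟨Real.exp (σ + 6), fun v hv => ?_⟩
    have hv0 : v ≠ 0 := norm_pos_iff.1 ((Real.exp_pos _).trans hv)
    have h1 : σ + 6 < (Complex.log v).re := by
      rw [Complex.log_re]; exact (Real.lt_log_iff_exp_lt (norm_pos_iff.2 hv0)).2 hv
    have h2 : σ + 5 < (lin g.natDegree e (Complex.log v)).re := by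
      have := (Complex.abs_re_le_norm _).trans
        (h.norm_corr_le' (ζ := Complex.log v) (by linarith))
      rw [lin, Complex.add_re]
      linarith [(abs_le.1 this).1]
    exact ⟨_, h2, by simp only [hψlin _ (by linarith) h2, Complex.exp_log hv0]⟩
  · have hlim : Tendsto (fun ξ => ψ ξ - ξ) (comap Complex.re atTop) (𝓝 0) := by
      have hev : ∀ᶠ ξ : ℂ in comap Complex.re atTop, σ + 5 < ξ.re :=
        tendsto_comap.eventually (eventually_gt_atTop (σ + 5))
      refine squeeze_zero_norm' (a := fun ξ : ℂ => C * Real.exp (-(ξ.re - 3 / 4))) ?_ ?_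
      · filter_upwards [hev] with ξ hξ
        refine (hclose ξ hξ).1.trans ?_
        have := h.nonneg
        have := hre ξ hξ
        gcongr
      · have h1 : Tendsto (fun x : ℝ => C * Real.exp (-(x - 3 / 4))) atTop (𝓝 0) := by
          rw [← mul_zero C]
          refine (Real.tendsto_exp_neg_atTop_nhds_zero.comp
            (tendsto_atTop_add_const_right _ (-(3 / 4)) tendsto_id)).const_mul C |>.congr ?_
          intro x
          simp [sub_eq_add_neg]
        exact h1.comp tendsto_comap
    have := (Complex.continuous_exp.tendsto 0).comp hlim
    rw [Complex.exp_zero] at this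
    refine this.congr fun ξ => ?_
    simp only [comp_apply]
    rw [← Complex.exp_add, sub_eq_add_neg]
  · rw [Complex.norm_exp]
    calc Real.exp ξ.re ≤ Real.exp (3 / 4 + (ψ ξ).re) := Real.exp_le_exp.2 (by linarith [hre ξ hξ])
      _ = Real.exp (3 / 4) * Real.exp (ψ ξ).re := Real.exp_add _ _
      _ ≤ _ := by gcongr
  · rw [Complex.norm_exp]
    calc Real.exp (ψ ξ).re ≤ Real.exp (3 / 4 + ξ.re) :=
          Real.exp_le_exp.2 (by linarith [(abs_le.1 (habs ξ hξ)).2])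
      _ = Real.exp (3 / 4) * Real.exp ξ.re := Real.exp_add _ _
      _ ≤ _ := by gcongr
  · obtain ⟨h1, h2⟩ := hψ ξ hξ
    have hcont : ContinuousAt (lin g.natDegree e) (ψ ξ) :=
      continuousAt_id.add (h.differentiableOn_corr.continuousOn.continuousAt
        ((isOpen_halfPlane σ).mem_nhds (show σ < (ψ ξ).re by linarith)))
    have hV : {ζ | lin g.natDegree e ζ ∈ U ∩ {ξ : ℂ | σ + 5 < ξ.re}} ∩ {ζ | σ + 2 < ζ.re} ∈ 𝓝 (ψ ξ) := by
      refine inter_mem (hcont ?_) ((isOpen_halfPlane _).mem_nhds h1)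
      rw [h2]
      exact inter_mem hU ((isOpen_halfPlane _).mem_nhds hξ)
    refine mem_of_superset (Complex.isOpenMap_exp.image_mem_nhds hV) ?_
    rintro _ ⟨ζ, ⟨⟨h3, h4⟩, h5⟩, rfl⟩
    exact ⟨_, h3, by simp only [hψlin ζ h5 h4]⟩

theorem exists_isBottcher {g : Polynomial ℂ} (hg : g.Monic) (hd : 2 ≤ g.natDegree) :
    ∃ s₀ Ψ, IsBottcher g s₀ Ψ := by
  set D := g.natDegree with hD
  set A : ℝ := ∑ i ∈ Finset.range D, ‖g.coeff i‖ with hA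
  have hA0 : 0 ≤ A := Finset.sum_nonneg fun _ _ => norm_nonneg _
  set σ : ℝ := max 1 (Real.log (2 * A + 1)) with hσ
  have hAσ : A * Real.exp (-σ) ≤ 1 / 2 := by
    have h1 : 2 * A + 1 ≤ Real.exp σ := by
      rw [← Real.log_le_iff_le_exp (by linarith)]
      exact le_max_right _ _
    rw [Real.exp_neg, ← div_eq_mul_inv, div_le_iff₀ (Real.exp_pos _)]
    linarith
  have hu : ∀ ζ : ℂ, σ < ζ.re →
      ‖g.eval (Complex.exp ζ) / Complex.exp ζ ^ D - 1‖ ≤ A * Real.exp (-ζ.re) := fun ζ hζ => by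
    have hw : 1 ≤ ‖Complex.exp ζ‖ := by
      rw [Complex.norm_exp]
      exact Real.one_le_exp (by linarith [le_max_left 1 (Real.log (2 * A + 1))])
    have hre : Real.exp (-ζ.re) = ‖Complex.exp ζ‖⁻¹ := by rw [Complex.norm_exp, Real.exp_neg]
    have hw0 : Complex.exp ζ ≠ 0 := Complex.exp_ne_zero ζ
    rw [hre]
    generalize Complex.exp ζ = w at *
    have h1 : g.eval w / w ^ D - 1 = (∑ i ∈ Finset.range D, g.coeff i * w ^ i) / w ^ D := by
      conv_lhs => rw [hg.as_sum]
      rw [← hD]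
      simp only [Polynomial.eval_add, Polynomial.eval_pow, Polynomial.eval_X,
        Polynomial.eval_finsetSum, Polynomial.eval_mul, Polynomial.eval_C]
      field_simp
      ring
    rw [h1, norm_div, norm_pow, div_le_iff₀ (by positivity)]
    refine (norm_sum_le _ _).trans ?_
    rw [hA, Finset.sum_mul, Finset.sum_mul]
    refine Finset.sum_le_sum fun i hi => ?_
    rw [norm_mul, norm_pow, mul_assoc]
    refine mul_le_mul_of_nonneg_left ?_ (norm_nonneg _)
    rw [inv_mul_eq_div, le_div_iff₀ (by positivity), ← pow_succ]
    exact pow_le_pow_right₀ hw (Finset.mem_range.1 hi)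
  have hu2 : ∀ ζ : ℂ, σ < ζ.re →
      ‖g.eval (Complex.exp ζ) / Complex.exp ζ ^ D - 1‖ ≤ 1 / 2 := fun ζ hζ =>
    (hu ζ hζ).trans (le_trans (mul_le_mul_of_nonneg_left
      (Real.exp_le_exp.2 (by linarith)) hA0) hAσ)
  have hslit : ∀ ζ : ℂ, σ < ζ.re → g.eval (Complex.exp ζ) / Complex.exp ζ ^ D ∈
      Complex.slitPlane := fun ζ hζ => by
    have := Complex.mem_slitPlane_of_norm_lt_one ((hu2 ζ hζ).trans_lt (by norm_num))
    rwa [add_sub_cancel] at this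
  refine IsPerturbation.exists_isBottcher (e := fun ζ =>
    Complex.log (g.eval (Complex.exp ζ) / Complex.exp ζ ^ D)) (σ := σ) (C := 3 / 2 * A) hg
    ⟨hd, le_max_left _ _, by positivity, by linarith, fun ζ hζ => ?_, fun ζ hζ => ?_, fun ζ => ?_⟩
    fun ζ hζ => ?_
  · refine DifferentiableAt.differentiableWithinAt (DifferentiableAt.clog ?_ (hslit ζ hζ))
    have h1 : DifferentiableAt ℂ (fun ζ => g.eval (Complex.exp ζ)) ζ :=
      (g.differentiable _).comp ζ Complex.differentiableAt_exp
    exact h1.div (Complex.differentiableAt_exp.pow D) (pow_ne_zero _ (Complex.exp_ne_zero ζ))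
  · have h1 := Complex.norm_log_one_add_half_le_self (hu2 ζ hζ)
    rw [add_sub_cancel] at h1
    exact h1.trans (by linarith [hu ζ hζ])
  · have : Complex.exp (ζ + 2 * Real.pi * Complex.I) = Complex.exp ζ := by
      rw [Complex.exp_add, Complex.exp_two_pi_mul_I, mul_one]
    simp only [this]
  · rw [IsPerturbation.map, Complex.exp_add, Complex.exp_log (Complex.slitPlane_ne_zero (hslit ζ hζ)),
      Complex.exp_nat_mul, ← hD]
    field_simp

/-! ### Lifting curves through polynomials -/

theorem eqOn_of_eval_eq {X : Type*} [TopologicalSpace X] {S : Set X} (hS : IsPreconnected S)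
    (p : Polynomial ℂ) {u v : X → ℂ} (hu : ContinuousOn u S) (hv : ContinuousOn v S)
    (h : ∀ x ∈ S, p.eval (u x) = p.eval (v x)) (hcrit : ∀ x ∈ S, p.derivative.eval (u x) ≠ 0)
    {x : X} (hx : x ∈ S) (hxe : u x = v x) {y : X} (hy : y ∈ S) : u y = v y := by
  rw [isPreconnected_iff_preconnectedSpace] at hS
  rw [continuousOn_iff_continuous_domRestrict] at hu hv
  have hclopen : IsClopen {z : S | S.domRestrict u z = S.domRestrict v z} := by
    refine ⟨isClosed_eq hu hv, isOpen_iff_mem_nhds.2 fun z hz => ?_⟩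
    have hloc := ((p.hasStrictDerivAt (u z)).hasStrictFDerivAt_equiv (hcrit z z.2))
    set e := hloc.toOpenPartialHomeomorph _
    have hmem : e.source ∈ 𝓝 (u z) := e.open_source.mem_nhds
      hloc.mem_toOpenPartialHomeomorph_source
    have hmem' : e.source ∈ 𝓝 (v z) := by
      have : u z = v z := hz
      rwa [this] at hmem
    filter_upwards [hu.continuousAt hmem, hv.continuousAt hmem'] with z' h1 h2
    exact e.injOn h1 h2 (h z' z'.2)
  have := hclopen.eq_univ ⟨⟨x, hx⟩, hxe⟩
  exact (this ▸ mem_univ (⟨y, hy⟩ : S) : (⟨y, hy⟩ : S) ∈ {z : S | S.domRestrict u z = S.domRestrict v z})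

/-- The forward orbits of the critical points. -/
def postcrit (g : Polynomial ℂ) : Set ℂ :=
  {z | ∃ (n : ℕ) (c : ℂ), g.derivative.eval c = 0 ∧ (fun z => g.eval z)^[n] c = z}

theorem eval_mem_postcrit {g : Polynomial ℂ} {z : ℂ} (hz : z ∈ postcrit g) :
    g.eval z ∈ postcrit g := by
  obtain ⟨n, c, hc, rfl⟩ := hz
  exact ⟨n + 1, c, hc, iterate_succ_apply' _ _ _⟩

theorem mem_postcrit_of_derivative {g : Polynomial ℂ} {z : ℂ} (hz : g.derivative.eval z = 0) :
    z ∈ postcrit g := ⟨0, z, hz, rfl⟩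

theorem countable_postcrit {g : Polynomial ℂ} (hd : 2 ≤ g.natDegree) : (postcrit g).Countable := by
  have hne : g.derivative ≠ 0 := fun h => by
    have := Polynomial.derivative_eq_zero.1 h
    omega
  have hfin : {c | g.derivative.eval c = 0}.Finite := by
    refine (g.derivative.roots.toFinset.finite_toSet).subset fun c hc => ?_
    simpa [hne] using hc
  have : postcrit g = ⋃ n : ℕ, (fun z => g.eval z)^[n] '' {c | g.derivative.eval c = 0} := by
    ext z; simp [postcrit]
  rw [this]
  exact countable_iUnion fun n => (hfin.image _).countable

theorem iterate_ne_zero_derivative {g : Polynomial ℂ} {z : ℂ} (n : ℕ)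
    (hz : (fun z => g.eval z)^[n] z ∉ postcrit g) :
    ∃ d : ℂ, d ≠ 0 ∧ HasStrictDerivAt ((fun z => g.eval z)^[n]) d z := by
  induction n with
  | zero => exact ⟨1, one_ne_zero, hasStrictDerivAt_id z⟩
  | succ n ih =>
    rw [iterate_succ_apply'] at hz
    obtain ⟨d, hd, hd'⟩ := ih fun h => hz (eval_mem_postcrit h)
    rw [iterate_succ']
    refine ⟨_, mul_ne_zero (fun h => hz ?_) hd, (g.hasStrictDerivAt _).comp z hd'⟩
    exact eval_mem_postcrit (mem_postcrit_of_derivative h)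

theorem eqOn_of_iterate_eq {X : Type*} [TopologicalSpace X] {S : Set X} (hS : IsPreconnected S)
    (g : Polynomial ℂ) (n : ℕ) {u v : X → ℂ} (hu : ContinuousOn u S) (hv : ContinuousOn v S)
    (h : ∀ x ∈ S, (fun z => g.eval z)^[n] (u x) = (fun z => g.eval z)^[n] (v x))
    (hcrit : ∀ x ∈ S, (fun z => g.eval z)^[n] (u x) ∉ postcrit g)
    {x : X} (hx : x ∈ S) (hxe : u x = v x) {y : X} (hy : y ∈ S) : u y = v y := by
  induction n generalizing u v x y with
  | zero => exact h y hy
  | succ n ih =>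
    simp only [iterate_succ_apply] at h hcrit
    have hcont := g.continuous
    have h1 : ∀ y ∈ S, g.eval (u y) = g.eval (v y) := fun y hy =>
      ih (hcont.comp_continuousOn hu) (hcont.comp_continuousOn hv) h hcrit hx
        (by simp only [comp_apply, hxe]) hy
    have hmem : ∀ (k : ℕ) (z : ℂ), z ∈ postcrit g → (fun z => g.eval z)^[k] z ∈ postcrit g := by
      intro k
      induction k with
      | zero => exact fun z hz => hz
      | succ k ihk =>
        intro z hz
        rw [iterate_succ_apply']
        exact eval_mem_postcrit (ihk z hz)
    exact eqOn_of_eval_eq hS g hu hv h1 (fun x hx h0 => hcrit x hx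
      (hmem n _ (eval_mem_postcrit (mem_postcrit_of_derivative h0)))) hx hxe hy

/-- A curve `β` near infinity on which `g` acts by multiplying the parameter by `D`, extended
down to the parameter `t / D ^ n`. -/
structure IsDescent (g : Polynomial ℂ) (t : ℝ) (n : ℕ) (β : ℝ → ℂ) : Prop where
  cont : ContinuousOn β (Ici (t / g.natDegree ^ n))
  conj : ∀ s, t / g.natDegree ^ n ≤ s → g.eval (β s) = β (g.natDegree * s)
  avoid : ∀ s, t ≤ s → β s ∉ postcrit g

namespace IsDescent

variable {g : Polynomial ℂ} {t : ℝ} {n : ℕ} {β β' : ℝ → ℂ}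

theorem mono (ht : 0 < t) (hd : 2 ≤ g.natDegree) (h : IsDescent g t (n + 1) β) :
    IsDescent g t n β := by
  have hD : (1 : ℝ) ≤ g.natDegree := by exact_mod_cast (by omega : 1 ≤ g.natDegree)
  have hle : t / (g.natDegree : ℝ) ^ (n + 1) ≤ t / (g.natDegree : ℝ) ^ n := by
    exact div_le_div_of_nonneg_left ht.le (by positivity) (pow_le_pow_right₀ hD n.le_succ)
  exact ⟨h.cont.mono (Ici_subset_Ici.2 hle), fun s hs => h.conj s (hle.trans hs), h.avoid⟩

theorem notMem (ht : 0 < t) (hd : 2 ≤ g.natDegree) (h : IsDescent g t n β) {s : ℝ}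
    (hs : t / g.natDegree ^ n ≤ s) : β s ∉ postcrit g := by
  induction n generalizing s with
  | zero => exact h.avoid s (by simpa using hs)
  | succ n ih =>
    intro hmem
    have := eval_mem_postcrit hmem
    rw [h.conj s hs] at this
    refine ih (h.mono ht hd) ?_ this
    have hD : (0 : ℝ) < g.natDegree := by exact_mod_cast (by omega : 0 < g.natDegree)
    rw [pow_succ, div_le_iff₀ (by positivity)] at hs
    rw [div_le_iff₀ (by positivity)]
    linarith

theorem eq (ht : 0 < t) (hd : 2 ≤ g.natDegree) (h : IsDescent g t n β) (h' : IsDescent g t n β')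
    (he : ∀ s, t ≤ s → β s = β' s) {s : ℝ} (hs : t / g.natDegree ^ n ≤ s) : β s = β' s := by
  have hD : (1 : ℝ) < g.natDegree := by exact_mod_cast (by omega : 1 < g.natDegree)
  induction n generalizing s with
  | zero => exact he s (by simpa using hs)
  | succ n ih =>
    have hmul : ∀ s, t / (g.natDegree : ℝ) ^ (n + 1) ≤ s →
        t / (g.natDegree : ℝ) ^ n ≤ g.natDegree * s := fun s hs => by
      rw [pow_succ, div_le_iff₀ (by positivity)] at hs
      rw [div_le_iff₀ (by positivity)]
      linarith
    refine eqOn_of_eval_eq (S := Ici (t / (g.natDegree : ℝ) ^ (n + 1))) isPreconnected_Ici g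
      h.cont h'.cont (fun x hx => ?_) (fun x hx h0 => ?_) (x := t) ?_ (he t le_rfl) hs
    · rw [h.conj x hx, h'.conj x hx]
      exact ih (h.mono ht hd) (h'.mono ht hd) (hmul x hx)
    · exact h.notMem ht hd hx (mem_postcrit_of_derivative h0)
    · exact div_le_self ht.le (one_le_pow₀ hD.le)

theorem extend (ht : 0 < t) (hd : 2 ≤ g.natDegree) (h : IsDescent g t n β) :
    ∃ β', IsDescent g t (n + 1) β' ∧ ∀ s, t ≤ s → β' s = β s := by
  have hD : (1 : ℝ) < g.natDegree := by exact_mod_cast (by omega : 1 < g.natDegree)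
  have hD0 : (0 : ℝ) < g.natDegree := by linarith
  set a : ℝ := t / (g.natDegree : ℝ) ^ (n + 1) with ha
  have hat : a ≤ t := div_le_self ht.le (one_le_pow₀ hD.le)
  have hmul : ∀ s, a ≤ s → t / (g.natDegree : ℝ) ^ n ≤ g.natDegree * s := fun s hs => by
    rw [ha, pow_succ, div_le_iff₀ (by positivity)] at hs
    rw [div_le_iff₀ (by positivity)]
    linarith
  have hle : ∀ s, t ≤ s → t / (g.natDegree : ℝ) ^ n ≤ s := fun s hs =>
    (div_le_self ht.le (one_le_pow₀ hD.le)).trans hs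
  obtain ⟨F, ⟨hF0, hF⟩, -⟩ := g.isCoveringMapOn_eval.existsUnique_continuousMap_lifts
    ⟨fun s => β (g.natDegree * max a s), h.cont.comp_continuous (by fun_prop)
      fun s => hmul _ (le_max_left _ _)⟩ (a₀ := t) (e₀ := β t)
    (by rw [h.conj t (hle t le_rfl), ContinuousMap.coe_mk, max_eq_right hat])
    (fun s => by
      rintro ⟨c, hc, hc'⟩
      refine h.notMem ht hd (hmul _ (le_max_left a s)) ?_
      rw [ContinuousMap.coe_mk] at hc'
      rw [← hc']
      exact eval_mem_postcrit (mem_postcrit_of_derivative hc))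
  have hFe : ∀ s, a ≤ s → g.eval (F s) = β (g.natDegree * s) := fun s hs => by
    have := congrFun hF s
    simpa [max_eq_right hs] using this
  have hanle : a ≤ t / (g.natDegree : ℝ) ^ n := by
    rw [ha, pow_succ, ← div_div]
    exact div_le_self (by positivity) hD.le
  have heq : ∀ s, t / (g.natDegree : ℝ) ^ n ≤ s → F s = β s := fun s hs =>
    (eqOn_of_eval_eq isPreconnected_Ici g h.cont F.continuous.continuousOn
      (fun x hx => by rw [h.conj x hx, hFe x (hanle.trans hx)])
      (fun x hx h0 => h.notMem ht hd hx (mem_postcrit_of_derivative h0)) (hle t le_rfl) hF0.symm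
      hs).symm
  exact ⟨F, ⟨F.continuous.continuousOn, fun s hs => by rw [hFe s hs, heq _ (hmul s hs)],
    fun s hs => by rw [heq s (hle s hs)]; exact h.avoid s hs⟩, fun s hs => heq s (hle s hs)⟩

/-- A curve defined near infinity extends to all positive parameters. -/
theorem exists_extension (ht : 0 < t) (hd : 2 ≤ g.natDegree) (h : IsDescent g t 0 β) :
    ∃ β' : ℝ → ℂ, ContinuousOn β' (Ioi 0) ∧ (∀ s, t ≤ s → β' s = β s) ∧
      (∀ s, 0 < s → g.eval (β' s) = β' (g.natDegree * s)) ∧ ∀ s, 0 < s → β' s ∉ postcrit g := by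
  have hD : (1 : ℝ) < g.natDegree := by exact_mod_cast (by omega : 1 < g.natDegree)
  have hall : ∀ n, ∃ β', IsDescent g t n β' ∧ ∀ s, t ≤ s → β' s = β s := fun n => by
    induction n with
    | zero => exact ⟨β, h, fun _ _ => rfl⟩
    | succ n ih =>
      obtain ⟨β₁, h1, h2⟩ := ih
      obtain ⟨β₂, h3, h4⟩ := h1.extend ht hd
      exact ⟨β₂, h3, fun s hs => (h4 s hs).trans (h2 s hs)⟩
  choose b hb hbe using hall
  have hmono : ∀ n k, IsDescent g t n (b (n + k)) := fun n k => by
    suffices ∀ k m, IsDescent g t (n + k) (b m) → IsDescent g t n (b m) from this k _ (hb _)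
    intro k
    induction k with
    | zero => exact fun m hm => hm
    | succ k ih => exact fun m hm => ih m (IsDescent.mono ht hd hm)
  have hagree : ∀ n m, n ≤ m → ∀ s, t / (g.natDegree : ℝ) ^ n ≤ s → b n s = b m s := by
    intro n m hnm s hs
    obtain ⟨k, rfl⟩ := Nat.exists_eq_add_of_le hnm
    exact (hb n).eq ht hd (hmono n k) (fun s hs => by rw [hbe n s hs, hbe _ s hs]) hs
  have hlow : ∀ s : ℝ, 0 < s → ∃ n : ℕ, t / (g.natDegree : ℝ) ^ n < s := fun s hs => by
    obtain ⟨n, hn⟩ := pow_unbounded_of_one_lt (t / s) hD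
    refine ⟨n, ?_⟩
    rw [div_lt_iff₀ hs] at hn
    rwa [div_lt_iff₀ (by positivity), mul_comm]
  have hlow' : ∀ s : ℝ, ∃ n : ℕ, 0 < s → t / (g.natDegree : ℝ) ^ n < s := fun s => by
    by_cases hs : 0 < s
    · obtain ⟨n, hn⟩ := hlow s hs; exact ⟨n, fun _ => hn⟩
    · exact ⟨0, fun h => absurd h hs⟩
  choose N hN using hlow'
  have heq : ∀ n s, t / (g.natDegree : ℝ) ^ n < s → b (N s) s = b n s := fun n s hs => by
    have hs0 : 0 < s := lt_trans (by positivity) hs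
    rw [hagree (N s) _ (le_max_left (N s) n) s (hN s hs0).le,
      hagree n _ (le_max_right (N s) n) s hs.le]
  refine ⟨fun s => b (N s) s, fun s hs => ?_, fun s hs => hbe _ s hs, fun s hs => ?_,
    fun s hs => (hb _).notMem ht hd (hN s hs).le⟩
  · have h1 : Ici (t / (g.natDegree : ℝ) ^ N s) ∈ 𝓝 s := Ici_mem_nhds (hN s hs)
    refine (((hb (N s)).cont.continuousAt h1).congr ?_).continuousWithinAt
    filter_upwards [lt_mem_nhds (hN s hs)] with s' hs'
    exact (heq _ _ hs').symm
  · have h1 : t / (g.natDegree : ℝ) ^ N s < g.natDegree * s :=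
      (hN s hs).trans (lt_mul_of_one_lt_left hs hD)
    rw [(hb (N s)).conj s (hN s hs).le]
    exact (heq _ _ h1).symm

end IsDescent

/-! ### Escaping orbits -/

theorem exists_escape_radius {g : Polynomial ℂ} (hd : 2 ≤ g.natDegree) :
    ∃ ρ > (0 : ℝ), ∀ z : ℂ, ρ < ‖z‖ → 2 * ‖z‖ ≤ ‖g.eval z‖ := by
  have h1 : 0 < g.divX.degree := by
    rw [← Polynomial.natDegree_pos_iff_degree_pos, Polynomial.natDegree_divX_eq_natDegree_tsub_one]
    omega
  have h2 : Tendsto (fun z : ℂ => ‖g.divX.eval z‖) (comap norm atTop) atTop :=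
    g.divX.tendsto_norm_atTop h1 tendsto_comap
  have h3 := h2.eventually_ge_atTop 3
  rw [eventually_comap] at h3
  obtain ⟨a, ha⟩ := h3.exists_forall_of_atTop
  refine ⟨max (max a ‖g.coeff 0‖) 1, by positivity, fun z hz => ?_⟩
  have hz1 : a ≤ ‖z‖ := ((le_max_left _ _).trans (le_max_left _ _)).trans hz.le
  have hz2 : ‖g.coeff 0‖ ≤ ‖z‖ := ((le_max_right _ _).trans (le_max_left _ _)).trans hz.le
  have h4 := ha _ hz1 z rfl
  have h5 : g.eval z = g.divX.eval z * z + g.coeff 0 := by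
    conv_lhs => rw [← g.divX_mul_X_add]
    simp
  have h6 := norm_sub_norm_le (g.divX.eval z * z) (-g.coeff 0)
  rw [sub_neg_eq_add, ← h5, norm_neg, norm_mul] at h6
  nlinarith [norm_nonneg z]

/-- `ρ` is a radius beyond which `g` at least doubles the modulus. -/
structure IsEscapeRadius (g : Polynomial ℂ) (ρ : ℝ) : Prop where
  pos : 0 < ρ
  le : ∀ z : ℂ, ρ < ‖z‖ → 2 * ‖z‖ ≤ ‖g.eval z‖

/-- Some iterate of `z` leaves the disc of radius `ρ`. -/
def Escapes (g : Polynomial ℂ) (ρ : ℝ) (z : ℂ) : Prop := ∃ n, ρ < ‖(fun z => g.eval z)^[n] z‖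

namespace IsEscapeRadius

variable {g : Polynomial ℂ} {ρ : ℝ} {z : ℂ}

theorem pow_le_iterate (h : IsEscapeRadius g ρ) (hz : ρ < ‖z‖) (n : ℕ) :
    2 ^ n * ‖z‖ ≤ ‖(fun z => g.eval z)^[n] z‖ := by
  induction n with
  | zero => simp
  | succ n ih =>
    have h1 : ‖z‖ ≤ 2 ^ n * ‖z‖ :=
      le_mul_of_one_le_left (norm_nonneg z) (one_le_pow₀ one_le_two)
    have h2 := h.le _ (hz.trans_le (h1.trans ih))
    rw [iterate_succ_apply', pow_succ]
    linarith

theorem norm_le_iterate (h : IsEscapeRadius g ρ) (hz : ρ < ‖z‖) (n : ℕ) :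
    ‖z‖ ≤ ‖(fun z => g.eval z)^[n] z‖ :=
  (le_mul_of_one_le_left (norm_nonneg z) (one_le_pow₀ one_le_two)).trans (h.pow_le_iterate hz n)

theorem tendsto (h : IsEscapeRadius g ρ) (hz : Escapes g ρ z) :
    Tendsto (fun n => ‖(fun z => g.eval z)^[n] z‖) atTop atTop := by
  obtain ⟨m, hm⟩ := hz
  have h1 : Tendsto (fun n => ‖(fun z => g.eval z)^[n + m] z‖) atTop atTop := by
    refine tendsto_atTop_mono (fun n => ?_)
      ((tendsto_pow_atTop_atTop_of_one_lt one_lt_two).atTop_mul_const (h.pos.trans hm))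
    rw [iterate_add_apply]
    exact h.pow_le_iterate hm n
  exact (tendsto_add_atTop_iff_nat m).1 h1

theorem isOpen_escapes (g : Polynomial ℂ) (ρ : ℝ) : IsOpen {z | Escapes g ρ z} := by
  have : {z | Escapes g ρ z} = ⋃ n, {z | ρ < ‖(fun z => g.eval z)^[n] z‖} := by
    ext z; simp [Escapes]
  rw [this]
  exact isOpen_iUnion fun n => isOpen_lt continuous_const (g.continuous.iterate n).norm

theorem isClosed_filledJulia (h : IsEscapeRadius g ρ) :
    IsClosed (filledJulia fun z => g.eval z) := by
  have : filledJulia (fun z => g.eval z) = {z | Escapes g ρ z}ᶜ := by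
    ext z
    constructor
    · intro hb he
      rw [filledJulia, mem_ofPred_eq] at hb
      obtain ⟨C, hC⟩ := hb.exists_norm_le
      obtain ⟨n, hn⟩ := ((h.tendsto he).eventually_gt_atTop C).exists
      exact absurd (hC _ ⟨n, rfl⟩) (not_le.2 hn)
    · intro hz
      rw [filledJulia, mem_ofPred_eq]
      refine isBounded_iff_forall_norm_le.2 ⟨ρ, ?_⟩
      rintro _ ⟨n, rfl⟩
      by_contra hn
      exact hz ⟨n, not_le.1 hn⟩
  rw [this]
  exact (isOpen_escapes g ρ).isClosed_compl

theorem escapes_of_iterate {n : ℕ} (hz : Escapes g ρ ((fun z => g.eval z)^[n] z)) :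
    Escapes g ρ z := by
  obtain ⟨m, hm⟩ := hz
  exact ⟨m + n, by rwa [iterate_add_apply]⟩

theorem eventually_notMem_postcrit (h : IsEscapeRadius g ρ) (hd : 2 ≤ g.natDegree)
    (hz : Escapes g ρ z) (hP : z ∉ postcrit g) :
    ∀ᶠ w in 𝓝 z, w ∉ postcrit g ∧ Escapes g ρ w := by
  have hne : g.derivative ≠ 0 := fun h => by
    have := Polynomial.derivative_eq_zero.1 h
    omega
  have h1 : ∀ᶠ w in 𝓝 z, ∀ c ∈ g.derivative.roots.toFinset,
      ∀ n, (fun z => g.eval z)^[n] c ≠ w ∨ ¬ Escapes g ρ w := by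
    refine (Finset.eventually_all _).2 fun c hc => ?_
    have hc0 : g.derivative.eval c = 0 := by simpa [hne] using hc
    by_cases hce : Escapes g ρ c
    · obtain ⟨N, hN⟩ := ((h.tendsto hce).eventually_gt_atTop (‖z‖ + 1)).exists_forall_of_atTop
      have h2 : ∀ᶠ w in 𝓝 z, ∀ n ∈ Finset.range N, (fun z => g.eval z)^[n] c ≠ w :=
        (Finset.eventually_all _).2 fun n _ =>
          (eventually_ne_nhds fun e => hP ⟨n, c, hc0, e.symm⟩).mono fun w hw e => hw e.symm
      have h3 : ∀ᶠ w in 𝓝 z, ‖w‖ < ‖z‖ + 1 :=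
        continuous_norm.continuousAt.eventually (gt_mem_nhds (lt_add_one _))
      filter_upwards [h2, h3] with w hw1 hw2 n
      left
      by_cases hn : n < N
      · exact hw1 n (Finset.mem_range.2 hn)
      · rintro rfl
        exact absurd hw2 (not_lt.2 (hN n (not_lt.1 hn)).le)
    · refine Eventually.of_forall fun w n => ?_
      by_cases hw : Escapes g ρ w
      · left
        rintro rfl
        exact hce (escapes_of_iterate hw)
      · exact Or.inr hw
  filter_upwards [h1, (isOpen_escapes g ρ).mem_nhds hz] with w hw hwe
  refine ⟨?_, hwe⟩
  rintro ⟨n, c, hc, e⟩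
  rcases hw c (by simpa [hne] using hc) n with h2 | h2
  · exact h2 e
  · exact h2 hwe

end IsEscapeRadius

/-! ### Inverse branches -/

theorem exists_ball_subset_image {M r ε : ℝ} (hM : 0 < M) (hr : 0 < r) (hε : 0 < ε) :
    ∃ δ > 0, ∀ (f : ℂ → ℂ) (z : ℂ), DifferentiableOn ℂ f (ball z r) →
      (∀ w ∈ ball z r, ‖f w‖ ≤ M) → ε ≤ ‖deriv f z‖ → ball (f z) δ ⊆ f '' ball z r := by
  set K : ℝ := 2 * M / r
  set C : ℝ := 2 * K / r
  have hC : 0 < C := by positivity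
  set η : ℝ := min (r / 2) (ε / (2 * C))
  have hη : 0 < η := by positivity
  have hηr : η < r := (min_le_left _ _).trans_lt (by linarith)
  refine ⟨η * (ε / 2) / 2, by positivity, fun f z hf hb hd => ?_⟩
  have hz : z ∈ ball z r := mem_ball_self hr
  have h1 : ∀ w ∈ ball z r, ‖dslope f z w‖ ≤ K := fun w hw =>
    Complex.norm_dslope_le_div_of_mapsTo_ball hf (fun w hw => by
      rw [mem_closedBall, dist_eq_norm]
      linarith [norm_sub_le (f w) (f z), hb w hw, hb z hz]) hw
  have hds : DifferentiableOn ℂ (dslope f z) (ball z r) :=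
    (Complex.differentiableOn_dslope (ball_mem_nhds z hr)).2 hf
  have h2 : ∀ w ∈ ball z r, dist (dslope f z w) (dslope f z z) ≤ C * dist w z := fun w hw =>
    Complex.dist_le_div_mul_dist_of_mapsTo_ball hds (fun w hw => by
      rw [mem_closedBall, dist_eq_norm]
      linarith [norm_sub_le (dslope f z w) (dslope f z z), h1 w hw, h1 z hz]) hw
  have h3 : ∀ w ∈ sphere z η, η * (ε / 2) ≤ ‖f w - f z‖ := fun w hw => by
    have hw' : dist w z = η := hw
    have h4 := h2 w (by rw [mem_ball, hw']; exact hηr)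
    rw [dslope_same, hw', dist_eq_norm] at h4
    have h5 := norm_sub_norm_le (deriv f z) (dslope f z w)
    rw [norm_sub_rev] at h5
    have h6 : C * η ≤ ε / 2 := by
      have : η ≤ ε / (2 * C) := min_le_right _ _
      rw [le_div_iff₀ (by positivity)] at this
      linarith
    rw [← sub_smul_dslope, norm_smul, ← dist_eq_norm, hw']
    gcongr
    linarith
  have hdiff : DiffContOnCl ℂ f (ball z η) := (hf.mono (closedBall_subset_ball hηr)).diffContOnCl_ball
    subset_rfl
  have hne : ∃ᶠ w in 𝓝 z, f w ≠ f z := by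
    have h4 : HasDerivAt f (deriv f z) z := (hf.differentiableAt (ball_mem_nhds z hr)).hasDerivAt
    exact ((h4.eventually_ne (norm_pos_iff.1 (hε.trans_le hd))).frequently).filter_mono
      nhdsWithin_le_nhds
  exact (hdiff.ball_subset_image_closedBall hη h3 hne).trans
    (image_mono (closedBall_subset_ball hηr))

theorem exists_branch {g : Polynomial ℂ} (n : ℕ) {z₀ : ℂ} {r : ℝ} (hr : 0 < r)
    (hP : ∀ z ∈ ball z₀ r, z ∉ postcrit g) {e₀ : ℂ} (he : (fun z => g.eval z)^[n] e₀ = z₀) :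
    ∃ h : ℂ → ℂ, DifferentiableOn ℂ h (ball z₀ r) ∧ h z₀ = e₀ ∧
      ∀ z ∈ ball z₀ r, (fun z => g.eval z)^[n] (h z) = z := by
  set b := OpenPartialHomeomorph.univBall z₀ r
  have hbs : b.source = univ := OpenPartialHomeomorph.univBall_source z₀ r
  have hbt : b.target = ball z₀ r := OpenPartialHomeomorph.univBall_target z₀ hr
  have hb0 : b 0 = z₀ := OpenPartialHomeomorph.univBall_apply_zero z₀ r
  have hmem : ∀ x, b x ∈ ball z₀ r := fun x => hbt ▸ b.map_source (hbs ▸ mem_univ x)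
  have hbc : Continuous b := by
    rw [← continuousOn_univ, ← hbs]; exact b.continuousOn
  have hlift : ∃ F : ℂ → ℂ, Continuous F ∧ F 0 = e₀ ∧ ∀ x, (fun z => g.eval z)^[n] (F x) = b x := by
    induction n generalizing e₀ with
    | zero => exact ⟨b, hbc, by rw [hb0]; exact he.symm, fun x => rfl⟩
    | succ n ih =>
      rw [iterate_succ_apply] at he
      obtain ⟨F, hF, hF0, hFb⟩ := ih he
      have hFP : ∀ x, F x ∉ postcrit g := fun x hx => by
        have : ∀ k : ℕ, (fun z => g.eval z)^[k] (F x) ∈ postcrit g := fun k => by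
          induction k with
          | zero => exact hx
          | succ k ihk => rw [iterate_succ_apply']; exact eval_mem_postcrit ihk
        exact hP _ (hmem x) (hFb x ▸ this n)
      obtain ⟨G, ⟨hG0, hG⟩, -⟩ := g.isCoveringMapOn_eval.existsUnique_continuousMap_lifts
        ⟨F, hF⟩ (a₀ := 0) (e₀ := e₀) hF0.symm (fun x => by
          rintro ⟨c, hc, hc'⟩
          refine hFP x ?_
          rw [ContinuousMap.coe_mk] at hc'
          rw [← hc']
          exact eval_mem_postcrit (mem_postcrit_of_derivative hc))
      refine ⟨G, G.continuous, hG0, fun x => ?_⟩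
      rw [iterate_succ_apply, ← hFb x]
      congr 1
      exact congrFun hG x
  obtain ⟨F, hF, hF0, hFb⟩ := hlift
  have hinv : ∀ z ∈ ball z₀ r, (fun z => g.eval z)^[n] (F (b.symm z)) = z := fun z hz => by
    rw [hFb]; exact b.right_inv (hbt ▸ hz)
  have hcont : ContinuousOn (fun z => F (b.symm z)) (ball z₀ r) :=
    hF.comp_continuousOn (hbt ▸ b.continuousOn_symm)
  refine ⟨fun z => F (b.symm z), fun z hz => ?_, ?_, hinv⟩
  · obtain ⟨d, hd, hd'⟩ := iterate_ne_zero_derivative (g := g) (z := F (b.symm z)) n (by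
      rw [hinv z hz]; exact hP z hz)
    have hz' := isOpen_ball.mem_nhds hz
    exact (HasDerivAt.of_local_left_inverse (hcont.continuousAt hz') hd'.hasDerivAt hd
      (eventually_of_mem hz' hinv)).differentiableAt.differentiableWithinAt
  · have : b.symm z₀ = 0 := by
      conv_lhs => rw [← hb0]
      exact b.left_inv (hbs ▸ mem_univ 0)
    simp only [this, hF0]

/-! ### Landing of invariant escaping curves -/

theorem tendsto_fixed_of_steps {g : Polynomial ℂ} (hd : 2 ≤ g.natDegree) {x : ℕ → ℂ} {M : ℝ}
    (hM : ∀ n, ‖x n‖ ≤ M) (hg : Tendsto (fun n => g.eval (x n) - x n) atTop (𝓝 0))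
    (hstep : Tendsto (fun n => x (n + 1) - x n) atTop (𝓝 0)) :
    ∃ w, g.eval w = w ∧ Tendsto x atTop (𝓝 w) := by
  have hfix : ∀ (φ : ℕ → ℕ) (w : ℂ), StrictMono φ → Tendsto (x ∘ φ) atTop (𝓝 w) →
      g.eval w = w := fun φ w hφ hw => by
    have h1 : Tendsto (fun n => g.eval (x (φ n)) - x (φ n)) atTop (𝓝 (g.eval w - w)) :=
      ((g.continuous.tendsto w).comp hw).sub hw
    exact sub_eq_zero.1 (tendsto_nhds_unique h1 (hg.comp hφ.tendsto_atTop))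
  obtain ⟨w, -, φ, hφ, hw⟩ := (isCompact_closedBall (0 : ℂ) M).tendsto_subseq (x := x)
    fun n => mem_closedBall_zero_iff.2 (hM n)
  refine ⟨w, hfix φ w hφ hw, ?_⟩
  have hne : g - Polynomial.X ≠ 0 := fun h => by
    have h1 := Polynomial.natDegree_sub_eq_left_of_natDegree_lt (p := g) (q := Polynomial.X)
      (by rw [Polynomial.natDegree_X]; omega)
    rw [h, Polynomial.natDegree_zero] at h1
    omega
  have hfin : {z | g.eval z = z}.Finite := by
    refine (g - Polynomial.X).roots.toFinset.finite_toSet.subset fun z hz => ?_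
    have hz' : g.eval z = z := hz
    simp [hne, hz']
  have hiso : ∀ᶠ z in 𝓝 w, g.eval z = z → z = w := by
    filter_upwards [(hfin.subset (sdiff_subset (t := {w}))).isClosed.isOpen_compl.mem_nhds
      (x := w) (by simp)] with z hz e
    by_contra hzw
    exact hz ⟨e, hzw⟩
  obtain ⟨δ, hδ, hiso⟩ := Metric.eventually_nhds_iff.1 hiso
  have key : ∀ ε, 0 < ε → ε < δ → ∀ᶠ n in atTop, dist (x n) w < ε := fun ε hε hεδ => by
    have hA : ∀ᶠ n in atTop, ¬ (ε / 2 ≤ dist (x n) w ∧ dist (x n) w ≤ ε) := by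
      by_contra hcon
      obtain ⟨ψ, hψ, hψA⟩ := extraction_of_frequently_atTop (not_eventually.1 hcon)
      have hcpt : IsCompact {z : ℂ | ε / 2 ≤ dist z w ∧ dist z w ≤ ε} := by
        refine (isCompact_closedBall w ε).of_isClosed_subset ?_ fun z hz => hz.2
        exact (isClosed_le continuous_const (continuous_id.dist continuous_const)).inter
          (isClosed_le (continuous_id.dist continuous_const) continuous_const)
      obtain ⟨w', hw', χ, hχ, hlim⟩ := hcpt.tendsto_subseq (x := x ∘ ψ)
        fun n => not_not.1 (hψA n)
      have h1 := hiso (hw'.2.trans_lt hεδ) (hfix _ w' (hψ.comp hχ) hlim)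
      have h2 : ε / 2 ≤ dist w' w := hw'.1
      rw [h1, dist_self] at h2
      linarith
    have hs : ∀ᶠ n in atTop, ‖x (n + 1) - x n‖ < ε / 2 :=
      (tendsto_zero_iff_norm_tendsto_zero.1 hstep).eventually (gt_mem_nhds (half_pos hε))
    obtain ⟨N, hN⟩ := (hA.and hs).exists_forall_of_atTop
    obtain ⟨k, hk, hkN⟩ := ((hw.eventually (ball_mem_nhds w (half_pos hε))).and
      (hφ.tendsto_atTop.eventually_ge_atTop N)).exists
    have hstay : ∀ n, dist (x (φ k + n)) w < ε / 2 := fun n => by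
      induction n with
      | zero => exact hk
      | succ n ih =>
        have h1 := (hN (φ k + n) (by omega)).2
        have h2 := (hN (φ k + n + 1) (by omega)).1
        rw [← dist_eq_norm] at h1
        have h3 := dist_triangle (x (φ k + n + 1)) (x (φ k + n)) w
        by_contra hcon
        exact h2 ⟨not_lt.1 hcon, by linarith⟩
    filter_upwards [eventually_ge_atTop (φ k)] with n hn
    have := hstay (n - φ k)
    rw [Nat.add_sub_cancel' hn] at this
    linarith
  refine Metric.tendsto_nhds.2 fun ε hε => ?_
  filter_upwards [key (min ε (δ / 2)) (by positivity)
    ((min_le_right _ _).trans_lt (by linarith))] with n hn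
  exact hn.trans_le (min_le_left _ _)

namespace IsEscapeRadius

variable {g : Polynomial ℂ} {ρ : ℝ}

theorem eventually_norm_deriv_branch_lt (h : IsEscapeRadius g ρ) {z₀ : ℂ} {r : ℝ} (hr : 0 < r)
    (he : ∀ z ∈ ball z₀ (2 * r), Escapes g ρ z) {b : ℕ → ℂ → ℂ}
    (hb : ∀ n, DifferentiableOn ℂ (b n) (ball z₀ (2 * r)))
    (hinv : ∀ n, ∀ z ∈ ball z₀ (2 * r), (fun z => g.eval z)^[n] (b n z) = z) {ε : ℝ}
    (hε : 0 < ε) : ∀ᶠ n in atTop, ∀ z ∈ ball z₀ r, ‖deriv (b n) z‖ < ε := by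
  set M : ℝ := max ρ (‖z₀‖ + 2 * r)
  have hM : 0 < M := h.pos.trans_le (le_max_left _ _)
  have hnorm : ∀ z ∈ ball z₀ (2 * r), ‖z‖ ≤ ‖z₀‖ + 2 * r := fun z hz => by
    have h1 := norm_le_norm_add_norm_sub' z z₀
    have h2 := mem_ball_iff_norm.1 hz
    linarith
  have hbM : ∀ n, ∀ z ∈ ball z₀ (2 * r), ‖b n z‖ ≤ M := fun n z hz => by
    by_contra hcon
    have h1 := h.norm_le_iterate ((le_max_left _ _).trans_lt (not_le.1 hcon)) n
    rw [hinv n z hz] at h1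
    exact hcon (h1.trans ((hnorm z hz).trans (le_max_right _ _)))
  obtain ⟨δ, hδ, himg⟩ := exists_ball_subset_image hM hr hε
  by_contra hcon
  have hsub : ∀ z ∈ ball z₀ r, ball z r ⊆ ball z₀ (2 * r) := fun z hz =>
    ball_subset_ball' (by linarith [mem_ball.1 hz])
  have hfr : ∃ᶠ n in atTop, ∃ y ∈ closedBall (0 : ℂ) M,
      ball y δ ⊆ b n '' ball z₀ (2 * r) := by
    refine (not_eventually.1 hcon).mono fun n hn => ?_
    push Not at hn
    obtain ⟨z, hz, hzε⟩ := hn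
    have hs := hsub z hz
    exact ⟨b n z, mem_closedBall_zero_iff.2 (hbM n z (hs (mem_ball_self hr))),
      (himg (b n) z ((hb n).mono hs) (fun w hw => hbM n w (hs hw)) hzε).trans (image_mono hs)⟩
  obtain ⟨φ, hφ, hφy⟩ := extraction_of_frequently_atTop hfr
  choose y hyM hy using hφy
  obtain ⟨w, -, ψ, hψ, hlim⟩ := (isCompact_closedBall (0 : ℂ) M).tendsto_subseq hyM
  have hev : ∀ᶠ k in atTop, (fun z => g.eval z)^[φ (ψ k)] w ∈ ball z₀ (2 * r) := by
    filter_upwards [hlim.eventually (ball_mem_nhds w hδ)] with k hk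
    obtain ⟨z, hz, hzw⟩ := hy (ψ k) (mem_ball_comm.1 hk)
    rw [← hzw, hinv _ z hz]
    exact hz
  obtain ⟨k, hk⟩ := hev.exists
  have htend := (h.tendsto (escapes_of_iterate (he _ hk))).comp (hφ.comp hψ).tendsto_atTop
  obtain ⟨l, hl, hl'⟩ := (hev.and (htend.eventually_gt_atTop (‖z₀‖ + 2 * r))).exists
  exact absurd (hnorm _ hl) (not_le.2 hl')

end IsEscapeRadius

/-- A curve in the escaping set, off the postcritical set, on which `g` acts by multiplying the
parameter by the degree. -/
structure IsEscapingCurve (g : Polynomial ℂ) (ρ : ℝ) (β : ℝ → ℂ) : Prop where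
  cont : ContinuousOn β (Ioi 0)
  conj : ∀ s, 0 < s → g.eval (β s) = β (g.natDegree * s)
  avoid : ∀ s, 0 < s → β s ∉ postcrit g
  escapes : ∀ s, 0 < s → Escapes g ρ (β s)

namespace IsEscapingCurve

variable {g : Polynomial ℂ} {ρ : ℝ} {β : ℝ → ℂ}

theorem iterate (hd : 2 ≤ g.natDegree) (hβ : IsEscapingCurve g ρ β) (n : ℕ) {s : ℝ} (hs : 0 < s) :
    (fun z => g.eval z)^[n] (β s) = β (g.natDegree ^ n * s) := by
  have hD : (0 : ℝ) < g.natDegree := by exact_mod_cast (by omega : 0 < g.natDegree)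
  induction n with
  | zero => simp
  | succ n ih =>
    rw [iterate_succ_apply', ih, hβ.conj _ (by positivity)]
    ring_nf

theorem iterate_div (hd : 2 ≤ g.natDegree) (hβ : IsEscapingCurve g ρ β) (n : ℕ) {s : ℝ}
    (hs : 0 < s) : (fun z => g.eval z)^[n] (β (s / g.natDegree ^ n)) = β s := by
  have hD : (0 : ℝ) < g.natDegree := by exact_mod_cast (by omega : 0 < g.natDegree)
  rw [hβ.iterate hd n (by positivity), mul_div_cancel₀ _ (by positivity)]

theorem exists_nhds (h : IsEscapeRadius g ρ) (hd : 2 ≤ g.natDegree)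
    (hβ : IsEscapingCurve g ρ β) {s : ℝ} (hs : 0 < s) :
    ∃ J ∈ 𝓝 s, ∀ ε > 0, ∀ᶠ n : ℕ in atTop, ∀ s' ∈ J,
      ‖β (s' / g.natDegree ^ n) - β (s / g.natDegree ^ n)‖ < ε := by
  have hD : (0 : ℝ) < g.natDegree := by exact_mod_cast (by omega : 0 < g.natDegree)
  obtain ⟨r', hr', hball⟩ := Metric.eventually_nhds_iff_ball.1
    (h.eventually_notMem_postcrit hd (hβ.escapes s hs) (hβ.avoid s hs))
  obtain ⟨r, rfl⟩ : ∃ r, r' = 2 * r := ⟨r' / 2, by ring⟩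
  have hr : 0 < r := by linarith
  choose b hb hb0 hinv using fun n => exists_branch (g := g) n hr'
    (fun z hz => (hball z hz).1) (hβ.iterate_div hd n hs)
  have hcs : ContinuousAt β s := hβ.cont.continuousAt (Ioi_mem_nhds hs)
  obtain ⟨η, hη, hJ⟩ := Metric.eventually_nhds_iff_ball.1
    ((hcs.eventually (ball_mem_nhds _ hr)).and (Ioi_mem_nhds hs))
  refine ⟨ball s η, ball_mem_nhds s hη, fun ε hε => ?_⟩
  have hsub : ball (β s) r ⊆ ball (β s) (2 * r) := ball_subset_ball (by linarith)
  filter_upwards [h.eventually_norm_deriv_branch_lt hr (fun z hz => (hball z hz).2) hb hinv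
    (div_pos hε (mul_pos two_pos hr))] with n hn s' hs'
  have heq : ∀ x ∈ ball s η, b n (β x) = β (x / g.natDegree ^ n) := fun x hx => by
    refine eqOn_of_iterate_eq (u := fun x => b n (β x)) (v := fun x => β (x / g.natDegree ^ n))
      (convex_ball s η).isPreconnected g n ?_ ?_ ?_ ?_ (mem_ball_self hη) (hb0 n) hx
    · exact (hb n).continuousOn.comp (hβ.cont.mono fun x hx => (hJ x hx).2)
        fun x hx => hsub (hJ x hx).1
    · refine hβ.cont.comp (continuous_id.div_const _).continuousOn fun x hx => ?_
      have : 0 < x := (hJ x hx).2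
      exact div_pos this (by positivity)
    · intro x hx
      rw [hinv n _ (hsub (hJ x hx).1), hβ.iterate_div hd n (hJ x hx).2]
    · intro x hx
      rw [hinv n _ (hsub (hJ x hx).1)]
      exact hβ.avoid x (hJ x hx).2
  rw [← heq s' hs', ← heq s (mem_ball_self hη)]
  have hmv := (convex_ball (β s) r).norm_image_sub_le_of_norm_deriv_le (f := b n)
    (C := ε / (2 * r)) (x := β s) (y := β s')
    (fun z hz => (hb n).differentiableAt (isOpen_ball.mem_nhds (hsub hz)))
    (fun z hz => (hn z hz).le) (mem_ball_self hr) (hJ s' hs').1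
  have h1 := mem_ball_iff_norm.1 (hJ s' hs').1
  calc _ ≤ ε / (2 * r) * ‖β s' - β s‖ := hmv
    _ ≤ ε / (2 * r) * r := by gcongr
    _ = ε / 2 := by field_simp
    _ < ε := by linarith

theorem tendsto_sub (h : IsEscapeRadius g ρ) (hd : 2 ≤ g.natDegree)
    (hβ : IsEscapingCurve g ρ β) {s s' : ℝ} (hs : 0 < s) (hs' : 0 < s') :
    Tendsto (fun n : ℕ => β (s' / g.natDegree ^ n) - β (s / g.natDegree ^ n)) atTop (𝓝 0) := by
  refine isPreconnected_Ioi.induction₂ (s := Ioi (0 : ℝ)) (fun s s' => Tendsto (fun n : ℕ =>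
    β (s' / g.natDegree ^ n) - β (s / g.natDegree ^ n)) atTop (𝓝 0)) (fun x hx => ?_)
    (fun x y z _ _ _ h1 h2 => ?_) (fun x y _ _ h1 => ?_) hs hs'
  · obtain ⟨J, hJ, hlim⟩ := hβ.exists_nhds h hd hx
    refine Filter.Eventually.filter_mono nhdsWithin_le_nhds ?_
    filter_upwards [hJ] with y hy
    refine Metric.tendsto_nhds.2 fun ε hε => ?_
    filter_upwards [hlim ε hε] with n hn
    rw [dist_zero_right]
    exact hn y hy
  · simpa using h2.add h1
  · simpa using h1.neg

theorem exists_tendsto (h : IsEscapeRadius g ρ) (hd : 2 ≤ g.natDegree)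
    (hβ : IsEscapingCurve g ρ β) : ∃ w, g.eval w = w ∧ Tendsto β (𝓝[>] 0) (𝓝 w) := by
  have hD1 : (1 : ℝ) < g.natDegree := by exact_mod_cast (by omega : 1 < g.natDegree)
  have hD : (0 : ℝ) < g.natDegree := one_pos.trans hD1
  obtain ⟨w, hw, hlim⟩ : ∃ w, g.eval w = w ∧
      Tendsto (fun n : ℕ => β (1 / g.natDegree ^ n)) atTop (𝓝 w) := by
    refine tendsto_fixed_of_steps (M := max ρ ‖β 1‖) hd (fun n => ?_) ?_ ?_
    · by_contra hcon
      have h1 := h.norm_le_iterate ((le_max_left _ _).trans_lt (not_le.1 hcon)) n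
      rw [hβ.iterate_div hd n one_pos] at h1
      exact hcon (h1.trans (le_max_right _ _))
    · refine (hβ.tendsto_sub h hd one_pos hD).congr fun n => ?_
      rw [hβ.conj _ (by positivity)]
      ring_nf
    · refine (hβ.tendsto_sub h hd one_pos (s' := 1 / g.natDegree) (by positivity)).congr fun n => ?_
      rw [div_div, ← pow_succ']
  refine ⟨w, hw, ?_⟩
  have hunif : ∀ ε > 0, ∀ᶠ n : ℕ in atTop, ∀ s ∈ Icc (1 : ℝ) g.natDegree,
      ‖β (s / g.natDegree ^ n) - w‖ < ε := fun ε hε => by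
    refine isCompact_Icc.induction_on (s := Icc (1 : ℝ) g.natDegree)
      (p := fun S => ∀ᶠ n : ℕ in atTop, ∀ s ∈ S, ‖β (s / g.natDegree ^ n) - w‖ < ε)
      (by simp) (fun S T hST hT => hT.mono fun n hn s hs => hn s (hST hs))
      (fun S T hS hT => ?_) (fun s hs => ?_)
    · filter_upwards [hS, hT] with n h1 h2 s hs
      exact hs.elim (h1 s) (h2 s)
    · have hs0 : 0 < s := one_pos.trans_le hs.1
      obtain ⟨J, hJ, hJlim⟩ := hβ.exists_nhds h hd hs0
      have h1 : Tendsto (fun n : ℕ => β (s / g.natDegree ^ n)) atTop (𝓝 w) := by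
        simpa using (hβ.tendsto_sub h hd one_pos hs0).add hlim
      refine ⟨J, mem_nhdsWithin_of_mem_nhds hJ, ?_⟩
      filter_upwards [hJlim (ε / 2) (half_pos hε),
        Metric.tendsto_nhds.1 h1 (ε / 2) (half_pos hε)] with n h2 h3 s' hs'
      rw [dist_eq_norm] at h3
      linarith [norm_sub_le_norm_sub_add_norm_sub (β (s' / g.natDegree ^ n))
        (β (s / g.natDegree ^ n)) w, h2 s' hs']
  refine Metric.tendsto_nhds.2 fun ε hε => ?_
  obtain ⟨N, hN⟩ := (hunif ε hε).exists_forall_of_atTop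
  have hpos : (0 : ℝ) < 1 / g.natDegree ^ N := by positivity
  filter_upwards [Ioo_mem_nhdsGT hpos] with x hx
  have hx1 : 1 ≤ x⁻¹ := by
    rw [one_le_inv₀ hx.1]
    refine hx.2.le.trans ?_
    rw [div_le_one (by positivity)]
    exact one_le_pow₀ hD1.le
  obtain ⟨n, hn1, hn2⟩ := exists_nat_pow_near hx1 hD1
  have hx0 : 0 < x := hx.1
  have hx2 := hx.2
  have hnN : N ≤ n + 1 := by
    by_contra hcon
    have h1 : (g.natDegree : ℝ) ^ (n + 1) ≤ g.natDegree ^ N :=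
      pow_le_pow_right₀ hD1.le (by omega)
    have h2 : x⁻¹ < (g.natDegree : ℝ) ^ N := hn2.trans_le h1
    rw [lt_div_iff₀ (by positivity)] at hx2
    rw [inv_lt_iff_one_lt_mul₀ hx0] at h2
    linarith
  have h3 := hN (n + 1) hnN (x * g.natDegree ^ (n + 1)) ⟨?_, ?_⟩
  · rwa [mul_div_cancel_right₀ _ (by positivity), ← dist_eq_norm] at h3
  · rw [inv_lt_iff_one_lt_mul₀ hx0] at hn2
    linarith
  · rw [le_inv_comm₀ (by positivity) hx0, inv_eq_one_div, le_div_iff₀ (by positivity)] at hn1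
    rw [pow_succ, ← mul_assoc]
    nlinarith

end IsEscapingCurve

/-! ### Construction of the ray system -/

theorem natDegree_mul_height {D : ℕ} (hD : 2 ≤ D) (j : ℤ) :
    D * height D j = height D j + 2 * Real.pi * j := by
  have : (2 : ℝ) ≤ D := by exact_mod_cast hD
  have h1 : (D : ℝ) - 1 ≠ 0 := by linarith
  unfold height
  field_simp
  ring

theorem height_add_mul {D : ℕ} (hD : 2 ≤ D) (j m : ℤ) :
    height D (j + ((D : ℤ) - 1) * m) = height D j + 2 * Real.pi * m := by
  have : (2 : ℝ) ≤ D := by exact_mod_cast hD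
  have h1 : (D : ℝ) - 1 ≠ 0 := by linarith
  unfold height
  push_cast
  field_simp

@[simp] theorem line_im (κ α s : ℝ) : (line κ α s).im = κ * s + α := by simp [line]

namespace IsBottcher

variable {g : Polynomial ℂ} {s₀ : ℝ} {Ψ : ℂ → ℂ}

theorem exists_slope (h : IsBottcher g s₀ Ψ) :
    ∃ κ : ℝ, ∀ j s, s₀ < s → Ψ (line κ (height g.natDegree j) s) ∉ postcrit g := by
  have hS : {ξ : ℂ | s₀ < ξ.re ∧ Ψ ξ ∈ postcrit g}.Countable := by
    have hsub : {ξ : ℂ | s₀ < ξ.re ∧ Ψ ξ ∈ postcrit g} ⊆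
        ⋃ z ∈ postcrit g, {ξ : ℂ | s₀ < ξ.re ∧ Ψ ξ = z} := fun ξ hξ => by
      simp only [mem_iUnion, mem_ofPred_eq]
      exact ⟨_, hξ.2, hξ.1, rfl⟩
    refine ((countable_postcrit h.two_le).biUnion fun z _ => ?_).mono hsub
    rcases {ξ : ℂ | s₀ < ξ.re ∧ Ψ ξ = z}.eq_empty_or_nonempty with he | ⟨ξ₀, hξ₀⟩
    · rw [he]
      exact countable_empty
    · refine (countable_range fun n : ℤ => ξ₀ + n * (2 * Real.pi * Complex.I)).mono fun ξ hξ => ?_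
      obtain ⟨n, hn⟩ := h.inj ξ ξ₀ hξ.1 hξ₀.1 (hξ.2.trans hξ₀.2.symm)
      exact ⟨n, hn.symm⟩
  have hbad := countable_iUnion fun j : ℤ =>
    hS.image fun ξ : ℂ => (ξ.im - height g.natDegree j) / ξ.re
  obtain ⟨κ, hκ⟩ := (hbad.dense_compl ℝ).nonempty
  refine ⟨κ, fun j s hs hP => hκ (mem_iUnion.2 ⟨j, line κ (height g.natDegree j) s, ⟨?_, hP⟩, ?_⟩)⟩
  · rwa [line_re]
  · have hs0 : s ≠ 0 := (h.pos.trans hs).ne'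
    simp only [line_re, line_im]
    field_simp
    ring

theorem conj_line (h : IsBottcher g s₀ Ψ) (κ : ℝ) (j : ℤ) {s : ℝ} (hs : s₀ < s) :
    g.eval (Ψ (line κ (height g.natDegree j) s)) =
      Ψ (line κ (height g.natDegree j) (g.natDegree * s)) := by
  have hD1 : (2 : ℝ) ≤ g.natDegree := by exact_mod_cast h.two_le
  have hs' : s₀ < g.natDegree * s := by nlinarith [h.pos]
  rw [h.conj _ (by rwa [line_re]), ← h.per _ j (by rwa [line_re] : s₀ <
    (line κ (height g.natDegree j) (g.natDegree * s)).re)]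
  congr 1
  have h1 := congrArg (fun x : ℝ => (x : ℂ)) (natDegree_mul_height h.two_le j)
  push_cast at h1
  simp only [line]
  push_cast
  linear_combination Complex.I * h1

end IsBottcher

/-- Invariant curves extending the lines of slope `κ` in a Böttcher coordinate. -/
structure IsRayFamily (g : Polynomial ℂ) (s₀ : ℝ) (Ψ : ℂ → ℂ) (κ : ℝ) (R : ℤ → ℝ → ℂ) :
    Prop where
  bott : IsBottcher g s₀ Ψ
  cont : ∀ j, Continuous (R j)
  base : ∀ j s, s₀ + 1 ≤ s → R j s = Ψ (line κ (height g.natDegree j) s)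
  conj : ∀ j s, 0 ≤ s → g.eval (R j s) = R j (g.natDegree * s)
  avoid : ∀ j s, 0 < s → R j s ∉ postcrit g
  per : ∀ j, R (j + ((g.natDegree : ℤ) - 1)) = R j

theorem IsBottcher.exists_isRayFamily {g : Polynomial ℂ} {s₀ : ℝ} {Ψ : ℂ → ℂ}
    (h : IsBottcher g s₀ Ψ) : ∃ κ R, IsRayFamily g s₀ Ψ κ R := by
  obtain ⟨κ, hκ⟩ := h.exists_slope
  obtain ⟨ρ, hρ, hρ'⟩ := exists_escape_radius h.two_le
  have hesc : IsEscapeRadius g ρ := ⟨hρ, hρ'⟩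
  have hD1 : (1 : ℝ) < g.natDegree := by
    exact_mod_cast (by have := h.two_le; omega : 1 < g.natDegree)
  have ht : 0 < s₀ + 1 := by linarith [h.pos]
  have hone : ∀ j : ℤ, ∃ r : ℝ → ℂ, Continuous r ∧
      (∀ s, s₀ + 1 ≤ s → r s = Ψ (line κ (height g.natDegree j) s)) ∧
      (∀ s, 0 ≤ s → g.eval (r s) = r (g.natDegree * s)) ∧ ∀ s, 0 < s → r s ∉ postcrit g := by
    intro j
    have hdesc : IsDescent g (s₀ + 1) 0 fun s => Ψ (line κ (height g.natDegree j) s) := by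
      refine ⟨h.cont.comp (continuous_line κ _).continuousOn fun s hs => ?_,
        fun s hs => h.conj_line κ j ?_, fun s hs => hκ j s (by linarith)⟩
      · rw [pow_zero, div_one, mem_Ici] at hs
        rw [mem_ofPred_eq, line_re]
        linarith
      · rw [pow_zero, div_one] at hs
        linarith
    obtain ⟨β, hβc, hβ, hβconj, hβP⟩ := hdesc.exists_extension ht h.two_le
    have hit : ∀ (n : ℕ) s, 0 < s → (fun z => g.eval z)^[n] (β s) = β (g.natDegree ^ n * s) := by
      intro n s hs
      induction n with
      | zero => simp
      | succ n ih =>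
        rw [iterate_succ_apply', ih, hβconj _ (by positivity)]
        ring_nf
    have hcurve : IsEscapingCurve g ρ β := by
      refine ⟨hβc, hβconj, hβP, fun s hs => ?_⟩
      have h1 : Tendsto (fun n : ℕ => (g.natDegree : ℝ) ^ n * s) atTop atTop :=
        (tendsto_pow_atTop_atTop_of_one_lt hD1).atTop_mul_const hs
      have h2 := Real.tendsto_exp_atTop.comp h1
      obtain ⟨n, hn1, hn2⟩ := ((h1.eventually_ge_atTop (s₀ + 1)).and
        (h2.eventually_gt_atTop (3 * ρ))).exists
      refine ⟨n, ?_⟩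
      rw [hit n s hs, hβ _ hn1]
      have h3 := h.lower (line κ (height g.natDegree j) (g.natDegree ^ n * s))
        (by rw [line_re]; linarith)
      rw [line_re] at h3
      simp only [comp_apply] at hn2
      linarith
    obtain ⟨w, hw, hlim⟩ := hcurve.exists_tendsto hesc h.two_le
    have hpos : ∀ s, 0 < s → (fun s => if 0 < s then β s else w) s = β s := fun s hs => if_pos hs
    refine ⟨fun s => if 0 < s then β s else w, ?_, ?_, ?_, ?_⟩
    · refine continuous_iff_continuousAt.2 fun s => ?_
      rcases lt_trichotomy s 0 with hs | rfl | hs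
      · refine (continuousAt_const (y := w)).congr ?_
        filter_upwards [Iio_mem_nhds hs] with x hx
        exact (if_neg (not_lt.2 (le_of_lt hx))).symm
      · refine continuousAt_iff_continuous_left'_right'.2 ⟨?_, ?_⟩
        · refine (continuousWithinAt_const (b := w)).congr (fun x hx => ?_) (by simp)
          exact if_neg (not_lt.2 (le_of_lt hx))
        · rw [ContinuousWithinAt, if_neg (lt_irrefl _)]
          refine hlim.congr' ?_
          filter_upwards [self_mem_nhdsWithin] with x hx
          exact (hpos x hx).symm
      · refine (hβc.continuousAt (Ioi_mem_nhds hs)).congr ?_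
        filter_upwards [Ioi_mem_nhds hs] with x hx
        exact (hpos x hx).symm
    · intro s hs
      rw [hpos s (by linarith), hβ s hs]
    · intro s hs
      rcases hs.eq_or_lt with rfl | hs
      · simpa using hw
      · rw [hpos s hs, hpos _ (by positivity)]
        exact hβconj s hs
    · intro s hs
      rw [hpos s hs]
      exact hβP s hs
  choose r hrc hrb hrconj hrP using hone
  refine ⟨κ, fun j => r (j % ((g.natDegree : ℤ) - 1)), h, fun j => hrc _, fun j s hs => ?_,
    fun j => hrconj _, fun j => hrP _, fun j => by simp only [Int.add_emod_right]⟩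
  rw [hrb _ s hs, ← h.per _ (j / ((g.natDegree : ℤ) - 1)) (by rw [line_re]; linarith)]
  congr 1
  have h1 := height_add_mul h.two_le (j % ((g.natDegree : ℤ) - 1)) (j / ((g.natDegree : ℤ) - 1))
  rw [Int.emod_add_mul_ediv] at h1
  simp only [line, h1]
  push_cast
  ring

theorem height_add_one {D : ℕ} (j : ℤ) : height D (j + 1) = height D j + 2 * Real.pi / (D - 1) := by
  unfold height
  push_cast
  ring

theorem strictMono_height {D : ℕ} (hD : 2 ≤ D) : StrictMono (height D) := by
  have h1 : (2 : ℝ) ≤ D := by exact_mod_cast hD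
  have h2 : 0 < 2 * Real.pi / ((D : ℝ) - 1) := div_pos (by positivity) (by linarith)
  refine strictMono_int_of_lt_succ fun j => ?_
  rw [height_add_one]
  linarith

theorem tendsto_line_comap (κ α : ℝ) : Tendsto (line κ α) atTop (comap Complex.re atTop) :=
  tendsto_comap_iff.2 (tendsto_id.congr fun s => (line_re κ α s).symm)

namespace IsBottcher

variable {g : Polynomial ℂ} {s₀ : ℝ} {Ψ : ℂ → ℂ}

theorem re_pow_mul (D n : ℕ) (ξ : ℂ) : ((D : ℂ) ^ n * ξ).re = (D : ℝ) ^ n * ξ.re := by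
  have : (D : ℂ) ^ n = (((D : ℝ) ^ n : ℝ) : ℂ) := by push_cast; rfl
  rw [this, Complex.re_ofReal_mul]

theorem re_lt (h : IsBottcher g s₀ Ψ) {ξ : ℂ} (hξ : s₀ < ξ.re) (n : ℕ) :
    s₀ < ((g.natDegree : ℂ) ^ n * ξ).re := by
  have hD : (1 : ℝ) ≤ g.natDegree := by
    exact_mod_cast (by have := h.two_le; omega : 1 ≤ g.natDegree)
  rw [re_pow_mul]
  have := one_le_pow₀ (n := n) hD
  nlinarith [h.pos]

theorem iterate (h : IsBottcher g s₀ Ψ) {ξ : ℂ} (hξ : s₀ < ξ.re) (n : ℕ) :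
    (fun z => g.eval z)^[n] (Ψ ξ) = Ψ ((g.natDegree : ℂ) ^ n * ξ) := by
  induction n with
  | zero => simp
  | succ n ih => rw [iterate_succ_apply', ih, h.conj _ (h.re_lt hξ n), pow_succ', mul_assoc]

theorem exp_le_iterate (h : IsBottcher g s₀ Ψ) {ξ : ℂ} (hξ : s₀ < ξ.re) (n : ℕ) :
    Real.exp (g.natDegree ^ n * ξ.re) ≤ 3 * ‖(fun z => g.eval z)^[n] (Ψ ξ)‖ := by
  rw [h.iterate hξ, ← re_pow_mul]
  exact h.lower _ (h.re_lt hξ n)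

theorem isRay (h : IsBottcher g s₀ Ψ) (κ α : ℝ) {γ : ℝ → ℂ} (hγ : Continuous γ)
    (he : ∀ᶠ s in atTop, γ s = Ψ (line κ α s)) : IsRay κ α γ :=
  ⟨hγ, (h.lim.comp (tendsto_line_comap κ α)).congr' (he.mono fun s hs => by
    simp only [hs, comp_apply])⟩

end IsBottcher

namespace IsRayFamily

variable {g : Polynomial ℂ} {s₀ κ : ℝ} {Ψ : ℂ → ℂ} {R : ℤ → ℝ → ℂ}

theorem iterate (h : IsRayFamily g s₀ Ψ κ R) (n : ℕ) (j : ℤ) {s : ℝ} (hs : 0 ≤ s) :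
    (fun z => g.eval z)^[n] (R j s) = R j (g.natDegree ^ n * s) := by
  induction n with
  | zero => simp
  | succ n ih => rw [iterate_succ_apply', ih, h.conj _ _ (by positivity), pow_succ', mul_assoc]

theorem exists_pow_mul_ge (h : IsRayFamily g s₀ Ψ κ R) {s : ℝ} (hs : 0 < s) (M : ℝ) :
    ∃ n : ℕ, M < g.natDegree ^ n * s := by
  have hD : (1 : ℝ) < g.natDegree := by
    exact_mod_cast (by have := h.bott.two_le; omega : 1 < g.natDegree)
  exact (((tendsto_pow_atTop_atTop_of_one_lt hD).atTop_mul_const hs).eventually_gt_atTop M).exists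

theorem eq_of_mem (h : IsRayFamily g s₀ Ψ κ R) {ξ : ℂ} (hξ : s₀ + 1 ≤ ξ.re) {j : ℤ} {t : ℝ}
    (ht : 0 ≤ t) (he : Ψ ξ = R j t) : t = ξ.re ∧
      ∃ m : ℤ, ξ.im - κ * ξ.re = height g.natDegree (j + ((g.natDegree : ℤ) - 1) * m) := by
  have hD : (0 : ℝ) < g.natDegree := by
    exact_mod_cast (by have := h.bott.two_le; omega : 0 < g.natDegree)
  have hξ' : s₀ < ξ.re := by linarith
  have hpos := h.bott.pos
  have htpos : 0 < t := by
    refine ht.lt_of_ne' fun h0 => ?_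
    subst h0
    obtain ⟨n, hn⟩ := h.exists_pow_mul_ge (hpos.trans hξ') (3 * ‖R j 0‖)
    have h1 := h.bott.exp_le_iterate hξ' n
    rw [he, h.iterate n j le_rfl, mul_zero] at h1
    linarith [Real.add_one_le_exp (g.natDegree ^ n * ξ.re)]
  have hre : t = ξ.re := by
    obtain ⟨n, hn⟩ := h.exists_pow_mul_ge htpos (s₀ + 1)
    have h1 := h.iterate n j ht
    rw [← he, h.bott.iterate hξ', h.base _ _ hn.le] at h1
    obtain ⟨m, hm⟩ := h.bott.inj _ _ (h.bott.re_lt hξ' n) (by rw [line_re]; linarith) h1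
    have h2 := congrArg Complex.re hm
    rw [IsBottcher.re_pow_mul, Complex.add_re, line_re] at h2
    have h3 : ((m : ℂ) * (2 * Real.pi * Complex.I)).re = 0 := by simp
    rw [h3, add_zero] at h2
    exact (mul_left_cancel₀ (by positivity) h2).symm
  refine ⟨hre, ?_⟩
  rw [hre, h.base _ _ hξ] at he
  obtain ⟨m, hm⟩ := h.bott.inj _ _ hξ' (by rw [line_re]; exact hξ') he
  refine ⟨m, ?_⟩
  rw [height_add_mul h.bott.two_le]
  have h2 := congrArg Complex.im hm
  rw [Complex.add_im, line_im] at h2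
  have h3 : ((m : ℂ) * (2 * Real.pi * Complex.I)).im = 2 * Real.pi * m := by simp; ring
  rw [h3] at h2
  linarith

theorem height_eq_of_mem_raySet (h : IsRayFamily g s₀ Ψ κ R) {ξ : ℂ} (hξ : s₀ + 1 ≤ ξ.re)
    (hmem : Ψ ξ ∈ raySet R) : ∃ j : ℤ, ξ.im - κ * ξ.re = height g.natDegree j := by
  obtain ⟨j, t, ht, he⟩ := RaySystem.mem_raySet.1 hmem
  obtain ⟨-, m, hm⟩ := h.eq_of_mem hξ ht he.symm
  exact ⟨_, hm⟩

theorem raySystem (h : IsRayFamily g s₀ Ψ κ R) : RaySystem g κ R where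
  monic := h.bott.monic
  two_le := h.bott.two_le
  ray j := h.bott.isRay κ _ (h.cont j) ((eventually_ge_atTop (s₀ + 1)).mono fun s hs => h.base j s hs)
  conj := h.conj
  per := h.per
  disj j j' s s' hs hs' he := by
    have hD : (0 : ℝ) < g.natDegree := by
      exact_mod_cast (by have := h.bott.two_le; omega : 0 < g.natDegree)
    obtain ⟨n, hn⟩ := h.exists_pow_mul_ge hs (s₀ + 1)
    have h1 := h.iterate n j hs.le
    rw [he, h.iterate n j' hs', h.base _ _ hn.le] at h1
    obtain ⟨h2, m, hm⟩ := h.eq_of_mem (by rw [line_re]; exact hn.le) (by positivity) h1.symm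
    rw [line_re] at h2
    rw [line_re, line_im, add_sub_cancel_left] at hm
    refine ⟨(mul_left_cancel₀ (by positivity) h2).symm, m, ?_⟩
    have := (strictMono_height h.bott.two_le).injective hm
    linarith

theorem exists_ray_of_norm_gt (h : IsRayFamily g s₀ Ψ κ R) :
    ∃ M : ℝ, ∀ v, M < ‖v‖ → v ∉ raySet R → ∃ (k : ℤ) (α : ℝ) (γ : ℝ → ℂ), IsRay κ α γ ∧
      γ 0 = v ∧ height g.natDegree k < α ∧ α < height g.natDegree (k + 1) ∧
      ∀ t, 0 ≤ t → γ t ∉ raySet R := by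
  obtain ⟨M, hM⟩ := h.bott.surj
  have hD : (2 : ℝ) ≤ g.natDegree := by exact_mod_cast h.bott.two_le
  have hpos := h.bott.pos
  refine ⟨max M (3 * Real.exp (s₀ + 1)), fun v hv hvR => ?_⟩
  obtain ⟨ξ, hξ, rfl⟩ := hM v ((le_max_left _ _).trans_lt hv)
  have hξ1 : s₀ + 1 < ξ.re := by
    have h1 := (le_max_right _ _).trans_lt (hv.trans_le (h.bott.upper ξ hξ))
    exact Real.exp_lt_exp.1 (by linarith)
  set θ := ξ.im - κ * ξ.re with hθ
  have hline : line κ θ ξ.re = ξ := by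
    apply Complex.ext
    · rw [line_re]
    · rw [line_im, hθ]; ring
  set c : ℝ := 2 * Real.pi / (g.natDegree - 1) with hc
  have hc0 : 0 < c := div_pos (by positivity) (by linarith)
  have hh : ∀ j : ℤ, height g.natDegree j = c * j := fun j => by
    rw [hc, height]; ring
  set k := ⌊θ / c⌋ with hk
  have hk1 : height g.natDegree k ≤ θ := by
    have := Int.floor_le (θ / c)
    rw [le_div_iff₀ hc0] at this
    rw [hh, mul_comm]; exact this
  have hk2 : θ < height g.natDegree (k + 1) := by
    have := Int.lt_floor_add_one (θ / c)
    rw [div_lt_iff₀ hc0] at this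
    rw [hh, mul_comm]
    push_cast
    exact this
  have hk1' : height g.natDegree k < θ := by
    refine hk1.lt_of_ne fun h0 => hvR ?_
    refine RaySystem.mem_raySet.2 ⟨k, ξ.re, by linarith, ?_⟩
    rw [h.base _ _ hξ1.le, h0, hline]
  refine ⟨k, θ, fun u => Ψ (line κ θ (max u ξ.re)), h.bott.isRay κ θ ?_ ?_, ?_, hk1', hk2, ?_⟩
  · refine h.bott.cont.comp_continuous ((continuous_line κ θ).comp (by fun_prop)) fun u => ?_
    rw [mem_ofPred_eq, line_re]
    exact hξ.trans_le (le_max_right _ _)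
  · filter_upwards [eventually_ge_atTop ξ.re] with u hu
    rw [max_eq_left hu]
  · simp only [max_eq_right (hpos.trans hξ).le, hline]
  · intro u hu hmem
    obtain ⟨j, hj⟩ := h.height_eq_of_mem_raySet
      (by rw [line_re]; exact hξ1.le.trans (le_max_right _ _)) hmem
    rw [line_re, line_im, add_sub_cancel_left] at hj
    rw [hj] at hk1' hk2
    have h1 := (strictMono_height h.bott.two_le).lt_iff_lt.1 hk1'
    have h2 := (strictMono_height h.bott.two_le).lt_iff_lt.1 hk2
    omega

theorem exists_flow_box (h : IsRayFamily g s₀ Ψ κ R) (j : ℤ) {s : ℝ} (hs : 0 < s) :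
    ∃ H₁ H₂ : Set ℂ, H₁ ∪ H₂ ∪ raySet R ∈ 𝓝 (R j s) ∧
      ∀ H, H = H₁ ∨ H = H₂ → IsPreconnected H ∧ Disjoint H (raySet R) ∧
        ∃ z ∈ H, ∃ c > s, ∃ k > (0 : ℝ), ∀ᶠ n : ℕ in atTop,
          k * Real.exp (g.natDegree ^ n * c) ≤ ‖(fun z => g.eval z)^[n] z‖ := by
  have hD : (2 : ℝ) ≤ g.natDegree := by exact_mod_cast h.bott.two_le
  have hpos := h.bott.pos
  set f : ℂ → ℂ := fun z => g.eval z with hf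
  set α := height g.natDegree j with hα
  obtain ⟨n, hn⟩ := h.exists_pow_mul_ge hs (s₀ + 1)
  have hDn : (0 : ℝ) < g.natDegree ^ n := by positivity
  set s₁ : ℝ := g.natDegree ^ n * s with hs₁
  set ξ₀ := line κ α s₁ with hξ₀
  have hξ₀re : ξ₀.re = s₁ := line_re _ _ _
  have hfn : f^[n] (R j s) = Ψ ξ₀ := by rw [h.iterate n j hs.le, h.base _ _ hn.le]
  obtain ⟨d, hd, hd'⟩ := iterate_ne_zero_derivative (g := g) (z := R j s) n (by
    rw [h.iterate n j hs.le]
    exact h.avoid _ _ (by positivity))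
  have hequiv := hd'.hasStrictFDerivAt_equiv hd
  set e := hequiv.toOpenPartialHomeomorph f^[n]
  have he : ∀ z, e z = f^[n] z := fun z => rfl
  have hsrc : R j s ∈ e.source := hequiv.mem_toOpenPartialHomeomorph_source
  have htgt : Ψ ξ₀ ∈ e.target := by
    rw [← hfn, ← he]
    exact e.map_source hsrc
  have hΨc : ∀ ξ : ℂ, s₀ < ξ.re → ContinuousAt Ψ ξ := fun ξ hξ =>
    h.bott.cont.continuousAt ((isOpen_lt continuous_const Complex.continuous_re).mem_nhds hξ)
  have hmem : ∀ᶠ ξ in 𝓝 ξ₀, s₀ + 1 < ξ.re ∧ Ψ ξ ∈ e.target ∧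
      R j (ξ.re / g.natDegree ^ n) ∈ e.source := by
    refine (Complex.continuous_re.continuousAt.eventually (lt_mem_nhds ?_)).and
      (((hΨc ξ₀ ?_).eventually (e.open_target.mem_nhds htgt)).and ?_)
    · rw [hξ₀re]; exact hn
    · rw [hξ₀re]; linarith
    · refine (((h.cont j).comp (Complex.continuous_re.div_const _)).continuousAt).eventually
        (e.open_source.mem_nhds ?_)
      rw [comp_apply, hξ₀re, hs₁, mul_div_cancel_left₀ _ hDn.ne']
      exact hsrc
  obtain ⟨r', hr', hball'⟩ := Metric.eventually_nhds_iff_ball.1 hmem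
  set c : ℝ := 2 * Real.pi / (g.natDegree - 1) with hc
  have hc0 : 0 < c := div_pos (by positivity) (by linarith)
  set r : ℝ := min r' (c / (1 + |κ|)) with hr
  have hκ : 0 < 1 + |κ| := by positivity
  have hr0 : 0 < r := lt_min hr' (by positivity)
  have hball : ∀ ξ ∈ ball ξ₀ r, s₀ + 1 < ξ.re ∧ Ψ ξ ∈ e.target ∧
      R j (ξ.re / g.natDegree ^ n) ∈ e.source := fun ξ hξ =>
    hball' ξ (ball_subset_ball (min_le_left _ _) hξ)
  set σ : ℂ → ℝ := fun ξ => ξ.im - κ * ξ.re - α with hσ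
  have hσ0 : ∀ ξ, σ ξ = (ξ - ξ₀).im - κ * (ξ - ξ₀).re := fun ξ => by
    simp only [hσ, Complex.sub_im, Complex.sub_re, hξ₀, line_re, line_im]
    ring
  have hσlt : ∀ ξ ∈ ball ξ₀ r, |σ ξ| < c := fun ξ hξ => by
    have h1 := mem_ball_iff_norm.1 hξ
    have h2 := Complex.abs_im_le_norm (ξ - ξ₀)
    have h3 := Complex.abs_re_le_norm (ξ - ξ₀)
    have h4 : r * (1 + |κ|) ≤ c := (le_div_iff₀ hκ).1 (min_le_right _ _)
    calc |σ ξ| ≤ |(ξ - ξ₀).im| + |κ * (ξ - ξ₀).re| := by rw [hσ0]; exact abs_sub _ _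
      _ ≤ ‖ξ - ξ₀‖ + |κ| * ‖ξ - ξ₀‖ := by rw [abs_mul]; gcongr
      _ = ‖ξ - ξ₀‖ * (1 + |κ|) := by ring
      _ < r * (1 + |κ|) := by gcongr
      _ ≤ c := h4
  set χ : ℂ → ℂ := fun ξ => e.symm (Ψ ξ) with hχ
  have hχinv : ∀ ξ ∈ ball ξ₀ r, f^[n] (χ ξ) = Ψ ξ := fun ξ hξ => by
    rw [← he]
    exact e.right_inv (hball ξ hξ).2.1
  have hχc : ContinuousOn χ (ball ξ₀ r) := e.continuousOn_symm.comp
    (fun ξ hξ => (hΨc ξ (by linarith [(hball ξ hξ).1])).continuousWithinAt)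
    fun ξ hξ => (hball ξ hξ).2.1
  have hline : ∀ ξ ∈ ball ξ₀ r, σ ξ = 0 → χ ξ ∈ raySet R := fun ξ hξ h0 => by
    have h1 := hball ξ hξ
    have hre : 0 < ξ.re := by linarith [h1.1]
    refine RaySystem.mem_raySet.2 ⟨j, ξ.re / g.natDegree ^ n, by positivity, ?_⟩
    have h2 : line κ α ξ.re = ξ := by
      apply Complex.ext
      · rw [line_re]
      · rw [line_im]
        simp only [hσ] at h0
        linarith
    have h3 : e (R j (ξ.re / g.natDegree ^ n)) = Ψ ξ := by
      rw [he, h.iterate n j (by positivity), mul_div_cancel₀ _ hDn.ne', h.base _ _ h1.1.le, h2]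
    rw [hχ]
    simp only
    rw [← h3, e.left_inv h1.2.2]
  have hoff : ∀ ξ ∈ ball ξ₀ r, σ ξ ≠ 0 → χ ξ ∉ raySet R := fun ξ hξ h0 hR => by
    have hR' : Ψ ξ ∈ raySet R := by
      obtain ⟨j', t, ht, he'⟩ := RaySystem.mem_raySet.1 hR
      refine RaySystem.mem_raySet.2 ⟨j', g.natDegree ^ n * t, by positivity, ?_⟩
      rw [← h.iterate n j' ht, he', hχinv ξ hξ]
    obtain ⟨j', hj'⟩ := h.height_eq_of_mem_raySet (hball ξ hξ).1.le hR'
    have h1 : σ ξ = height g.natDegree j' - height g.natDegree j := by rw [← hj']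
    have h2 := abs_lt.1 (hσlt ξ hξ)
    rw [h1] at h2 h0
    have h3 : height g.natDegree j' < height g.natDegree (j + 1) := by
      rw [height_add_one]; linarith
    have h4 : height g.natDegree j < height g.natDegree (j' + 1) := by
      rw [height_add_one]; linarith
    rw [(strictMono_height h.bott.two_le).lt_iff_lt] at h3 h4
    exact h0 (by rw [show j' = j by omega, sub_self])
  have hhalf : ∀ τ : ℝ, τ = 1 ∨ τ = -1 → ∀ H, H = χ '' (ball ξ₀ r ∩ {ξ | 0 < τ * σ ξ}) →
      IsPreconnected H ∧ Disjoint H (raySet R) ∧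
        ∃ z ∈ H, ∃ c > s, ∃ k > (0 : ℝ), ∀ᶠ n : ℕ in atTop,
          k * Real.exp (g.natDegree ^ n * c) ≤ ‖f^[n] z‖ := by
    rintro τ hτ H rfl
    have hτ2 : τ * τ = 1 := by rcases hτ with rfl | rfl <;> norm_num
    have hτ1 : |τ| = 1 := by rcases hτ with rfl | rfl <;> norm_num
    refine ⟨?_, ?_, ?_⟩
    · refine ((convex_ball ξ₀ r).inter ?_).isPreconnected.image _ (hχc.mono inter_subset_left)
      intro x hx y hy a b ha hb hab
      rw [mem_ofPred_eq] at hx hy ⊢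
      have h1 : τ * σ (a • x + b • y) = a * (τ * σ x) + b * (τ * σ y) := by
        simp only [hσ, Complex.add_im, Complex.add_re, Complex.smul_im, Complex.smul_re,
          smul_eq_mul]
        have : α = (a + b) * α := by rw [hab, one_mul]
        linear_combination (-τ) * this
      rw [h1]
      rcases ha.eq_or_lt with rfl | ha
      · rw [zero_add] at hab
        subst hab
        linarith
      · have := mul_pos ha hx
        have := mul_nonneg hb hy.le
        linarith
    · rw [disjoint_left]
      rintro _ ⟨ξ, ⟨hξ, hξσ⟩, rfl⟩
      rw [mem_ofPred_eq] at hξσ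
      exact hoff ξ hξ fun h0 => by rw [h0, mul_zero] at hξσ; exact lt_irrefl _ hξσ
    · set δ : ℝ := r / (2 * (2 + |κ|)) with hδ
      have hκ2 : 0 < 2 + |κ| := by positivity
      have hδ0 : 0 < δ := by positivity
      set ξ : ℂ := ξ₀ + δ * (1 + (κ + τ) * Complex.I) with hξdef
      have hsub : ξ - ξ₀ = δ * (1 + (κ + τ) * Complex.I) := by rw [hξdef]; ring
      have hξ : ξ ∈ ball ξ₀ r := by
        rw [mem_ball_iff_norm, hsub, norm_mul, Complex.norm_real, Real.norm_of_nonneg hδ0.le]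
        have h1 : ‖(1 : ℂ) + (κ + τ) * Complex.I‖ ≤ 2 + |κ| := by
          calc ‖(1 : ℂ) + (κ + τ) * Complex.I‖ ≤ ‖(1 : ℂ)‖ + ‖((κ + τ : ℝ) : ℂ) * Complex.I‖ := by
                push_cast; exact norm_add_le _ _
            _ = 1 + |κ + τ| := by
                rw [norm_mul, Complex.norm_I, mul_one, Complex.norm_real, norm_one,
                  Real.norm_eq_abs]
            _ ≤ 2 + |κ| := by linarith [abs_add_le κ τ]
        calc δ * ‖(1 : ℂ) + (κ + τ) * Complex.I‖ ≤ δ * (2 + |κ|) := by gcongr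
          _ = r / 2 := by rw [hδ]; field_simp
          _ < r := by linarith
      have hre : ξ.re = s₁ + δ := by rw [hξdef]; simp [hξ₀re]
      have hσξ : σ ξ = δ * τ := by
        rw [hσ0, hsub]
        simp
        ring
      refine ⟨χ ξ, ⟨ξ, ⟨hξ, ?_⟩, rfl⟩, ξ.re / g.natDegree ^ n, ?_, 1 / 3, by norm_num, ?_⟩
      · rw [mem_ofPred_eq, hσξ]
        nlinarith
      · rw [gt_iff_lt, lt_div_iff₀ hDn, hre, hs₁]
        linarith
      · filter_upwards [eventually_ge_atTop n] with N hN
        obtain ⟨k, rfl⟩ := Nat.exists_eq_add_of_le' hN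
        rw [iterate_add_apply, hχinv ξ hξ]
        have h1 := h.bott.exp_le_iterate (ξ := ξ) (by linarith [(hball ξ hξ).1]) k
        rw [pow_add, mul_assoc, mul_div_cancel₀ _ hDn.ne']
        linarith
  refine ⟨χ '' (ball ξ₀ r ∩ {ξ | 0 < (1 : ℝ) * σ ξ}), χ '' (ball ξ₀ r ∩ {ξ | 0 < (-1 : ℝ) * σ ξ}),
    ?_, fun H hH => ?_⟩
  · have hcont : ContinuousAt f^[n] (R j s) := (g.continuous.iterate n).continuousAt
    have himg : Ψ '' ball ξ₀ r ∈ 𝓝 (f^[n] (R j s)) := by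
      rw [hfn]
      exact h.bott.isOpenMap ξ₀ (by rw [hξ₀re]; linarith) _ (ball_mem_nhds _ hr0)
    filter_upwards [hcont.eventually himg, e.open_source.mem_nhds hsrc] with z hz hzs
    obtain ⟨ξ, hξ, hξz⟩ := hz
    have hzχ : χ ξ = z := by
      rw [hχ]
      simp only
      rw [hξz, ← he, e.left_inv hzs]
    rw [← hzχ]
    rcases lt_trichotomy (σ ξ) 0 with h0 | h0 | h0
    · exact Or.inl (Or.inr ⟨ξ, ⟨hξ, by rw [mem_ofPred_eq]; linarith⟩, rfl⟩)
    · exact Or.inr (hline ξ hξ h0)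
    · exact Or.inl (Or.inl ⟨ξ, ⟨hξ, by rw [mem_ofPred_eq]; linarith⟩, rfl⟩)
  · rcases hH with rfl | rfl
    · exact hhalf 1 (Or.inl rfl) _ rfl
    · exact hhalf (-1) (Or.inr rfl) _ rfl

theorem fullRaySystem (h : IsRayFamily g s₀ Ψ κ R) : FullRaySystem g κ R where
  toRaySystem := h.raySystem
  flow j _ hs := h.exists_flow_box j hs
  far := h.exists_ray_of_norm_gt

end IsRayFamily

theorem exists_fullRaySystem {g : Polynomial ℂ} (hg : g.Monic) (hd : 2 ≤ g.natDegree) :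
    ∃ κ R, FullRaySystem g κ R := by
  obtain ⟨s₀, Ψ, h⟩ := exists_isBottcher hg hd
  obtain ⟨κ, R, hR⟩ := h.exists_isRayFamily
  exact ⟨κ, R, hR.fullRaySystem⟩

/-! ### Periodic Fatou components of cubic polynomials -/

theorem mem_filledJulia {f : ℂ → ℂ} {z : ℂ} :
    z ∈ filledJulia f ↔ Bornology.IsBounded (range fun n => f^[n] z) := by
  rw [filledJulia, mem_ofPred_eq]

theorem mem_filledJulia_of_iterate_eq {f : ℂ → ℂ} {p : ℕ} (hp : 0 < p) {z : ℂ}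
    (hz : f^[p] z = z) : z ∈ filledJulia f := by
  rw [mem_filledJulia]
  refine (((Finset.range p).finite_toSet.image fun n => f^[n] z).isBounded).subset ?_
  rintro _ ⟨n, rfl⟩
  refine ⟨n % p, by simpa using Nat.mod_lt n hp, ?_⟩
  exact (IsPeriodicPt.iterate_mod_apply (f := f) hz n)

theorem filledJulia_subset_iterate (f : ℂ → ℂ) (p : ℕ) : filledJulia f ⊆ filledJulia f^[p] :=
    fun z hz => by
  rw [mem_filledJulia] at hz ⊢
  refine hz.subset ?_
  rintro _ ⟨n, rfl⟩
  exact ⟨p * n, by simp only [iterate_mul]⟩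

theorem fatouComponent_subset_interior {f : ℂ → ℂ} {z : ℂ} (hz : z ∈ filledJulia f)
    (hne : (fatouComponent f z).Nonempty) :
    z ∈ fatouComponent f z ∧ fatouComponent f z ⊆ interior (filledJulia f) := by
  have hmem : z ∈ fatouSet f := connectedComponentIn_nonempty_iff.1 hne
  have hzV : z ∈ fatouComponent f z := mem_connectedComponentIn hmem
  have hunion : fatouSet f = interior (filledJulia f) ∪ interior (filledJulia f)ᶜ :=
    compl_frontier_eq_union_interior
  refine ⟨hzV, isPreconnected_connectedComponentIn.subset_left_of_subset_union isOpen_interior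
    isOpen_interior (disjoint_compl_right.mono interior_subset interior_subset)
    (hunion ▸ connectedComponentIn_subset _ _) ⟨z, hzV, ?_⟩⟩
  rw [hunion] at hmem
  exact hmem.resolve_right fun h => interior_subset h hz

theorem exists_polynomial_eval_eq_iterate_cubic (c a : ℂ) (p : ℕ) :
    ∃ g : Polynomial ℂ, g.Monic ∧ g.natDegree = 3 ^ p ∧ ∀ z, g.eval z = (cubic c a)^[p] z := by
  set q : Polynomial ℂ := Polynomial.X ^ 3 + (-Polynomial.C (3 * c ^ 2) * Polynomial.X +
    Polynomial.C a) with hq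
  have hlin : (-Polynomial.C (3 * c ^ 2) * Polynomial.X + Polynomial.C a).degree <
      ((3 : ℕ) : WithBot ℕ) := by
    rw [← Polynomial.C_neg]
    exact Polynomial.degree_linear_le.trans_lt (by norm_num)
  have hmon : q.Monic := Polynomial.monic_X_pow_add hlin
  have hdeg : q.natDegree = 3 := by
    rw [hq]
    compute_degree!
  have hev : (fun z => q.eval z) = cubic c a := by
    ext z
    simp only [hq, cubic, Polynomial.eval_add, Polynomial.eval_mul, Polynomial.eval_pow,
      Polynomial.eval_X, Polynomial.eval_C, Polynomial.eval_neg]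
    ring
  refine ⟨q.comp^[p] Polynomial.X, ?_, ?_, fun z => ?_⟩
  · induction p with
    | zero => exact Polynomial.monic_X
    | succ p ih =>
      rw [iterate_succ_apply']
      refine hmon.comp ih ?_
      rw [Polynomial.natDegree_iterate_comp, hdeg, Polynomial.natDegree_X]
      positivity
  · rw [Polynomial.natDegree_iterate_comp, hdeg, Polynomial.natDegree_X, mul_one]
  · rw [Polynomial.iterate_comp_eval, hev, Polynomial.eval_X]

end RayLanding

/-- For `(c,a) ∈ S_p`, two distinct components `V₁, V₂` of the cycle of
periodic Fatou components containing the orbit of `c` meet along at most one boundary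
point, and if they meet, the common point `q` satisfies `f_{c,a}^p(q) = q`. -/
theorem touching_periodic_components_fixed_point
    (p : ℕ) (hp : 1 ≤ p) (w : ℂ × ℂ) (hw : w ∈ Sp p)
    (k₁ k₂ : ℕ) (hk₁ : k₁ < p) (hk₂ : k₂ < p)
    (hne : fatouComponent (cubic w.1 w.2) ((cubic w.1 w.2)^[k₁] w.1) ≠
      fatouComponent (cubic w.1 w.2) ((cubic w.1 w.2)^[k₂] w.1))
    (hmeet : (frontier (fatouComponent (cubic w.1 w.2) ((cubic w.1 w.2)^[k₁] w.1)) ∩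
      frontier (fatouComponent (cubic w.1 w.2) ((cubic w.1 w.2)^[k₂] w.1))).Nonempty) :
    ∃ q : ℂ,
      frontier (fatouComponent (cubic w.1 w.2) ((cubic w.1 w.2)^[k₁] w.1)) ∩
        frontier (fatouComponent (cubic w.1 w.2) ((cubic w.1 w.2)^[k₂] w.1)) = {q} ∧
      (cubic w.1 w.2)^[p] q = q := by
  obtain ⟨g, hg, hdeg, hev⟩ := RayLanding.exists_polynomial_eval_eq_iterate_cubic w.1 w.2 p
  have hd : 2 ≤ g.natDegree := by
    have := Nat.pow_le_pow_right (n := 3) (by norm_num) hp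
    omega
  obtain ⟨κ, R, hR⟩ := RayLanding.exists_fullRaySystem hg hd
  obtain ⟨ρ, hρ, hρ'⟩ := RayLanding.exists_escape_radius hd
  have hK := RayLanding.IsEscapeRadius.isClosed_filledJulia (g := g) ⟨hρ, hρ'⟩
  set f := cubic w.1 w.2
  have hgf : (fun z => g.eval z) = f^[p] := funext hev
  have hfix : ∀ k, f^[p] (f^[k] w.1) = f^[k] w.1 := fun k => by
    rw [← iterate_add_apply, add_comm, iterate_add_apply, hw.1]
  have hcomp : ∀ k, (frontier (fatouComponent f (f^[k] w.1))).Nonempty →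
      f^[k] w.1 ∈ fatouComponent f (f^[k] w.1) ∧
      fatouComponent f (f^[k] w.1) ⊆ interior (filledJulia fun z => g.eval z) := fun k hk => by
    have h1 := RayLanding.fatouComponent_subset_interior
      (RayLanding.mem_filledJulia_of_iterate_eq hp (hfix k))
      (closure_nonempty_iff.1 (hk.mono frontier_subset_closure))
    refine ⟨h1.1, h1.2.trans (interior_mono ?_)⟩
    rw [hgf]
    exact RayLanding.filledJulia_subset_iterate f p
  obtain ⟨h1, h1'⟩ := hcomp k₁ (hmeet.mono inter_subset_left)
  obtain ⟨h2, h2'⟩ := hcomp k₂ (hmeet.mono inter_subset_right)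
  obtain ⟨m, hm, hsub⟩ := hR.exists_closure_inter_subset hK
    (fun h => hne (by rw [h])) (by rw [hev, hfix]) (by rw [hev, hfix])
    isPreconnected_connectedComponentIn isPreconnected_connectedComponentIn h1' h2' h1 h2
  refine ⟨m, (hmeet.subset_singleton_iff).1 ?_, (hev m).symm.trans hm⟩
  exact (inter_subset_inter frontier_subset_closure frontier_subset_closure).trans hsub
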